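/- arXiv:1602.03424 — 4 statements merged into one kernel-verified Lean document; each statement's English description precedes it below -/
import Mathlib

section
/- Let N grains of sand be placed on the vertex v_0 at the center of the bottom boundary of a sufficiently large graph approximation SG_i of the Sierpinski gasket, and let R denote the diameter after stabilization, i.e., the maximum graph distance d(v, v_0) over all vertices v carrying at least one grain in the stabilized configuration. Then R grows asymptotically as R = Θ(N^{1/D_f}), where D_f = log 3 / log 2 is the fractal dimension of the Sierpinski gasket; explicitly, (N/60)^{1/D_f} < R < (N/2)^{1/D_f} for all sufficiently large N. -/
open Classical

namespace ASM

variable {V : Type*}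

/-- The degree of a vertex. -/
noncomputable def deg (G : SimpleGraph V) (v : V) : ℕ := (G.neighborSet v).ncard

/-- The result of toppling the vertex `v`: `v` loses `deg v` grains and each
neighbor of `v` receives one grain. -/
noncomputable def toppleAt (G : SimpleGraph V) (η : V → ℕ) (v : V) : V → ℕ :=
  fun u => if u = v then η v - deg G v else η u + (if G.Adj v u then 1 else 0)

/-- `Topples G S η l η'` means that starting from the configuration `η`, the vertices in
the list `l` may be legally toppled in order (each toppled vertex is not a sink and holds
at least `deg` many grains when toppled), resulting in the configuration `η'`.
`S` is the set of sink vertices. -/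
inductive Topples (G : SimpleGraph V) (S : Set V) : (V → ℕ) → List V → (V → ℕ) → Prop
  | nil (η : V → ℕ) : Topples G S η [] η
  | cons {η η' : V → ℕ} {l : List V} (v : V) (hv : v ∉ S) (hge : deg G v ≤ η v)
      (ht : Topples G S (toppleAt G η v) l η') : Topples G S η (v :: l) η'

/-- A configuration is stable if every non-sink vertex has fewer grains than its degree. -/
def Stable (G : SimpleGraph V) (S : Set V) (η : V → ℕ) : Prop :=
  ∀ v, v ∉ S → η v < deg G v

/-- `η` stabilizes to `η'`: there is a legal toppling sequence from `η` to the
stable configuration `η'`. -/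
def StabilizesTo (G : SimpleGraph V) (S : Set V) (η η' : V → ℕ) : Prop :=
  ∃ l : List V, Topples G S η l η' ∧ Stable G S η'

/-- A configuration `η` is recurrent if it is stable and, for every configuration `σ`,
there is a configuration `τ` such that `σ + τ` stabilizes to `η` (equality being
required away from the sinks, where grains simply accumulate). -/
def Recurrent (G : SimpleGraph V) (S : Set V) (η : V → ℕ) : Prop :=
  Stable G S η ∧
    ∀ σ : V → ℕ, ∃ τ η' : V → ℕ, StabilizesTo G S (σ + τ) η' ∧ ∀ v, v ∉ S → η' v = η v

/-- `idf G S v` is the number of edges joining `v` to sink vertices. -/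
noncomputable def idf (G : SimpleGraph V) (S : Set V) (v : V) : ℕ :=
  (G.neighborSet v ∩ S).ncard

end ASM

open ASM

/-! ### The graph approximations of the Sierpinski gasket

The level-`n` graph approximation `SG_n` of the Sierpinski gasket is realized in
triangular coordinates: rows `r = 0, …, 2^n` from the top; an upward unit cell with top
corner `(r, c)` (where `0 ≤ c ≤ r < 2^n`) belongs to the gasket exactly when the binomial
coefficient `r.choose c` is odd, and its three corners are `(r, c)`, `(r+1, c)` and
`(r+1, c+1)`.  Vertices are corners of cells, and two distinct vertices are adjacent
exactly when they are corners of a common cell.  This recovers exactly the recursive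
construction: `SG_0` is a triangle, and `SG_{i+1}` consists of three copies of `SG_i`
glued pairwise at corner vertices. -/

/-- `(r, c)` indexes an (upward) cell of the level-`n` Sierpinski gasket graph. -/
def IsCell (n r c : ℕ) : Prop := r < 2 ^ n ∧ c ≤ r ∧ ¬ (2 ∣ Nat.choose r c)

/-- `(x, y)` is one of the three corners of the cell with top corner `(r, c)`. -/
def InCorners (r c x y : ℕ) : Prop :=
  (x = r ∧ y = c) ∨ (x = r + 1 ∧ y = c) ∨ (x = r + 1 ∧ y = c + 1)

/-- `p` is a vertex of the level-`n` Sierpinski gasket graph. -/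
def IsVtx (n : ℕ) (p : ℕ × ℕ) : Prop := ∃ r c : ℕ, IsCell n r c ∧ InCorners r c p.1 p.2

/-- The vertex set of the level-`n` Sierpinski gasket graph `SG_n`. -/
def SGV (n : ℕ) : Type := {p : ℕ × ℕ // IsVtx n p}

/-- The level-`n` Sierpinski gasket graph `SG_n`: two distinct vertices are adjacent
exactly when they are corners of a common cell. -/
def SGgraph (n : ℕ) : SimpleGraph (SGV n) where
  Adj p q := p ≠ q ∧ ∃ r c : ℕ, IsCell n r c ∧
      InCorners r c p.val.1 p.val.2 ∧ InCorners r c q.val.1 q.val.2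
  symm := by constructor; rintro p q ⟨hne, r, c, h1, h2, h3⟩; exact ⟨hne.symm, r, c, h1, h3, h2⟩
  loopless := by constructor; rintro p ⟨hne, -⟩; exact hne rfl

/-- The boundary of `SG_n`: its three corner vertices. -/
def SGBoundary (n : ℕ) : Set (SGV n) :=
  {v | v.val = (0, 0) ∨ v.val = (2 ^ n, 0) ∨ v.val = (2 ^ n, 2 ^ n)}

/-- The diameter of the set of sites holding sand: the largest graph distance from `v0`
to a vertex carrying at least one grain in the configuration `η`. -/
noncomputable def reachRadius (n : ℕ) (v0 : SGV n) (η : SGV n → ℕ) : ℕ :=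
  sSup {d : ℕ | ∃ v : SGV n, 1 ≤ η v ∧ (SGgraph n).dist v0 v = d}

/-! ### Auxiliary: integer-coordinate gasket -/

namespace SGaux

def chi : ℕ → ℤ → ℤ → ℤ
  | 0, i, j => if i = 0 ∧ j = 0 then 1 else 0
  | m+1, i, j => chi m i j + chi m (i-2^m) j + chi m (i-2^m) (j-2^m)

lemma chi_out : ∀ (m : ℕ) (i j : ℤ), ¬(0 ≤ j ∧ j ≤ i ∧ i < 2^m) → chi m i j = 0
  | 0, i, j, h => by
      simp only [chi]; rw [if_neg]; rintro ⟨rfl, rfl⟩; apply h; norm_num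
  | m+1, i, j, h => by
      have hp : (0:ℤ) < 2^m := by positivity
      rw [pow_succ] at h
      simp only [chi]
      rw [chi_out m i j (by omega), chi_out m (i-2^m) j (by omega),
        chi_out m (i-2^m) (j-2^m) (by omega)]
      rfl

lemma chi_01 : ∀ (m : ℕ) (i j : ℤ), chi m i j = 0 ∨ chi m i j = 1
  | 0, i, j => by simp only [chi]; split_ifs <;> simp
  | m+1, i, j => by
      simp only [chi]
      by_cases h1 : i < 2^m
      · rw [chi_out m (i-2^m) j (by omega), chi_out m (i-2^m) (j-2^m) (by omega)]
        simpa using chi_01 m i j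
      · rw [chi_out m i j (by omega)]
        by_cases h2 : j < 2^m
        · rw [chi_out m (i-2^m) (j-2^m) (by omega)]
          simpa using chi_01 m (i-2^m) j
        · by_cases h3 : i - 2^m < 2^m
          · rw [chi_out m (i-2^m) j (by omega)]
            simpa using chi_01 m (i-2^m) (j-2^m)
          · rw [chi_out m (i-2^m) j (by omega), chi_out m (i-2^m) (j-2^m) (by omega)]
            simp

lemma chi_nonneg (m : ℕ) (i j : ℤ) : 0 ≤ chi m i j := by
  rcases chi_01 m i j with h | h <;> omega

lemma chi_refl : ∀ (m : ℕ) (i j : ℤ), chi m i (i-j) = chi m i j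
  | 0, i, j => by
      simp only [chi]
      by_cases h : i = 0 ∧ j = 0
      · rw [if_pos h, if_pos (by omega)]
      · rw [if_neg h, if_neg (by omega)]
  | m+1, i, j => by
      simp only [chi]
      have h1 := chi_refl m i j
      have h2 := chi_refl m (i-2^m) j
      have h3 := chi_refl m (i-2^m) (j-2^m)
      rw [show i - 2^m - (j - 2^m) = i - j by ring] at h3
      rw [show i - j - 2^m = i - 2^m - j by ring, h1, h2, h3]
      ring

lemma chi_top : ∀ m : ℕ, chi m 0 0 = 1
  | 0 => by simp [chi]
  | m+1 => by
      have hp : (0:ℤ) < 2^m := by positivity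
      simp only [chi]
      rw [chi_top m, chi_out m (0-2^m) 0 (by omega), chi_out m (0-2^m) (0-2^m) (by omega)]
      rfl

lemma chi_left : ∀ m : ℕ, chi m (2^m-1) 0 = 1
  | 0 => by simp [chi]
  | m+1 => by
      have hp : (0:ℤ) < 2^m := by positivity
      simp only [chi]
      rw [pow_succ, show (2:ℤ)^m*2-1-2^m = 2^m-1 by ring, chi_left m,
        chi_out m _ 0 (by omega), chi_out m (2^m-1) (0-2^m) (by omega)]
      rfl

lemma parity_step (n s c : ℕ) : (Nat.choose (2^n+s) c : ZMod 2) =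
    Nat.choose s c + (if 2^n ≤ c then (Nat.choose s (c-2^n) : ZMod 2) else 0) := by
  have h : ((1 + Polynomial.X : Polynomial (ZMod 2)))^(2^n+s)
      = (1+Polynomial.X)^s + (1+Polynomial.X)^s * Polynomial.X^(2^n) := by
    rw [pow_add, add_pow_char_pow]; ring
  have h2 := congrArg (fun p => Polynomial.coeff p c) h
  simp only [Polynomial.coeff_add, Polynomial.coeff_mul_X_pow',
    Polynomial.coeff_one_add_X_pow] at h2
  exact h2

lemma chi_choose : ∀ (n r c : ℕ), r < 2^n → (chi n r c = ((Nat.choose r c % 2 : ℕ) : ℤ))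
  | 0, r, c, h => by
      have : r = 0 := by simpa using h
      subst this
      rcases c with _ | c
      · simp [chi]
      · simp [chi]; omega
  | n+1, r, c, h => by
      have hpz : ((2^n : ℕ) : ℤ) = 2^n := by push_cast; rfl
      by_cases h1 : r < 2^n
      · have : (r:ℤ) < 2^n := by exact_mod_cast h1
        simp only [chi]
        rw [chi_choose n r c h1, chi_out n (r-2^n) c (by omega),
          chi_out n (r-2^n) (c-2^n) (by omega)]
        simp
      · obtain ⟨s, rfl⟩ : ∃ s, r = 2^n + s := ⟨r - 2^n, by omega⟩
        have hs : s < 2^n := by rw [pow_succ] at h; omega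
        have key : chi (n+1) ((2^n+s : ℕ):ℤ) c = chi n s c + chi n s (c - 2^n) := by
          simp only [chi]
          rw [chi_out n ((2^n+s : ℕ):ℤ) c (by omega)]
          push_cast
          rw [show (2:ℤ)^n + s - 2^n = s by ring]; ring
        have h01 := chi_01 (n+1) ((2^n+s : ℕ):ℤ) c
        have hmod := parity_step n s c
        have e1 := chi_choose n s c hs
        by_cases hc : 2^n ≤ c
        · have e2 := chi_choose n s (c-2^n) hs
          rw [Nat.cast_sub hc, hpz] at e2
          rw [if_pos hc] at hmod
          have hm : Nat.choose (2^n+s) c ≡ Nat.choose s c + Nat.choose s (c-2^n) [MOD 2] := by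
            rw [← ZMod.natCast_eq_natCast_iff]; push_cast; exact hmod
          unfold Nat.ModEq at hm
          omega
        · have e2 : chi n s (c-2^n) = 0 := chi_out n _ _ (by omega)
          rw [if_neg hc, add_zero] at hmod
          have hm : Nat.choose (2^n+s) c ≡ Nat.choose s c [MOD 2] := by
            rw [← ZMod.natCast_eq_natCast_iff]; exact hmod
          unfold Nat.ModEq at hm
          omega

lemma isCell_iff (n r c : ℕ) : IsCell n r c ↔ chi n r c = 1 := by
  unfold IsCell
  constructor
  · rintro ⟨h1, h2, h3⟩
    rw [chi_choose n r c h1]; omega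
  · intro h
    have h4 : 0 ≤ (c:ℤ) ∧ (c:ℤ) ≤ r ∧ (r:ℤ) < 2^n := by
      by_contra h4
      rw [chi_out n r c h4] at h; omega
    have h1 : r < 2^n := by exact_mod_cast h4.2.2
    refine ⟨h1, by omega, ?_⟩
    rw [chi_choose n r c h1] at h; omega

def Lap (m : ℕ) (f : ℤ → ℤ → ℤ) (i j : ℤ) : ℤ :=
  chi m i j * (f (i+1) j + f (i+1) (j+1) - 2 * f i j)
  + chi m (i-1) j * (f (i-1) j + f i (j+1) - 2 * f i j)
  + chi m (i-1) (j-1) * (f (i-1) (j-1) + f i (j-1) - 2 * f i j)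

def Cnt (m : ℕ) (i j : ℤ) : ℤ := chi m i j + chi m (i-1) j + chi m (i-1) (j-1)

lemma Cnt_nonneg (m : ℕ) (i j : ℤ) : 0 ≤ Cnt m i j := by
  have := chi_nonneg m i j
  have := chi_nonneg m (i-1) j
  have := chi_nonneg m (i-1) (j-1)
  unfold Cnt; omega

lemma Lap_congr (m : ℕ) (f g : ℤ → ℤ → ℤ)
    (h : ∀ a b, 0 ≤ b → b ≤ a → a ≤ 2^m → f a b = g a b) (i j : ℤ) :
    Lap m f i j = Lap m g i j := by
  unfold Lap
  have key : ∀ a b, chi m a b = 0 ∨ (f a b = g a b ∧ f (a+1) b = g (a+1) b ∧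
      f (a+1) (b+1) = g (a+1) (b+1)) := by
    intro a b
    by_cases hh : 0 ≤ b ∧ b ≤ a ∧ a < 2^m
    · right
      exact ⟨h _ _ (by omega) (by omega) (by omega), h _ _ (by omega) (by omega) (by omega),
        h _ _ (by omega) (by omega) (by omega)⟩
    · left; exact chi_out m a b hh
  have k1 := key i j
  have k2 := key (i-1) j
  have k3 := key (i-1) (j-1)
  simp only [sub_add_cancel] at k2 k3
  congr 1
  · congr 1
    · rcases k1 with k | ⟨k, k', k''⟩
      · rw [k]; ring
      · rw [k, k', k'']
    · rcases k2 with k | ⟨k, k', k''⟩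
      · rw [k]; ring
      · rw [k, k', k'']
  · rcases k3 with k | ⟨k, k', k''⟩
    · rw [k]; ring
    · rw [k, k', k'']

lemma Lap_zero (m : ℕ) (i j : ℤ) : Lap m (fun _ _ => 0) i j = 0 := by
  simp [Lap]

lemma Lap_succ (m : ℕ) (f : ℤ → ℤ → ℤ) (i j : ℤ) :
    Lap (m+1) f i j = Lap m f i j + Lap m (fun a b => f (a+2^m) b) (i-2^m) j
      + Lap m (fun a b => f (a+2^m) (b+2^m)) (i-2^m) (j-2^m) := by
  simp only [Lap, chi]
  rw [show i - 2^m + 1 + 2^m = i + 1 by ring, show i - 2^m - 1 + 2^m = i - 1 by ring,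
    show i - 2^m + 2^m = i by ring, show j - 2^m + 1 + 2^m = j + 1 by ring,
    show j - 2^m - 1 + 2^m = j - 1 by ring, show j - 2^m + 2^m = j by ring,
    show i - 1 - 2^m = i - 2^m - 1 by ring, show j - 1 - 2^m = j - 2^m - 1 by ring]
  ring

lemma Cnt_succ (m : ℕ) (i j : ℤ) :
    Cnt (m+1) i j = Cnt m i j + Cnt m (i-2^m) j + Cnt m (i-2^m) (j-2^m) := by
  simp only [Cnt, chi]
  rw [show i - 1 - 2^m = i - 2^m - 1 by ring, show j - 1 - 2^m = j - 2^m - 1 by ring]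
  ring

lemma Lap_refl (m : ℕ) (f : ℤ → ℤ → ℤ) (i j : ℤ) :
    Lap m (fun a b => f a (a-b)) i j = Lap m f i (i-j) := by
  simp only [Lap]
  have h1 := chi_refl m i j
  have h2 := chi_refl m (i-1) j
  have h3 := chi_refl m (i-1) (j-1)
  rw [show i - 1 - (j - 1) = i - j by ring] at h3
  rw [h1, h3, show i - j - 1 = i - 1 - j by ring, h2]
  rw [show i + 1 - j = i - j + 1 by ring, show i + 1 - (j+1) = i - j by ring,
    show i - (j+1) = i - 1 - j by ring, show i - 1 - (j - 1) = i - j by ring,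
    show i - (j-1) = i - j + 1 by ring]
  ring

lemma Cnt_refl (m : ℕ) (i j : ℤ) : Cnt m i (i-j) = Cnt m i j := by
  simp only [Cnt]
  have h1 := chi_refl m i j
  have h2 := chi_refl m (i-1) j
  have h3 := chi_refl m (i-1) (j-1)
  rw [show i - 1 - (j - 1) = i - j by ring] at h3
  rw [h1, h3, show i - j - 1 = i - 1 - j by ring, h2]
  ring

def E : ℕ → ℤ → ℤ → ℤ → ℤ → ℤ → ℤ
  | 0, a, b, c, i, j => if i ≤ 0 then a else if 1 ≤ j then c else b
  | m+1, a, b, c, i, j =>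
      if i ≤ 2^m then E m (5*a) (2*a+2*b+c-1) (2*a+2*c+b-1) i j
      else if 2^m ≤ j then E m (2*a+2*c+b-1) (2*b+2*c+a-1) (5*c) (i-2^m) (j-2^m)
      else E m (2*a+2*b+c-1) (5*b) (2*b+2*c+a-1) (i-2^m) j

lemma E_top : ∀ (m : ℕ) (a b c : ℤ), E m a b c 0 0 = 5^m*a
  | 0, a, b, c => by simp [E]
  | m+1, a, b, c => by
      have hp : (0:ℤ) < 2^m := by positivity
      simp only [E]; rw [if_pos (by omega), E_top m]; ring

lemma E_left : ∀ (m : ℕ) (a b c : ℤ), E m a b c (2^m) 0 = 5^m*b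
  | 0, a, b, c => by simp [E]
  | m+1, a, b, c => by
      have hp : (0:ℤ) < 2^m := by positivity
      simp only [E]; rw [pow_succ, if_neg (by omega), if_neg (by omega),
        show (2:ℤ)^m*2-2^m = 2^m by ring, E_left m]; ring

lemma E_right : ∀ (m : ℕ) (a b c : ℤ), E m a b c (2^m) (2^m) = 5^m*c
  | 0, a, b, c => by simp [E]
  | m+1, a, b, c => by
      have hp : (0:ℤ) < 2^m := by positivity
      simp only [E]; rw [pow_succ, if_neg (by omega), if_pos (by omega),
        show (2:ℤ)^m*2-2^m = 2^m by ring, E_right m]; ring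

lemma E_nonneg : ∀ (m : ℕ) (a b c : ℤ), 0 ≤ a → 0 ≤ b → 0 ≤ c → 1 ≤ a+b+c → ∀ i j,
    0 ≤ E m a b c i j
  | 0, a, b, c, ha, hb, hc, _, i, j => by simp only [E]; split_ifs <;> assumption
  | m+1, a, b, c, ha, hb, hc, h, i, j => by
      simp only [E]
      split_ifs <;> apply E_nonneg <;> omega

lemma E_zero : ∀ (m : ℕ) (i : ℤ), E m 0 0 1 i 0 = 0
  | 0, i => by simp [E]
  | m+1, i => by
      have hp : (0:ℤ) < 2^m := by positivity
      simp only [E]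
      rw [if_neg (show ¬ ((2:ℤ)^m ≤ 0) by omega)]
      split_ifs
      · simpa using E_zero m i
      · simpa using E_zero m (i-2^m)

def dl (x y i j : ℤ) : ℤ := if i = x ∧ j = y then 1 else 0

lemma dl_shift (x y i j s t : ℤ) : dl x y (i-s) (j-t) = dl (x+s) (y+t) i j := by
  unfold dl
  by_cases h : i = x + s ∧ j = y + t
  · rw [if_pos h, if_pos (by omega)]
  · rw [if_neg h, if_neg (by omega)]

lemma dl_shift' (x y i j s : ℤ) : dl x y (i-s) j = dl (x+s) y i j := by
  have := dl_shift x y i j s 0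
  simpa using this

lemma E_lap : ∀ (m : ℕ) (a b c i j : ℤ), Lap m (E m a b c) i j = Cnt m i j
    + 3^m*(b+c-2*a-1) * dl 0 0 i j + 3^m*(a+c-2*b-1) * dl (2^m) 0 i j
    + 3^m*(a+b-2*c-1) * dl (2^m) (2^m) i j
  | 0, a, b, c, i, j => by
      by_cases h1 : i = 0 ∧ j = 0
      · obtain ⟨rfl, rfl⟩ := h1
        simp [Lap, Cnt, chi, E, dl]
      by_cases h2 : i = 1 ∧ j = 0
      · obtain ⟨rfl, rfl⟩ := h2
        simp [Lap, Cnt, chi, E, dl]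
      by_cases h3 : i = 1 ∧ j = 1
      · obtain ⟨rfl, rfl⟩ := h3
        simp [Lap, Cnt, chi, E, dl]
      have e1 : ¬ (i - 1 = 0 ∧ j = 0) := by omega
      have e2 : ¬ (i - 1 = 0 ∧ j - 1 = 0) := by omega
      simp only [Lap, Cnt, chi, dl, pow_zero, if_neg h1, if_neg h2, if_neg h3, if_neg e1,
        if_neg e2]
      ring
  | m+1, a, b, c, i, j => by
      have hp : (0:ℤ) < 2^m := by positivity
      rw [Lap_succ]
      rw [Lap_congr m (E (m+1) a b c) (E m (5*a) (2*a+2*b+c-1) (2*a+2*c+b-1))]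
      rotate_left
      · intro x y h1 h2 h3
        simp only [E]; rw [if_pos h3]
      rw [Lap_congr m (fun x y => E (m+1) a b c (x+2^m) y)
        (E m (2*a+2*b+c-1) (5*b) (2*b+2*c+a-1))]
      rotate_left
      · intro x y h1 h2 h3
        simp only [E]
        by_cases hx : x = 0
        · have hy : y = 0 := by omega
          subst hx hy
          rw [if_pos (by omega), E_top, zero_add, E_left]
        · rw [if_neg (by omega)]
          by_cases hy : y = 2^m
          · have hx : x = 2^m := by omega
            subst hx hy
            rw [if_pos (le_refl _), E_right, add_sub_cancel_right, sub_self, E_left]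
          · rw [if_neg (by omega), add_sub_cancel_right]
      rw [Lap_congr m (fun x y => E (m+1) a b c (x+2^m) (y+2^m))
        (E m (2*a+2*c+b-1) (2*b+2*c+a-1) (5*c))]
      rotate_left
      · intro x y h1 h2 h3
        simp only [E]
        by_cases hx : x = 0
        · have hy : y = 0 := by omega
          subst hx hy
          rw [if_pos (by omega), E_top, zero_add, E_right]
        · rw [if_neg (by omega), if_pos (by omega), add_sub_cancel_right, add_sub_cancel_right]
      rw [E_lap m, E_lap m, E_lap m, Cnt_succ]
      simp only [dl_shift]
      simp only [dl_shift']
      rw [pow_succ 2 m, show (2:ℤ)^m*2 = 2^m+2^m by ring, zero_add]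
      ring

/-- function on a level-`m` triangle supported near the right corner -/
def F (k m : ℕ) (i j : ℤ) : ℤ :=
  if 0 < j - (2^m-2^k) ∧ j ≤ i then E k 0 0 1 (i - (2^m-2^k)) (j - (2^m-2^k)) else 0

lemma F_nonneg (k m : ℕ) (i j : ℤ) : 0 ≤ F k m i j := by
  unfold F; split_ifs
  · apply E_nonneg <;> norm_num
  · rfl

lemma F_right (k m : ℕ) : F k m (2^m) (2^m) = 5^k := by
  have hp : (0:ℤ) < 2^k := by positivity
  unfold F
  rw [if_pos (by omega), sub_sub_cancel, E_right]; ring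

lemma F_lap (k m : ℕ) (hkm : k ≤ m) : ∀ i j : ℤ,
    Lap m (F k m) i j ≤ Cnt m i j - 3^(k+1) * dl (2^m) (2^m) i j := by
  induction m, hkm using Nat.le_induction with
  | base =>
    intro i j
    rw [Lap_congr k (F k k) (E k 0 0 1), E_lap]
    · apply le_of_eq; ring
    · intro a b h1 h2 h3
      unfold F
      rw [sub_self, sub_zero, sub_zero]
      by_cases hb : b = 0
      · subst hb; rw [if_neg (by omega), E_zero]
      · rw [if_pos (by omega)]
  | succ m hkm ih =>
    intro i j
    have hp : (0:ℤ) < 2^m := by positivity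
    have hkp : (2:ℤ)^k ≤ 2^m := pow_le_pow_right₀ (by norm_num) hkm
    rw [Lap_succ]
    rw [Lap_congr m (F k (m+1)) (fun _ _ => 0), Lap_zero]
    rotate_left
    · intro a b h1 h2 h3
      unfold F
      rw [pow_succ, if_neg (by omega)]
    rw [Lap_congr m (fun a b => F k (m+1) (a+2^m) b) (fun _ _ => 0), Lap_zero]
    rotate_left
    · intro a b h1 h2 h3
      simp only [F]
      rw [pow_succ, if_neg (by omega)]
    rw [Lap_congr m (fun a b => F k (m+1) (a+2^m) (b+2^m)) (F k m)]
    rotate_left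
    · intro a b h1 h2 h3
      simp only [F]
      rw [pow_succ, show a + 2^m - (2^m*2 - 2^k) = a - (2^m-2^k) by ring,
        show b + 2^m - (2^m*2 - 2^k) = b - (2^m-2^k) by ring]
      simp only [add_le_add_iff_right]
    have h := ih (i-2^m) (j-2^m)
    rw [Cnt_succ]
    have := Cnt_nonneg m i j
    have := Cnt_nonneg m (i-2^m) j
    rw [dl_shift] at h
    rw [pow_succ 2 m, show (2:ℤ)^m*2 = 2^m+2^m by ring]
    linarith

/-- the global comparison function on `SG_{m+1}` -/
def W (k m : ℕ) (i j : ℤ) : ℤ :=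
  if j ≤ i - j then (if 2^m < i then F k m (i-2^m) j else 0)
  else (if 2^m < i then F k m (i-2^m) (i-j) else 0)

lemma W_nonneg (k m : ℕ) (i j : ℤ) : 0 ≤ W k m i j := by
  unfold W; split_ifs <;> first | apply F_nonneg | rfl

lemma F_low (k m : ℕ) (hkm : k ≤ m) (i j : ℤ) (h : j ≤ 0) : F k m i j = 0 := by
  have hkp : (2:ℤ)^k ≤ 2^m := pow_le_pow_right₀ (by norm_num) hkm
  unfold F; rw [if_neg (by omega)]

lemma W_lap (k m : ℕ) (hkm : k ≤ m) (i j : ℤ) :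
    Lap (m+1) (W k m) i j ≤ Cnt (m+1) i j - 2 * 3^(k+1) * dl (2^(m+1)) (2^m) i j := by
  have hp : (0:ℤ) < 2^m := by positivity
  rw [Lap_succ]
  rw [Lap_congr m (W k m) (fun _ _ => 0), Lap_zero]
  rotate_left
  · intro a b h1 h2 h3
    unfold W; split_ifs <;> first | omega | rfl
  rw [Lap_congr m (fun a b => W k m (a+2^m) b) (F k m)]
  rotate_left
  · intro a b h1 h2 h3
    simp only [W]
    rw [add_sub_cancel_right, if_pos (by omega)]
    split_ifs
    · rfl
    · rw [F_low k m hkm _ _ (by omega)]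
  rw [Lap_congr m (fun a b => W k m (a+2^m) (b+2^m)) (fun a b => F k m a (a-b)), Lap_refl]
  rotate_left
  · intro a b h1 h2 h3
    simp only [W]
    rw [add_sub_cancel_right, add_sub_add_right_eq_sub]
    by_cases h4 : b + 2^m ≤ a - b
    · have : b = 0 := by omega
      have : a = 2^m := by omega
      subst b a
      simp
    · rw [if_neg h4]
      split_ifs
      · rfl
      · rw [F_low k m hkm _ _ (by omega)]
  have h1 := F_lap k m hkm (i-2^m) j
  have h2 := F_lap k m hkm (i-2^m) (i-2^m-(j-2^m))
  rw [Cnt_refl] at h2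
  rw [Cnt_succ]
  have := Cnt_nonneg m i j
  rw [dl_shift'] at h1
  have h3 : dl (2^m) (2^m) (i-2^m) (i-2^m-(j-2^m)) = dl (2^m+2^m) (2^m) i j := by
    unfold dl
    by_cases h : i = 2^m+2^m ∧ j = 2^m
    · rw [if_pos h, if_pos (by omega)]
    · rw [if_neg h, if_neg (by omega)]
  rw [h3] at h2
  rw [pow_succ 2 m, show (2:ℤ)^m*2 = 2^m+2^m by ring]
  linarith

lemma Cnt_out (m : ℕ) (i j : ℤ) (h : ¬ (0 ≤ j ∧ j ≤ i ∧ i ≤ 2^m)) : Cnt m i j = 0 := by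
  unfold Cnt
  rw [chi_out _ _ _ (by omega), chi_out _ _ _ (by omega), chi_out _ _ _ (by omega)]
  rfl

/-- Every vertex other than the right corner has a cell in which it is not the right corner. -/
lemma chi_step : ∀ (m : ℕ) (i j : ℤ), 1 ≤ Cnt m i j → j < 2^m →
    1 ≤ chi m i j ∨ 1 ≤ chi m (i-1) j
  | 0, i, j, h, hj => by
      by_contra hc
      push Not at hc
      have := chi_nonneg 0 (i-1) (j-1)
      unfold Cnt at h
      have h3 : chi 0 (i-1) (j-1) ≠ 0 := by omega
      have : 0 ≤ j - 1 := by
        by_contra h4; exact h3 (chi_out _ _ _ (by omega))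
      norm_num at hj; omega
  | m+1, i, j, h, hj => by
      have hp : (0:ℤ) < 2^m := by positivity
      rw [Cnt_succ] at h
      simp only [chi]
      have a1 := chi_nonneg m i j
      have a2 := chi_nonneg m (i-2^m) j
      have a3 := chi_nonneg m (i-2^m) (j-2^m)
      have b1 := chi_nonneg m (i-1) j
      have b2 := chi_nonneg m (i-1-2^m) j
      have b3 := chi_nonneg m (i-1-2^m) (j-2^m)
      have c1 := Cnt_nonneg m i j
      have c2 := Cnt_nonneg m (i-2^m) j
      have c3 := Cnt_nonneg m (i-2^m) (j-2^m)
      rw [pow_succ] at hj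
      by_cases h1 : 1 ≤ Cnt m i j
      · by_cases hj1 : j < 2^m
        · have := chi_step m i j h1 hj1
          omega
        · have h4 : 0 ≤ j ∧ j ≤ i ∧ i ≤ 2^m := by
            by_contra h4; rw [Cnt_out m i j h4] at h1; omega
          have hi : i = 2^m := by omega
          have hj : j = 2^m := by omega
          subst hi hj
          rw [sub_self] at *
          have := chi_top m
          omega
      by_cases h2 : 1 ≤ Cnt m (i-2^m) j
      · by_cases hj1 : j < 2^m
        · have := chi_step m (i-2^m) j h2 hj1
          rw [show i - 2^m - 1 = i - 1 - 2^m by ring] at this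
          omega
        · have h4 : 0 ≤ j ∧ j ≤ i - 2^m ∧ i - 2^m ≤ 2^m := by
            by_contra h4; rw [Cnt_out m _ j h4] at h2; omega
          have hi : i = 2^m + 2^m := by omega
          have hj : j = 2^m := by omega
          subst hi hj
          have := chi_left m
          rw [show (2:ℤ)^m + 2^m - 1 - 2^m = 2^m-1 by ring, sub_self] at *
          omega
      · have := chi_step m (i-2^m) (j-2^m) (by omega) (by omega)
        rw [show i - 2^m - 1 = i - 1 - 2^m by ring] at this
        omega

end SGaux

namespace SGaux

section generic
variable {V : Type*} [Fintype V]

lemma deg_eq (G : SimpleGraph V) (v : V) :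
    (deg G v : ℤ) = ∑ u, if G.Adj u v then (1:ℤ) else 0 := by
  unfold deg
  rw [Finset.sum_boole, Set.ncard_eq_toFinset_card']
  congr 2
  ext u
  simp [SimpleGraph.adj_comm]

lemma toppleAt_cast (G : SimpleGraph V) (η : V → ℕ) (v : V) (h : deg G v ≤ η v) (u : V) :
    (toppleAt G η v u : ℤ) = η u - (if u = v then (deg G v : ℤ) else 0)
      + (if G.Adj v u then 1 else 0) := by
  unfold toppleAt
  by_cases huv : u = v
  · subst huv
    simp [h]
  · simp [huv]

lemma sum_topples (G : SimpleGraph V) {η η' : V → ℕ} {l : List V}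
    (h : Topples G ∅ η l η') : ∑ v, (η' v : ℤ) = ∑ v, (η v : ℤ) := by
  induction h with
  | nil η => rfl
  | cons v hv hge ht ih =>
    rw [ih]
    simp only [toppleAt_cast G _ v hge]
    rw [Finset.sum_add_distrib, Finset.sum_sub_distrib, Finset.sum_ite_eq' Finset.univ v, deg_eq]
    simp [SimpleGraph.adj_comm]

lemma least_action (G : SimpleGraph V) {η η' : V → ℕ} {l : List V}
    (h : Topples G ∅ η l η') : ∀ (w : V → ℤ), (∀ v, 0 ≤ w v) →
    (∀ v, (η v : ℤ) + (∑ u, if G.Adj u v then w u else 0) - deg G v * w v < deg G v) →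
    ∀ v ∈ l, 1 ≤ w v := by
  induction h with
  | nil η => intro w _ _ v hv; simp at hv
  | @cons η η' l v hv hge ht ih =>
    intro w hw hst x hx
    have hwv : 1 ≤ w v := by
      by_contra hc
      have h0 : w v = 0 := le_antisymm (by omega) (hw v)
      have h1 := hst v
      have h2 : 0 ≤ ∑ u, if G.Adj u v then w u else 0 :=
        Finset.sum_nonneg (fun u _ => by split_ifs; exacts [hw u, le_refl _])
      rw [h0] at h1
      have h3 : (deg G v : ℤ) ≤ η v := by exact_mod_cast hge
      linarith
    have key := ih (fun u => w u - if u = v then 1 else 0)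
      (fun u => by
        by_cases hu : u = v
        · subst hu; simp; exact hwv
        · simp [hu]; exact hw u)
      (fun u => by
        have h1 := hst u
        rw [toppleAt_cast G η v hge]
        have h2 : (∑ x, if G.Adj x u then (w x - if x = v then (1:ℤ) else 0) else 0)
            = (∑ x, if G.Adj x u then w x else 0) - (if G.Adj v u then 1 else 0) := by
          have : ∀ x, (if G.Adj x u then (w x - if x = v then (1:ℤ) else 0) else 0)
            = (if G.Adj x u then w x else 0) - (if x = v then (if G.Adj v u then 1 else 0) else 0) := by
            intro x
            by_cases hx : x = v
            · subst hx; split_ifs <;> simp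
            · simp [hx]
          simp only [this]
          rw [Finset.sum_sub_distrib, Finset.sum_ite_eq' Finset.univ v]
          simp
        rw [h2]
        by_cases hu : u = v
        · subst hu
          simp only [if_true, SimpleGraph.irrefl, if_false] at h1 ⊢
          linarith
        · simp only [if_neg hu]
          linarith)
    rcases List.mem_cons.1 hx with rfl | hx
    · exact hwv
    · have := key x hx
      by_cases hxv : x = v
      · subst hxv; exact hwv
      · simpa [hxv] using this

lemma support_topples (G : SimpleGraph V) {η η' : V → ℕ} {l : List V}
    (h : Topples G ∅ η l η') (y : V) (hy : 1 ≤ η' y) : 1 ≤ η y ∨ ∃ u ∈ l, G.Adj u y := by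
  induction h with
  | nil η => left; exact hy
  | @cons η η' l v hv hge ht ih =>
    rcases ih hy with h1 | ⟨u, hu, ha⟩
    · by_cases ha : G.Adj v y
      · right; exact ⟨v, by simp, ha⟩
      · left
        unfold toppleAt at h1
        by_cases hyv : y = v
        · subst hyv; simp at h1; omega
        · simpa [hyv, ha] using h1
    · right; exact ⟨u, by simp [hu], ha⟩

end generic

lemma vtx_bound {n : ℕ} (z : SGV n) : z.val.1 ≤ 2^n ∧ z.val.2 ≤ z.val.1 := by
  obtain ⟨r, c, ⟨h1, h2, h3⟩, h⟩ := z.property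
  rcases h with h | h | h <;> omega

instance (n : ℕ) : Finite (SGV n) := by
  apply Finite.of_injective
    (fun z : SGV n => ((⟨z.val.1, by have := vtx_bound z; omega⟩ : Fin (2^n+1)),
      (⟨z.val.2, by have := vtx_bound z; omega⟩ : Fin (2^n+1))))
  intro a b h
  simp only [Prod.mk.injEq, Fin.mk.injEq] at h
  exact Subtype.ext (Prod.ext h.1 h.2)

noncomputable instance (n : ℕ) : Fintype (SGV n) := Fintype.ofFinite _

/-- every integer cell comes from a natural-number cell -/
lemma cell_of_chi {n : ℕ} {i j : ℤ} (h : chi n i j = 1) :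
    ∃ r c : ℕ, i = r ∧ j = c ∧ IsCell n r c := by
  have h4 : 0 ≤ j ∧ j ≤ i ∧ i < 2^n := by
    by_contra h4
    rw [chi_out n i j h4] at h; omega
  refine ⟨i.toNat, j.toNat, by omega, by omega, ?_⟩
  rw [isCell_iff, Int.toNat_of_nonneg (by omega), Int.toNat_of_nonneg (by omega)]
  exact h

def IC (i j x y : ℤ) : Prop :=
  (x = i ∧ y = j) ∨ (x = i + 1 ∧ y = j) ∨ (x = i + 1 ∧ y = j + 1)

lemma IC_iff (r c x y : ℕ) : InCorners r c x y ↔ IC r c x y := by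
  unfold InCorners IC; omega

lemma vtx_of_chi {n : ℕ} {i j x y : ℤ} (h : chi n i j = 1) (hc : IC i j x y) :
    ∃ z : SGV n, (z.val.1 : ℤ) = x ∧ (z.val.2 : ℤ) = y := by
  obtain ⟨r, c, rfl, rfl, hcell⟩ := cell_of_chi h
  have hx : 0 ≤ x ∧ 0 ≤ y := by unfold IC at hc; omega
  refine ⟨⟨(x.toNat, y.toNat), r, c, hcell, ?_⟩, ?_, ?_⟩
  · rw [IC_iff]
    simp only
    rw [Int.toNat_of_nonneg hx.1, Int.toNat_of_nonneg hx.2]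
    exact hc
  · simp only; omega
  · simp only; omega

lemma adj_iff {n : ℕ} (p q : SGV n) : (SGgraph n).Adj p q ↔ p ≠ q ∧ ∃ i j : ℤ, chi n i j = 1 ∧
    IC i j p.val.1 p.val.2 ∧ IC i j q.val.1 q.val.2 := by
  constructor
  · rintro ⟨hne, r, c, h1, h2, h3⟩
    exact ⟨hne, r, c, (isCell_iff _ _ _).1 h1, (IC_iff _ _ _ _).1 h2, (IC_iff _ _ _ _).1 h3⟩
  · rintro ⟨hne, i, j, h1, h2, h3⟩
    obtain ⟨r, c, rfl, rfl, hcell⟩ := cell_of_chi h1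
    exact ⟨hne, r, c, hcell, (IC_iff _ _ _ _).2 h2, (IC_iff _ _ _ _).2 h3⟩

lemma vtx_ext {n : ℕ} {p q : SGV n} (h1 : (p.val.1 : ℤ) = q.val.1) (h2 : (p.val.2 : ℤ) = q.val.2) :
    p = q := Subtype.ext (Prod.ext (by exact_mod_cast h1) (by exact_mod_cast h2))

/-- explicit neighbour finset in integer coordinates -/
noncomputable def nb (n : ℕ) (i j : ℤ) : Finset (ℤ × ℤ) :=
  (if chi n i j = 1 then {(i+1, j), (i+1, j+1)} else ∅) ∪
  ((if chi n (i-1) j = 1 then {(i-1, j), (i, j+1)} else ∅) ∪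
  (if chi n (i-1) (j-1) = 1 then {(i-1, j-1), (i, j-1)} else ∅))

lemma mem_nb (n : ℕ) (i j x y : ℤ) : (x, y) ∈ nb n i j ↔
    (chi n i j = 1 ∧ ((x = i+1 ∧ y = j) ∨ (x = i+1 ∧ y = j+1))) ∨
    (chi n (i-1) j = 1 ∧ ((x = i-1 ∧ y = j) ∨ (x = i ∧ y = j+1))) ∨
    (chi n (i-1) (j-1) = 1 ∧ ((x = i-1 ∧ y = j-1) ∨ (x = i ∧ y = j-1))) := by
  unfold nb
  (split_ifs <;> simp [*]) <;> tauto

lemma adj_nb {n : ℕ} (p q : SGV n) : (SGgraph n).Adj p q ↔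
    ((q.val.1 : ℤ), (q.val.2 : ℤ)) ∈ nb n p.val.1 p.val.2 := by
  rw [adj_iff, mem_nb]
  constructor
  · rintro ⟨hne, i, j, h1, h2, h3⟩
    have hne' : ¬ ((p.val.1 : ℤ) = q.val.1 ∧ (p.val.2 : ℤ) = q.val.2) :=
      fun h => hne (vtx_ext h.1 h.2)
    unfold IC at h2 h3
    rcases h2 with ⟨h2, h2'⟩ | ⟨h2, h2'⟩ | ⟨h2, h2'⟩
    · left; rw [h2, h2']; refine ⟨h1, by omega⟩
    · right; left; rw [h2, h2', add_sub_cancel_right]; refine ⟨h1, by omega⟩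
    · right; right; rw [h2, h2', add_sub_cancel_right, add_sub_cancel_right]
      refine ⟨h1, by omega⟩
  · rintro (⟨h1, h2⟩ | ⟨h1, h2⟩ | ⟨h1, h2⟩)
    · refine ⟨fun h => by rw [h] at h2; omega, _, _, h1, ?_, ?_⟩ <;> unfold IC <;> omega
    · refine ⟨fun h => by rw [h] at h2; omega, _, _, h1, ?_, ?_⟩ <;> unfold IC <;> omega
    · refine ⟨fun h => by rw [h] at h2; omega, _, _, h1, ?_, ?_⟩ <;> unfold IC <;> omega

lemma nb_vtx {n : ℕ} {i j x y : ℤ} (h : (x, y) ∈ nb n i j) :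
    ∃ z : SGV n, (z.val.1 : ℤ) = x ∧ (z.val.2 : ℤ) = y := by
  rw [mem_nb] at h
  rcases h with ⟨h1, h2⟩ | ⟨h1, h2⟩ | ⟨h1, h2⟩ <;> apply vtx_of_chi h1 <;> unfold IC <;> omega

lemma nbr_sum {n : ℕ} (z : SGV n) (f : ℤ → ℤ → ℤ) :
    (∑ u : SGV n, if (SGgraph n).Adj u z then f u.val.1 u.val.2 else 0) =
    chi n z.val.1 z.val.2 * (f (z.val.1+1) z.val.2 + f (z.val.1+1) (z.val.2+1))
    + chi n (z.val.1-1) z.val.2 * (f (z.val.1-1) z.val.2 + f z.val.1 (z.val.2+1))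
    + chi n (z.val.1-1) (z.val.2-1) * (f (z.val.1-1) (z.val.2-1) + f z.val.1 (z.val.2-1)) := by
  rw [← Finset.sum_filter]
  have h1 : ∑ u ∈ Finset.univ.filter (fun u => (SGgraph n).Adj u z), f u.val.1 u.val.2
      = ∑ p ∈ nb n z.val.1 z.val.2, f p.1 p.2 := by
    apply Finset.sum_bij (fun (u : SGV n) _ => ((u.val.1 : ℤ), (u.val.2 : ℤ)))
    · intro u hu
      rw [← adj_nb]
      exact ((Finset.mem_filter.1 hu).2).symm
    · intro a _ b _ h
      simp only [Prod.mk.injEq] at h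
      exact vtx_ext h.1 h.2
    · rintro ⟨x, y⟩ h
      obtain ⟨u, rfl, rfl⟩ := nb_vtx h
      exact ⟨u, Finset.mem_filter.2 ⟨Finset.mem_univ _, ((adj_nb z u).2 h).symm⟩, rfl⟩
    · intro a _; rfl
  rw [h1]
  generalize (z.val.1 : ℤ) = i
  generalize (z.val.2 : ℤ) = j
  unfold nb
  rw [Finset.sum_union, Finset.sum_union]
  · have aux : ∀ (t : ℤ) (a b : ℤ × ℤ), (t = 0 ∨ t = 1) → a ≠ b →
        ∑ p ∈ (if t = 1 then ({a, b} : Finset (ℤ × ℤ)) else ∅), f p.1 p.2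
          = t * (f a.1 a.2 + f b.1 b.2) := by
      intro t a b ht hab
      rcases ht with rfl | rfl
      · simp
      · simp [Finset.sum_pair hab]
    rw [aux _ _ _ (chi_01 n _ _) (by simp), aux _ _ _ (chi_01 n _ _) (by simp),
      aux _ _ _ (chi_01 n _ _) (by simp)]
    ring
  · rw [Finset.disjoint_left]
    rintro ⟨x, y⟩
    split_ifs <;> simp <;> omega
  · rw [Finset.disjoint_left]
    rintro ⟨x, y⟩
    split_ifs <;> simp <;> omega

lemma deg_cnt {n : ℕ} (z : SGV n) : (deg (SGgraph n) z : ℤ) = 2 * Cnt n z.val.1 z.val.2 := by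
  rw [deg_eq]
  have := nbr_sum z (fun _ _ => 1)
  rw [this]; unfold Cnt; ring

lemma cnt_pos {n : ℕ} (z : SGV n) : 1 ≤ Cnt n z.val.1 z.val.2 := by
  obtain ⟨r, c, h, hc⟩ := z.property
  rw [isCell_iff] at h
  rw [IC_iff] at hc
  have h1 := chi_nonneg n z.val.1 z.val.2
  have h2 := chi_nonneg n (z.val.1-1) z.val.2
  have h3 := chi_nonneg n (z.val.1-1) (z.val.2-1)
  unfold Cnt
  unfold IC at hc
  rcases hc with ⟨a, b⟩ | ⟨a, b⟩ | ⟨a, b⟩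
  · rw [a, b] at h1 h2 h3 ⊢; omega
  · rw [a, b] at h1 h2 h3 ⊢; simp only [add_sub_cancel_right] at h1 h2 h3 ⊢; omega
  · rw [a, b] at h1 h2 h3 ⊢; simp only [add_sub_cancel_right] at h1 h2 h3 ⊢; omega

lemma cnt_le_two {n : ℕ} (z : SGV n) : Cnt n z.val.1 z.val.2 ≤ 2 := by
  by_contra hc
  unfold Cnt at hc
  have h1 := chi_01 n z.val.1 z.val.2
  have h2 := chi_01 n (z.val.1-1) z.val.2
  have h3 := chi_01 n (z.val.1-1) (z.val.2-1)
  have e1 : chi n z.val.1 z.val.2 = 1 := by omega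
  have e3 : chi n (z.val.1-1) (z.val.2-1) = 1 := by omega
  have e2 : chi n (z.val.1-1) z.val.2 = 1 := by omega
  obtain ⟨r, c, hr, hcc, hcell⟩ := cell_of_chi e3
  have hr' : (z.val.1 : ℤ) = ((r+1 : ℕ) : ℤ) := by push_cast; omega
  have hc' : (z.val.2 : ℤ) = ((c+1 : ℕ) : ℤ) := by push_cast; omega
  rw [hr', hc'] at e1
  rw [hr, hc'] at e2
  have k1 := ((isCell_iff _ _ _).2 e1).2.2
  have k2 := ((isCell_iff _ _ _).2 e2).2.2
  have k3 := hcell.2.2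
  rw [Nat.choose_succ_succ] at k1
  simp only [Nat.succ_eq_add_one] at k1
  omega

lemma lap_graph {n : ℕ} (z : SGV n) (f : ℤ → ℤ → ℤ) :
    (∑ u : SGV n, if (SGgraph n).Adj u z then f u.val.1 u.val.2 else 0)
      - deg (SGgraph n) z * f z.val.1 z.val.2 = Lap n f z.val.1 z.val.2 := by
  rw [nbr_sum, deg_cnt]; unfold Lap Cnt; ring

/-- walks towards `v0` -/
lemma walk_left (m : ℕ) (v0 : SGV (m+1)) (hv0 : v0.val = (2^(m+1), 2^m)) : ∀ (d : ℕ) (z : SGV (m+1)),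
    z.val.2 + 2^m ≤ z.val.1 → z.val.2 + d = 2^m →
    ∃ p : (SGgraph (m+1)).Walk v0 z, p.length ≤ d := by
  have hp : (0:ℤ) < 2^m := by positivity
  have hpz : ((2^m : ℕ) : ℤ) = 2^m := by push_cast; rfl
  intro d
  induction d with
  | zero =>
    intro z h1 h2
    have hb := vtx_bound z
    rw [pow_succ] at hb
    have : z = v0 := by
      apply Subtype.ext; rw [hv0]; apply Prod.ext
      · simp only; rw [pow_succ]; omega
      · simp only; omega
    subst this
    exact ⟨SimpleGraph.Walk.nil, le_refl _⟩
  | succ d ih =>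
    intro z h1 h2
    have hb := vtx_bound z
    have hc := cnt_pos z
    rw [Cnt_succ] at hc
    -- z belongs to the left sub-triangle
    have hl : 1 ≤ Cnt m (z.val.1 - 2^m) z.val.2 := by
      by_contra hl
      have a1 := Cnt_nonneg m z.val.1 z.val.2
      have a2 := Cnt_nonneg m (z.val.1-2^m) z.val.2
      have a3 := Cnt_nonneg m (z.val.1-2^m) (z.val.2-2^m)
      by_cases h3 : Cnt m (z.val.1-2^m) (z.val.2-2^m) = 0
      · have h4 : 0 ≤ (z.val.2:ℤ) ∧ (z.val.2:ℤ) ≤ z.val.1 ∧ (z.val.1:ℤ) ≤ 2^m := by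
          by_contra h4; rw [Cnt_out m _ _ h4] at hc; omega
        have e1 : (z.val.1:ℤ) = 2^m := by omega
        have e2 : (z.val.2:ℤ) = 0 := by omega
        apply hl
        rw [e1, e2, sub_self]
        unfold Cnt
        have := chi_top m
        have := chi_nonneg m (0-1) 0
        have := chi_nonneg m (0-1) (0-1)
        omega
      · apply h3; apply Cnt_out; omega
    have hs := chi_step m _ _ hl (by omega)
    -- neighbour in column +1
    have hex : ∃ x : ℤ, (x, (z.val.2:ℤ)+1) ∈ nb (m+1) z.val.1 z.val.2 ∧ (z.val.2:ℤ) + 1 + 2^m ≤ x := by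
      have g : ∀ a b : ℤ, 1 ≤ chi m (a-2^m) b → chi (m+1) a b = 1 := by
        intro a b h
        have h01 := chi_01 (m+1) a b
        have b1 := chi_nonneg m a b
        have b3 := chi_nonneg m (a-2^m) (b-2^m)
        simp only [chi] at h01 ⊢
        omega
      rcases hs with hs | hs
      · refine ⟨z.val.1+1, ?_, by omega⟩
        rw [mem_nb]; left; exact ⟨g _ _ hs, by omega⟩
      · refine ⟨z.val.1, ?_, ?_⟩
        · rw [mem_nb]; right; left
          refine ⟨g _ _ ?_, by omega⟩
          rw [show (z.val.1:ℤ) - 1 - 2^m = z.val.1 - 2^m - 1 by ring]; exact hs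
        · by_contra hlt
          rw [chi_out m _ _ (by omega)] at hs; omega
    obtain ⟨x, hx, hx2⟩ := hex
    obtain ⟨u, hu1, hu2⟩ := nb_vtx hx
    rw [← hu1, ← hu2, ← adj_nb] at hx
    obtain ⟨p, hp⟩ := ih u (by omega) (by omega)
    exact ⟨p.concat hx.symm, by simp; exact hp⟩

/-- reflection -/
lemma refl_exists {n : ℕ} (z : SGV n) : ∃ u : SGV n, u.val.1 = z.val.1 ∧ u.val.2 + z.val.2 = z.val.1 := by
  obtain ⟨r, c, h, hc⟩ := z.property
  have hz := vtx_bound z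
  have hle := h.2.1
  rw [isCell_iff, ← chi_refl] at h
  have : IC r (r-c) z.val.1 (z.val.1 - z.val.2) := by
    unfold InCorners at hc; unfold IC; omega
  obtain ⟨u, h1, h2⟩ := vtx_of_chi h this
  exact ⟨u, by omega, by omega⟩

noncomputable def rf {n : ℕ} (z : SGV n) : SGV n := (refl_exists z).choose

lemma rf_fst {n : ℕ} (z : SGV n) : (rf z).val.1 = z.val.1 := (refl_exists z).choose_spec.1
lemma rf_snd {n : ℕ} (z : SGV n) : (rf z).val.2 + z.val.2 = z.val.1 :=
  (refl_exists z).choose_spec.2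

lemma rf_rf {n : ℕ} (z : SGV n) : rf (rf z) = z := by
  have h1 := rf_fst z
  have h2 := rf_snd z
  have h3 := rf_fst (rf z)
  have h4 := rf_snd (rf z)
  apply vtx_ext <;> omega

lemma rf_adj {n : ℕ} {p q : SGV n} (h : (SGgraph n).Adj p q) : (SGgraph n).Adj (rf p) (rf q) := by
  rw [adj_iff] at h ⊢
  obtain ⟨hne, i, j, h1, h2, h3⟩ := h
  refine ⟨fun h => hne (by rw [← rf_rf p, h, rf_rf]), i, i-j, by rw [chi_refl]; exact h1, ?_, ?_⟩
  · have a := rf_fst p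
    have b := rf_snd p
    unfold IC at h2 ⊢; omega
  · have a := rf_fst q
    have b := rf_snd q
    unfold IC at h3 ⊢; omega

noncomputable def rfHom (n : ℕ) : SGgraph n →g SGgraph n := ⟨rf, fun h => rf_adj h⟩

lemma walk_right (m : ℕ) (v0 : SGV (m+1)) (hv0 : v0.val = (2^(m+1), 2^m)) (d : ℕ) (z : SGV (m+1))
    (h1 : 2^m ≤ z.val.2) (h2 : z.val.1 + d = 2^m + z.val.2) :
    ∃ p : (SGgraph (m+1)).Walk v0 z, p.length ≤ d := by
  have a := rf_fst z
  have b := rf_snd z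
  obtain ⟨p, hp⟩ := walk_left m v0 hv0 d (rf z) (by omega) (by omega)
  have hv : (rfHom (m+1)) v0 = v0 := by
    show rf v0 = v0
    have c := rf_fst v0
    have e := rf_snd v0
    have e1 : v0.val.1 = 2^(m+1) := by rw [hv0]
    have e2 : v0.val.2 = 2^m := by rw [hv0]
    rw [pow_succ] at e1
    apply vtx_ext <;> omega
  have hz : (rfHom (m+1)) (rf z) = z := rf_rf z
  exact ⟨(p.map (rfHom (m+1))).copy hv hz, by
    rw [SimpleGraph.Walk.length_copy, SimpleGraph.Walk.length_map]; exact hp⟩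

/-- every vertex is within distance `2^(m+1)` of `v0` -/
lemma walk_any (m : ℕ) (v0 : SGV (m+1)) (hv0 : v0.val = (2^(m+1), 2^m)) : ∀ (d : ℕ) (z : SGV (m+1)),
    2^m ≤ d + (z.val.1 - z.val.2) →
    ∃ p : (SGgraph (m+1)).Walk v0 z, p.length ≤ d + 2^m := by
  have hp : (0:ℤ) < 2^m := by positivity
  have hpz : ((2^m : ℕ) : ℤ) = 2^m := by push_cast; rfl
  have base : ∀ (d : ℕ) (z : SGV (m+1)), z.val.2 + 2^m ≤ z.val.1 →
      ∃ p : (SGgraph (m+1)).Walk v0 z, p.length ≤ d + 2^m := by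
    intro d z h
    have hb := vtx_bound z
    rw [pow_succ] at hb
    obtain ⟨p, hp⟩ := walk_left m v0 hv0 (2^m - z.val.2) z h (by omega)
    exact ⟨p, by omega⟩
  intro d
  induction d with
  | zero =>
    intro z h
    have hb := vtx_bound z
    exact base 0 z (by omega)
  | succ d ih =>
    intro z h
    have hb := vtx_bound z
    by_cases hl : z.val.2 + 2^m ≤ z.val.1
    · exact base _ z hl
    have a := rf_fst z
    have b := rf_snd z
    have hc := cnt_pos (rf z)
    have hs := chi_step (m+1) _ _ hc (by rw [pow_succ]; omega)
    rw [a] at hs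
    have hex : ∃ x y : ℤ, (x, y) ∈ nb (m+1) (rf z).val.1 (rf z).val.2 ∧
        y = (rf z).val.2 + 1 := by
      have c1 := chi_01 (m+1) z.val.1 (rf z).val.2
      have c2 := chi_01 (m+1) (z.val.1-1) (rf z).val.2
      rcases hs with hs | hs
      · refine ⟨z.val.1 + 1, (rf z).val.2 + 1, ?_, rfl⟩
        rw [a, mem_nb]; left; exact ⟨by omega, by omega⟩
      · refine ⟨z.val.1, (rf z).val.2 + 1, ?_, rfl⟩
        rw [a, mem_nb]; right; left; exact ⟨by omega, by omega⟩
    obtain ⟨x, y, hx, hy⟩ := hex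
    obtain ⟨u, hu1, hu2⟩ := nb_vtx hx
    rw [← hu1, ← hu2, ← adj_nb] at hx
    have hx' := rf_adj hx
    rw [rf_rf] at hx'
    have e := rf_fst u
    have f := rf_snd u
    obtain ⟨p, hp⟩ := ih (rf u) (by omega)
    exact ⟨p.concat hx'.symm, by simp; omega⟩

end SGaux

namespace SGaux

lemma walk_bound {n : ℕ} {a b : SGV n} (p : (SGgraph n).Walk a b) :
    (a.val.1 : ℤ) ≤ b.val.1 + p.length ∧ (a.val.2 : ℤ) ≤ b.val.2 + p.length ∧
    (a.val.1 : ℤ) - a.val.2 ≤ b.val.1 - b.val.2 + p.length := by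
  induction p with
  | nil => simp
  | cons h p ih =>
    rw [adj_nb, mem_nb] at h
    rw [SimpleGraph.Walk.length_cons]
    push_cast
    omega

noncomputable def A : ℕ → Finset (ℤ × ℤ)
  | 0 => {(0,0), (1,0), (1,1)}
  | m+1 => A m ∪ ((A m).image (fun p => (p.1+2^m, p.2)) ∪
      (A m).image (fun p => (p.1+2^m, p.2+2^m)))

lemma A_card : ∀ m, (A m).card ≤ 3^(m+1)
  | 0 => by simp [A]
  | m+1 => by
      have h := A_card m
      simp only [A]
      have h1 := Finset.card_union_le (A m) ((A m).image (fun p => (p.1+2^m, p.2)) ∪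
        (A m).image (fun p => (p.1+2^m, p.2+2^m)))
      have h2 := Finset.card_union_le ((A m).image (fun p : ℤ × ℤ => (p.1+2^m, p.2)))
        ((A m).image (fun p => (p.1+2^m, p.2+2^m)))
      have h3 : ((A m).image (fun p : ℤ × ℤ => (p.1+2^m, p.2))).card ≤ _ := Finset.card_image_le
      have h4 : ((A m).image (fun p : ℤ × ℤ => (p.1+2^m, p.2+2^m))).card ≤ _ :=
        Finset.card_image_le
      rw [pow_succ 3 (m+1)]
      omega

lemma mem_A : ∀ (m : ℕ) (i j : ℤ), 1 ≤ Cnt m i j → (i, j) ∈ A m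
  | 0, i, j, h => by
      by_contra hc
      simp only [A, Finset.mem_insert, Finset.mem_singleton, Prod.mk.injEq] at hc
      simp only [Cnt, chi] at h
      rw [if_neg (by omega), if_neg (by omega), if_neg (by omega)] at h
      omega
  | m+1, i, j, h => by
      rw [Cnt_succ] at h
      simp only [A, Finset.mem_union, Finset.mem_image]
      by_cases h1 : 1 ≤ Cnt m i j
      · left; exact mem_A m i j h1
      by_cases h2 : 1 ≤ Cnt m (i-2^m) j
      · right; left; exact ⟨_, mem_A m _ _ h2, by simp⟩
      · right; right; exact ⟨_, mem_A m (i-2^m) (j-2^m) (by omega), by simp⟩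

lemma deep (k m : ℕ) (hkm : k ≤ m) : ∀ i j : ℤ, 1 ≤ Cnt m i j → 2^m-2^k < j →
    1 ≤ Cnt k (i-(2^m-2^k)) (j-(2^m-2^k)) := by
  induction m, hkm using Nat.le_induction with
  | base => intro i j h _; simpa using h
  | succ m hkm ih =>
    intro i j h hj
    have hkp : (2:ℤ)^k ≤ 2^m := pow_le_pow_right₀ (by norm_num) hkm
    rw [Cnt_succ] at h
    rw [pow_succ] at hj
    have h1 : Cnt m i j = 0 := Cnt_out _ _ _ (by omega)
    have h2 : Cnt m (i-2^m) j = 0 := Cnt_out _ _ _ (by omega)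
    have := ih (i-2^m) (j-2^m) (by omega) (by omega)
    rw [pow_succ]
    rw [show i - (2^m*2-2^k) = i - 2^m - (2^m-2^k) by ring,
      show j - (2^m*2-2^k) = j - 2^m - (2^m-2^k) by ring]
    exact this

lemma card_all {n : ℕ} (S : Finset (SGV n)) : S.card ≤ 3^(n+1) := by
  refine le_trans ?_ (A_card n)
  apply Finset.card_le_card_of_injOn (fun u : SGV n => ((u.val.1 : ℤ), (u.val.2 : ℤ)))
  · intro u _
    exact mem_A n _ _ (cnt_pos u)
  · intro a _ b _ h
    simp only [Prod.mk.injEq] at h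
    exact vtx_ext h.1 h.2

lemma card_near (k m : ℕ) (hkm : k ≤ m) (S : Finset (SGV (m+1)))
    (hS : ∀ z ∈ S, (2:ℤ)^(m+1) - 2^k < z.val.1 ∧ (2:ℤ)^m - 2^k < z.val.2 ∧
      (2:ℤ)^m - 2^k < z.val.1 - z.val.2) : S.card ≤ 2 * 3^(k+1) := by
  have hkp : (2:ℤ)^k ≤ 2^m := pow_le_pow_right₀ (by norm_num) hkm
  have hA := A_card k
  have h1 := Finset.card_union_le
    ((A k).image (fun p : ℤ × ℤ => (p.1+2^m+(2^m-2^k), p.2+(2^m-2^k))))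
    ((A k).image (fun p : ℤ × ℤ => (p.1+2^m+(2^m-2^k), p.1+2^m-p.2)))
  have h3 : ((A k).image (fun p : ℤ × ℤ => (p.1+2^m+(2^m-2^k), p.2+(2^m-2^k)))).card ≤ _ :=
    Finset.card_image_le
  have h4 : ((A k).image (fun p : ℤ × ℤ => (p.1+2^m+(2^m-2^k), p.1+2^m-p.2))).card ≤ _ :=
    Finset.card_image_le
  refine le_trans (b := ((A k).image (fun p : ℤ × ℤ => (p.1+2^m+(2^m-2^k), p.2+(2^m-2^k))) ∪
    (A k).image (fun p : ℤ × ℤ => (p.1+2^m+(2^m-2^k), p.1+2^m-p.2))).card) ?_ (by omega)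
  apply Finset.card_le_card_of_injOn (fun u : SGV (m+1) => ((u.val.1 : ℤ), (u.val.2 : ℤ)))
  · intro z hz
    obtain ⟨s1, s2, s3⟩ := hS z hz
    have hc := cnt_pos z
    rw [Cnt_succ] at hc
    rw [pow_succ] at s1
    have c1 : Cnt m z.val.1 z.val.2 = 0 := by
      by_cases hk : k = m ∧ False
      · exact hk.2.elim
      · apply Cnt_out
        omega
    simp only [Finset.coe_union, Finset.coe_image, Set.mem_union, Set.mem_image, Finset.mem_coe]
    by_cases h2 : 1 ≤ Cnt m (z.val.1-2^m) z.val.2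
    · left
      refine ⟨_, mem_A k _ _ (deep k m hkm _ _ h2 s2), ?_⟩
      apply Prod.ext <;> simp only <;> ring
    · right
      have h3 : 1 ≤ Cnt m (z.val.1-2^m) (z.val.2-2^m) := by omega
      rw [← Cnt_refl, show (z.val.1:ℤ)-2^m-(z.val.2-2^m) = z.val.1 - z.val.2 by ring] at h3
      refine ⟨_, mem_A k _ _ (deep k m hkm _ _ h3 s3), ?_⟩
      apply Prod.ext
      · simp only; ring
      · simp only; ring
  · intro a _ b _ h
    simp only [Prod.mk.injEq] at h
    exact vtx_ext h.1 h.2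

section main
variable (m : ℕ) (v0 : SGV (m+1)) (hv0 : v0.val = (2^(m+1), 2^m))
include hv0

lemma ecc (z : SGV (m+1)) : (SGgraph (m+1)).Reachable v0 z ∧
    (SGgraph (m+1)).dist v0 z ≤ 2^(m+1) := by
  obtain ⟨p, hp⟩ := walk_any m v0 hv0 (2^m) z (by omega)
  refine ⟨⟨p⟩, le_trans (SimpleGraph.dist_le p) ?_⟩
  rw [pow_succ]; omega

lemma upper_core (N k : ℕ) (hN : N ≤ 2*3^(k+1)) (l : List (SGV (m+1))) (η' : SGV (m+1) → ℕ)
    (ht : Topples (SGgraph (m+1)) ∅ (fun v => if v = v0 then N else 0) l η') :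
    reachRadius (m+1) v0 η' ≤ 2^k := by
  unfold reachRadius
  apply csSup_le'
  rintro d ⟨y, hy, rfl⟩
  by_cases hk : m + 1 ≤ k
  · exact le_trans (ecc m v0 hv0 y).2 (Nat.pow_le_pow_right (by norm_num) hk)
  have hkm : k ≤ m := by omega
  have hkp : (2:ℕ)^k ≤ 2^m := Nat.pow_le_pow_right (by norm_num) hkm
  have hpz : ((2^m : ℕ) : ℤ) = 2^m := by push_cast; rfl
  have hpk : ((2^k : ℕ) : ℤ) = 2^k := by push_cast; rfl
  have hp0 : 0 < 2^k := by positivity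
  rcases support_topples _ ht y hy with h | ⟨u, hu, ha⟩
  · have : y = v0 := by by_contra hc; simp [hc] at h
    subst this; simp
  have hla := least_action _ ht (fun z => W k m z.val.1 z.val.2) (fun z => W_nonneg _ _ _ _)
    (fun z => by
      have h1 := lap_graph z (W k m)
      have h2 := W_lap k m hkm z.val.1 z.val.2
      have h3 := cnt_pos z
      have h4 := deg_cnt z
      have h5 : (N:ℤ) ≤ 2*3^(k+1) := by exact_mod_cast hN
      have h6 : ((if z = v0 then N else 0 : ℕ) : ℤ)
          = N * dl (2^(m+1)) (2^m) z.val.1 z.val.2 := by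
        unfold dl
        by_cases hz : z = v0
        · subst hz; rw [hv0]; simp
        · rw [if_neg hz, if_neg]
          · simp
          · rintro ⟨e1, e2⟩
            apply hz
            apply vtx_ext
            · rw [hv0, e1]; push_cast; rfl
            · rw [hv0, e2]; push_cast; rfl
      have h7 : dl (2^(m+1)) (2^m) z.val.1 z.val.2 = 0 ∨ dl (2^(m+1)) (2^m) z.val.1 z.val.2 = 1 := by
        unfold dl; split_ifs <;> simp
      rw [h6]
      rcases h7 with h7 | h7 <;> rw [h7] at h2 ⊢ <;> linarith) u hu
  suffices hs : ∃ p : (SGgraph (m+1)).Walk v0 u, p.length + 1 ≤ 2^k by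
    obtain ⟨p, hp⟩ := hs
    refine le_trans (SimpleGraph.dist_le (p.concat ha)) ?_
    rw [SimpleGraph.Walk.length_concat]; exact hp
  have hb := vtx_bound u
  rw [pow_succ] at hb
  simp only [W, F] at hla
  split_ifs at hla with c1 c2 c3 c2 c3
  · obtain ⟨p, hp⟩ := walk_left m v0 hv0 (2^m - u.val.2) u (by omega) (by omega)
    exact ⟨p, by omega⟩
  · omega
  · omega
  · obtain ⟨p, hp⟩ := walk_right m v0 hv0 (2^m - (u.val.1 - u.val.2)) u (by omega) (by omega)
    exact ⟨p, by omega⟩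
  · omega
  · omega

lemma dist_le_radius (η' : SGV (m+1) → ℕ) (z : SGV (m+1)) (hz : 1 ≤ η' z) :
    (SGgraph (m+1)).dist v0 z ≤ reachRadius (m+1) v0 η' := by
  unfold reachRadius
  apply le_csSup
  · refine ⟨2^(m+1), ?_⟩
    rintro d ⟨y, hy, rfl⟩
    exact (ecc m v0 hv0 y).2
  · exact ⟨z, hz, rfl⟩

lemma lower_core (N : ℕ) (hN : 4 ≤ N) (l : List (SGV (m+1))) (η' : SGV (m+1) → ℕ)
    (ht : Topples (SGgraph (m+1)) ∅ (fun v => if v = v0 then N else 0) l η')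
    (hst : Stable (SGgraph (m+1)) ∅ η') :
    ∃ t : ℕ, 2^t ≤ reachRadius (m+1) v0 η' ∧ N ≤ 54 * 3^t := by
  have hR := dist_le_radius m v0 hv0 η'
  generalize reachRadius (m+1) v0 η' = R at hR
  have hη : ∀ z, η' z ≤ 3 := by
    intro z
    have h1 := hst z (by simp)
    have h2 := deg_cnt z
    have h3 := cnt_le_two z
    omega
  have hsum : N = ∑ z, η' z := by
    have h := sum_topples _ ht
    have h2 : ∑ v : SGV (m+1), (((if v = v0 then N else 0) : ℕ) : ℤ) = N := by
      push_cast
      rw [Finset.sum_ite_eq' Finset.univ v0]; simp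
    rw [h2] at h
    exact_mod_cast h.symm
  have hle : ∀ c, (Finset.univ.filter (fun z => 1 ≤ η' z)).card ≤ c → N ≤ 3 * c := by
    intro c hc
    have q : ∑ z, η' z ≤ ∑ z, (if 1 ≤ η' z then 3 else 0) := by
      apply Finset.sum_le_sum
      intro z _
      have := hη z
      split_ifs <;> omega
    rw [← Finset.sum_filter, Finset.sum_const, smul_eq_mul] at q
    rw [hsum]
    refine le_trans q ?_
    rw [mul_comm]
    exact Nat.mul_le_mul_left 3 (by convert hc)
  have hcoord : ∀ z, 1 ≤ η' z → (2:ℤ)^(m+1) ≤ z.val.1 + R ∧ (2:ℤ)^m ≤ z.val.2 + R ∧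
      (2:ℤ)^m ≤ z.val.1 - z.val.2 + R := by
    intro z hz
    have h1 := hR z hz
    obtain ⟨p, hp⟩ := (ecc m v0 hv0 z).1.exists_walk_length_eq_dist
    have h2 := walk_bound p
    rw [hv0] at h2
    push_cast at h2
    rw [pow_succ] at h2 ⊢
    omega
  have hR1 : R ≠ 0 := by
    intro h0
    have : N ≤ 3 * 1 := by
      apply hle
      rw [Finset.card_le_one]
      have hh : ∀ z, 1 ≤ η' z → v0 = z := by
        intro z hz
        have := hR z hz
        rw [h0] at this
        exact ((ecc m v0 hv0 z).1.dist_eq_zero_iff).1 (by omega)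
      intro a ha b hb
      rw [← hh a (Finset.mem_filter.1 ha).2, ← hh b (Finset.mem_filter.1 hb).2]
    omega
  refine ⟨Nat.log 2 R, Nat.pow_log_le_self 2 hR1, ?_⟩
  have hlt := Nat.lt_pow_succ_log_self (b := 2) (by norm_num) R
  generalize Nat.log 2 R = t at hlt
  by_cases htm : t + 1 ≤ m
  · have := hle _ (card_near (t+1) m htm _ (fun z hz => by
      have h := hcoord z (Finset.mem_filter.1 hz).2
      have h2 : (R:ℤ) < 2^(t+1) := by exact_mod_cast hlt
      omega))
    rw [pow_succ, pow_succ] at this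
    omega
  · have h1 := hle _ (card_all _)
    have h2 : 3^m ≤ 3^t := Nat.pow_le_pow_right (by norm_num) (by omega)
    rw [pow_succ, pow_succ] at h1
    omega

end main

lemma rpow_three (t : ℕ) : ((3:ℝ)^t) ^ (1 / (Real.log 3 / Real.log 2)) = 2^t := by
  have h3 : (0:ℝ) < Real.log 3 := Real.log_pos (by norm_num)
  have h2 : (0:ℝ) < Real.log 2 := Real.log_pos (by norm_num)
  have h : (3:ℝ) ^ (1 / (Real.log 3 / Real.log 2)) = 2 := by
    rw [Real.rpow_def_of_pos (by norm_num), one_div_div, mul_div_cancel₀ _ h3.ne',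
      Real.exp_log (by norm_num)]
  rw [← Real.rpow_natCast, ← Real.rpow_mul (by norm_num), mul_comm, Real.rpow_mul (by norm_num), h,
    Real.rpow_natCast]

end SGaux

/-- Let `N` grains of sand be placed on the vertex `v0` at the center of
the bottom boundary of a sufficiently large graph approximation `SG_n` of the Sierpinski
gasket — "sufficiently large" meaning that no grain ever reaches the boundary — and let
`R` denote the diameter after stabilization, i.e. the maximum graph distance `d(v, v0)`
over all vertices `v` carrying at least one grain in the stabilized configuration.  Then
`R = Θ(N^(1/D_f))` where `D_f = log 3 / log 2` is the fractal dimension of the Sierpinski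
gasket; explicitly, `(N/60)^(1/D_f) < R < (N/2)^(1/D_f)` for all sufficiently large `N`. -/
theorem sg_growth_theta
    : ∃ N₀ : ℕ, ∀ N : ℕ, N₀ ≤ N →
      ∀ (n : ℕ), 1 ≤ n → ∀ (v0 : SGV n), v0.val = (2 ^ n, 2 ^ (n - 1)) →
      ∀ (l : List (SGV n)) (η' : SGV n → ℕ),
        Topples (SGgraph n) ∅ (fun v => if v = v0 then N else 0) l η' →
        Stable (SGgraph n) ∅ η' →
        (∀ b ∈ SGBoundary n, b ∉ l ∧ η' b = 0) →
        ((N : ℝ) / 60) ^ (1 / (Real.log 3 / Real.log 2)) < (reachRadius n v0 η' : ℝ) ∧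
          (reachRadius n v0 η' : ℝ) < ((N : ℝ) / 2) ^ (1 / (Real.log 3 / Real.log 2)) := by
  refine ⟨4, ?_⟩
  intro N hN n hn v0 hv0 l η' ht hst _
  obtain ⟨m, rfl⟩ : ∃ m, n = m + 1 := ⟨n - 1, by omega⟩
  rw [Nat.add_sub_cancel] at hv0
  have hα : (0:ℝ) < 1 / (Real.log 3 / Real.log 2) := by
    have h3 : (0:ℝ) < Real.log 3 := Real.log_pos (by norm_num)
    have h2 : (0:ℝ) < Real.log 2 := Real.log_pos (by norm_num)
    positivity
  constructor
  · obtain ⟨t, h1, h2⟩ := SGaux.lower_core m v0 hv0 N hN l η' ht hst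
    have h1' : (2:ℝ)^t ≤ (reachRadius (m+1) v0 η' : ℝ) := by exact_mod_cast h1
    have h2' : (N:ℝ) ≤ 54 * 3^t := by exact_mod_cast h2
    refine lt_of_lt_of_le ?_ h1'
    rw [← SGaux.rpow_three]
    apply Real.rpow_lt_rpow (by positivity) _ hα
    have : (0:ℝ) < 3^t := by positivity
    linarith
  · have hne : (N-1)/2 ≠ 0 := by omega
    have h1 := Nat.pow_log_le_self 3 hne
    have h2 := Nat.lt_pow_succ_log_self (b := 3) (by norm_num) ((N-1)/2)
    generalize Nat.log 3 ((N-1)/2) = k at h1 h2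
    have h3 := SGaux.upper_core m v0 hv0 N k (by simp only [Nat.succ_eq_add_one] at h2; omega) l η' ht
    have h3' : (reachRadius (m+1) v0 η' : ℝ) ≤ 2^k := by exact_mod_cast h3
    refine lt_of_le_of_lt h3' ?_
    rw [← SGaux.rpow_three]
    apply Real.rpow_lt_rpow (by positivity) _ hα
    have h4 : 2 * 3^k < N := by omega
    have h4' : (2:ℝ) * 3^k < N := by exact_mod_cast h4
    linarith
end

section
/- Let N be the number of grains of sand placed on the vertex v_0 of a sufficiently large graph approximation SG_i of the Sierpinski gasket, and let R be the diameter after stabilization (the maximum graph distance from v_0 of a vertex carrying at least one grain). Then R < (N/2)^{1/D_f}, where D_f = log 3 / log 2. -/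
open Classical

open ASM

section generic
variable {V : Type*} [Fintype V]

lemma deg_eq (G : SimpleGraph V) (v : V) :
    deg G v = ∑ w ∈ Finset.univ.filter (fun w => G.Adj v w), 1 := by
  unfold deg
  rw [← Finset.card_eq_sum_ones, Set.ncard_eq_toFinset_card']
  congr 1
  ext w
  simp

lemma sum_count_cons (G : SimpleGraph V) (v a : V) (l : List V) :
    ∑ w ∈ Finset.univ.filter (fun w => G.Adj v w), (a :: l).count w
      = (∑ w ∈ Finset.univ.filter (fun w => G.Adj v w), l.count w) + (if G.Adj v a then 1 else 0) := by
  simp only [List.count_cons, Finset.sum_add_distrib]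
  congr 1
  simp [Finset.sum_ite_eq]

lemma topples_count {G : SimpleGraph V} {S : Set V} {η η' : V → ℕ} {l : List V}
    (h : Topples G S η l η') (v : V) :
    η' v + deg G v * l.count v
      = η v + ∑ w ∈ Finset.univ.filter (fun w => G.Adj v w), l.count w := by
  induction h with
  | nil η => simp
  | @cons η η' l a hv hge ht ih =>
    rw [sum_count_cons]
    unfold toppleAt at ih
    by_cases h : v = a
    · subst h
      simp at ih ⊢
      rw [mul_add]
      omega
    · have h2 : ¬ a = v := fun e => h e.symm
      simp [h, G.adj_comm a v, List.count_cons, h2] at ih ⊢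
      split_ifs at * <;> omega

lemma least_action {G : SimpleGraph V} {S : Set V} {η η' : V → ℕ} {l : List V}
    (h : Topples G S η l η') (v0 : V) (η0 H : V → ℕ)
    (hH : ∀ v, v ≠ v0 →
      η0 v + ∑ w ∈ Finset.univ.filter (fun w => G.Adj v w), H w < deg G v * (H v + 1)) :
    ∀ c : V → ℕ,
    (∀ v, η v + deg G v * c v = η0 v + ∑ w ∈ Finset.univ.filter (fun w => G.Adj v w), c w) →
    (∀ v, c v ≤ H v) → (c v0 + l.count v0 ≤ H v0) → ∀ v, c v + l.count v ≤ H v := by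
  induction h with
  | nil η => intro c _ h2 _ v; simpa using h2 v
  | @cons η η' l a hv hge ht ih =>
    intro c h1 h2 h3 v
    have key : c a + 1 ≤ H a := by
      by_cases ha : a = v0
      · subst ha; simp at h3; omega
      · by_contra hcon
        have hca : c a = H a := le_antisymm (h2 a) (by omega)
        have e1 := h1 a
        have e2 := hH a ha
        have e3 : ∑ w ∈ Finset.univ.filter (fun w => G.Adj a w), c w ≤
          ∑ w ∈ Finset.univ.filter (fun w => G.Adj a w), H w :=
          Finset.sum_le_sum (fun w _ => h2 w)
        rw [hca] at e1
        rw [mul_add] at e2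
        omega
    have := ih (fun w => c w + if w = a then 1 else 0) ?_ ?_ ?_ v
    · simp only [List.count_cons]
      by_cases hva : v = a
      · subst hva; simp at this ⊢; omega
      · have h2 : ¬ a = v := fun e => hva e.symm
        simp [hva, h2] at this ⊢; omega
    · intro w
      have e1 := h1 w
      simp only [Finset.sum_add_distrib]
      rw [Finset.sum_ite_eq']
      unfold toppleAt
      by_cases hwa : w = a
      · subst hwa; simp [mul_add]; omega
      · simp [hwa, G.adj_comm a w]; omega
    · intro w
      by_cases hwa : w = a
      · subst hwa; simpa using key
      · simpa [hwa] using h2 w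
    · by_cases hwa : v0 = a
      · subst hwa; simp at h3 ⊢; omega
      · have h2 : ¬ a = v0 := fun e => hwa e.symm
        simp [hwa, List.count_cons, h2] at h3 ⊢; omega

lemma last_topple {G : SimpleGraph V} {S : Set V} {η η' : V → ℕ} {l : List V}
    (h : Topples G S η l η') : ∀ (t : ℕ) (L : V → ℕ), (∀ v, L v ≤ t) →
    (∀ v w, L v = L w → 0 < L v → v = w) →
    (∀ v, (Finset.univ.filter (fun w => G.Adj v w ∧ L v < L w)).card ≤ η v) →
    ∃ L' : V → ℕ, (∀ v w, L' v = L' w → 0 < L' v → v = w) ∧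
      (∀ v, (Finset.univ.filter (fun w => G.Adj v w ∧ L' v < L' w)).card ≤ η' v) ∧
      ∀ v, (0 < L v ∨ v ∈ l) → 0 < L' v := by
  induction h with
  | nil η => intro t L _ h2 h3; exact ⟨L, h2, h3, by simp⟩
  | @cons η η' l a hv hge ht ih =>
    intro t L h1 h2 h3
    have hih := ih (t+1) (fun v => if v = a then t + 1 else L v) ?_ ?_ ?_
    · obtain ⟨L', a1, a2, a3⟩ := hih
      refine ⟨L', a1, a2, ?_⟩
      intro v hv
      apply a3
      by_cases hva : v = a
      · left; simp [hva]
      · simp [hva] at hv ⊢; exact hv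
    · intro v; have := h1 v; show (if v = a then t + 1 else L v) ≤ t + 1; split_ifs <;> omega
    · intro v w
      have := h1 v
      have := h1 w
      have := h2 v w
      split_ifs with e1 e2 e2
      · intros; rw [e1, e2]
      · intros; omega
      · intros; omega
      · exact this
    · intro v
      unfold toppleAt
      by_cases hva : v = a
      · subst hva
        have : (Finset.univ.filter (fun w => G.Adj v w ∧
          (if v = v then t + 1 else L v) < (if w = v then t + 1 else L w))) = ∅ := by
          ext w
          have := h1 w
          simp
          intro _
          split_ifs <;> omega
        simp only at this ⊢
        rw [this]; simp
      · have h3v := h3 v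
        simp only [hva, if_false]
        by_cases hadj : G.Adj a v
        · simp only [hadj, if_true]
          refine le_trans (Finset.card_le_card (t := insert a (Finset.univ.filter (fun w => G.Adj v w ∧ L v < L w))) ?_) (le_trans (Finset.card_insert_le _ _) (by omega))
          intro w
          simp
          intro hw hl
          by_cases hwa : w = a
          · left; exact hwa
          · right; simp [hwa] at hl; exact ⟨hw, hl⟩
        · simp only [hadj, if_false, add_zero]
          refine le_trans (Finset.card_le_card ?_) h3v
          intro w
          simp
          intro hw hl
          have hwa : w ≠ a := by rintro rfl; exact hadj hw.symm
          simp [hwa] at hl; exact ⟨hw, hl⟩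

lemma topples_sum {G : SimpleGraph V} {S : Set V} {η η' : V → ℕ} {l : List V}
    (h : Topples G S η l η') : ∑ v, η' v = ∑ v, η v := by
  have h1 : ∑ v, (η' v + deg G v * l.count v) =
    ∑ v, (η v + ∑ w ∈ Finset.univ.filter (fun w => G.Adj v w), l.count w) :=
    Finset.sum_congr rfl (fun v _ => topples_count h v)
  rw [Finset.sum_add_distrib, Finset.sum_add_distrib] at h1
  have h2 : ∑ v, ∑ w ∈ Finset.univ.filter (fun w => G.Adj v w), l.count w
      = ∑ v, deg G v * l.count v := by
    simp only [Finset.sum_filter]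
    rw [Finset.sum_comm]
    apply Finset.sum_congr rfl
    intro w _
    rw [deg_eq, Finset.sum_mul, Finset.sum_filter]
    simp [G.adj_comm w]
  omega

end generic

/-- Numeric relation. -/
def GRel : ℕ → ℕ → ℕ → ℕ → ℕ → ℕ → ℕ → Prop
  | 0, a, b, c, α, β, γ => b + c ≤ α ∧ a + c ≤ β ∧ a + b ≤ γ
  | k + 1, a, b, c, α, β, γ => ∃ x y z x1 x2 y1 y2 z1 z2,
      GRel k a x y α x1 y1 ∧ GRel k x b z x2 β z1 ∧ GRel k y z c y2 z2 γ ∧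
      x1 + x2 ≤ 4 * x + 3 ∧ y1 + y2 ≤ 4 * y + 3 ∧ z1 + z2 ≤ 4 * z + 3

lemma GRel.swapBC {k a b c α β γ : ℕ} (h : GRel k a b c α β γ) : GRel k a c b α γ β := by
  induction k generalizing a b c α β γ with
  | zero => simp only [GRel] at *; omega
  | succ k ih =>
    obtain ⟨x, y, z, x1, x2, y1, y2, z1, z2, h1, h2, h3, h4, h5, h6⟩ := h
    exact ⟨y, x, z, y1, y2, x1, x2, z2, z1, ih h1, ih h3, ih h2, h5, h4, by omega⟩

lemma GRel.swapAB {k a b c α β γ : ℕ} (h : GRel k a b c α β γ) : GRel k b a c β α γ := by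
  induction k generalizing a b c α β γ with
  | zero => simp only [GRel] at *; omega
  | succ k ih =>
    obtain ⟨x, y, z, x1, x2, y1, y2, z1, z2, h1, h2, h3, h4, h5, h6⟩ := h
    exact ⟨x, z, y, x2, x1, z1, z2, y1, y2, ih h2, ih h1, ih h3, by omega, by omega, by omega⟩

lemma GRel.gmin {k a b c α β γ a' b' c' α' β' γ' : ℕ} (h : GRel k a b c α β γ)
    (h' : GRel k a' b' c' α' β' γ') :
    GRel k (min a a') (min b b') (min c c') (min α α') (min β β') (min γ γ') := by
  induction k generalizing a b c α β γ a' b' c' α' β' γ' with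
  | zero => simp only [GRel] at *; omega
  | succ k ih =>
    obtain ⟨x, y, z, x1, x2, y1, y2, z1, z2, h1, h2, h3, h4, h5, h6⟩ := h
    obtain ⟨x', y', z', x1', x2', y1', y2', z1', z2', h1', h2', h3', h4', h5', h6'⟩ := h'
    exact ⟨_, _, _, _, _, _, _, _, _, ih h1 h1', ih h2 h2', ih h3 h3', by omega, by omega, by omega⟩

lemma GRel.up {k a b c α β γ α' β' γ' : ℕ} (h : GRel k a b c α β γ)
    (hα : α ≤ α') (hβ : β ≤ β') (hγ : γ ≤ γ') : GRel k a b c α' β' γ' := by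
  induction k generalizing a b c α β γ α' β' γ' with
  | zero => simp only [GRel] at *; omega
  | succ k ih =>
    obtain ⟨x, y, z, x1, x2, y1, y2, z1, z2, h1, h2, h3, h4, h5, h6⟩ := h
    exact ⟨x, y, z, x1, x2, y1, y2, z1, z2, ih h1 hα le_rfl le_rfl, ih h2 le_rfl hβ le_rfl,
      ih h3 le_rfl le_rfl hγ, h4, h5, h6⟩

lemma GRel.const (k K : ℕ) {a b c : ℕ} (ha : a ≤ K) (hb : b ≤ K) (hc : c ≤ K) :
    GRel k a b c (2 * K) (2 * K) (2 * K) := by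
  induction k generalizing a b c with
  | zero => simp only [GRel] at *; omega
  | succ k ih =>
    exact ⟨K, K, K, _, _, _, _, _, _, ih ha le_rfl le_rfl, ih le_rfl hb le_rfl,
      ih le_rfl le_rfl hc, by omega, by omega, by omega⟩

lemma GRel.down {k a b c α β γ a' b' c' : ℕ} (h : GRel k a b c α β γ)
    (ha : a' ≤ a) (hb : b' ≤ b) (hc : c' ≤ c) : GRel k a' b' c' α β γ := by
  have h1 := h.gmin (GRel.const k (a' + b' + c') (a := a') (b := b') (c := c')
    (by omega) (by omega) (by omega))
  rw [min_eq_right ha, min_eq_right hb, min_eq_right hc] at h1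
  exact h1.up (min_le_left _ _) (min_le_left _ _) (min_le_left _ _)

lemma GRel.sy {k a b c α β γ : ℕ} (h : GRel k a b c α β γ) :
    GRel k a (min b c) (min b c) α (min β γ) (min β γ) := by
  have := h.gmin h.swapBC
  rwa [min_self, min_self, min_comm c b, min_comm γ β] at this

/-- Driving enough. -/
def PP (k M : ℕ) : Prop := ∀ α β γ, GRel k M 0 0 α β γ → 2 ≤ β

lemma PP.mono {k M M' : ℕ} (h : PP k M) (hM : M ≤ M') : PP k M' :=
  fun α β γ hr => h α β γ (hr.down hM le_rfl le_rfl)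

lemma PP.out {k M b c α β γ : ℕ} (h : PP k M) (hr : GRel k M b c α β γ) : 2 ≤ β ∧ 2 ≤ γ :=
  ⟨h _ _ _ (hr.down le_rfl (Nat.zero_le _) (Nat.zero_le _)),
    h _ _ _ (hr.swapBC.down le_rfl (Nat.zero_le _) (Nat.zero_le _))⟩

lemma PP.step {k a b c α β γ x y z x1 x2 y1 y2 z1 z2 : ℕ} (hP : PP (k + 1) a)
    (hA : GRel k a x y α x1 y1) (hB : GRel k x b z x2 β z1) (hC : GRel k y z c y2 z2 γ)
    (hx : x1 + x2 ≤ 4 * x + 3) (hy : y1 + y2 ≤ 4 * y + 3) (hz : z1 + z2 ≤ 4 * z + 3) :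
    1 ≤ x ∧ 1 ≤ y ∧ 1 ≤ z ∧ PP k a ∧ PP k x ∧ PP k y := by
  have zero : GRel k 0 0 0 0 0 0 := GRel.const k 0 le_rfl le_rfl le_rfl
  have key1 : ∀ α β γ, GRel k a 0 0 α β γ → 4 ≤ β ∨ 4 ≤ γ := by
    intro α β γ h
    by_contra hcon
    have := hP α 0 0 ⟨0, 0, 0, β, 0, γ, 0, 0, 0, h, zero, zero, by omega, by omega, by omega⟩
    omega
  have hPa : PP k a := by
    intro α β γ h
    have h2 := h.sy
    rw [min_self] at h2
    have := key1 _ _ _ h2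
    omega
  have hx1 : 1 ≤ x := by
    by_contra hcon
    have := key1 _ _ _ (hA.sy.down le_rfl (Nat.zero_le _) (Nat.zero_le _))
    omega
  have hy1 : 1 ≤ y := by
    by_contra hcon
    have := key1 _ _ _ (hA.sy.down le_rfl (Nat.zero_le _) (Nat.zero_le _))
    omega
  have hm : PP k (min x y) := by
    intro α' β' γ' h
    by_contra hcon
    have h2 := h.sy
    rw [min_self] at h2
    have hB' := hB.down (min_le_left x y) (Nat.zero_le b) (Nat.zero_le z)
    have hC' := hC.down (min_le_right x y) (Nat.zero_le z) (Nat.zero_le c)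
    have h3 := (hB'.gmin hC').gmin h2
    simp only [min_self] at h3
    have h4 := h3.up (α' := min x2 y2) (β' := 1) (γ' := 1) (by omega) (by omega) (by omega)
    have := hP _ _ _ ⟨min x y, min x y, 0, _, _, _, _, _, _, hA.sy, h4, h4, by omega, by omega, by omega⟩
    omega
  have hPx := hm.mono (min_le_left x y)
  have hPy := hm.mono (min_le_right x y)
  refine ⟨hx1, hy1, ?_, hPa, hPx, hPy⟩
  have := (hPx.out hB).2
  have := (hPy.out hC).1
  omega

/-- In-sum at the top of a copy. -/
def sD (f : ℕ → ℕ → ℕ) (x y : ℕ) : ℕ := f (x + 1) y + f (x + 1) (y + 1)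
/-- In-sum at the left of a copy. -/
def sE (f : ℕ → ℕ → ℕ) (x y : ℕ) : ℕ := f (x - 1) y + f x (y + 1)
/-- In-sum at the right of a copy. -/
def sF (f : ℕ → ℕ → ℕ) (x y : ℕ) : ℕ := f (x - 1) (y - 1) + f x (y - 1)

/-- Superstability inside a copy. -/
def Sol (f : ℕ → ℕ → ℕ) : ℕ → ℕ → ℕ → Prop
  | 0, _, _ => True
  | k + 1, r, c => Sol f k r c ∧ Sol f k (r + 2 ^ k) c ∧ Sol f k (r + 2 ^ k) (c + 2 ^ k) ∧
      sE f (r + 2 ^ k) c + sD f (r + 2 ^ k) c ≤ 4 * f (r + 2 ^ k) c + 3 ∧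
      sF f (r + 2 ^ k) (c + 2 ^ k) + sD f (r + 2 ^ k) (c + 2 ^ k)
        ≤ 4 * f (r + 2 ^ k) (c + 2 ^ k) + 3 ∧
      sF f (r + 2 ^ k + 2 ^ k) (c + 2 ^ k) + sE f (r + 2 ^ k + 2 ^ k) (c + 2 ^ k)
        ≤ 4 * f (r + 2 ^ k + 2 ^ k) (c + 2 ^ k) + 3

/-- Interior vertices of a copy. -/
def Jn : ℕ → ℕ → ℕ → ℕ → ℕ → Prop
  | 0, _, _, _, _ => False
  | k + 1, r, c, x, y => (x = r + 2 ^ k ∧ y = c) ∨ (x = r + 2 ^ k ∧ y = c + 2 ^ k) ∨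
      (x = r + 2 ^ k + 2 ^ k ∧ y = c + 2 ^ k) ∨
      Jn k r c x y ∨ Jn k (r + 2 ^ k) c x y ∨ Jn k (r + 2 ^ k) (c + 2 ^ k) x y

/-- Corners of a copy. -/
def Cor (k r c x y : ℕ) : Prop :=
  (x = r ∧ y = c) ∨ (x = r + 2 ^ k ∧ y = c) ∨ (x = r + 2 ^ k ∧ y = c + 2 ^ k)

lemma sol_rel {f : ℕ → ℕ → ℕ} {k r c : ℕ} (h : Sol f k r c) :
    GRel k (f r c) (f (r + 2 ^ k) c) (f (r + 2 ^ k) (c + 2 ^ k))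
      (sD f r c) (sE f (r + 2 ^ k) c) (sF f (r + 2 ^ k) (c + 2 ^ k)) := by
  induction k generalizing r c with
  | zero => simp [GRel, sD, sE, sF]
  | succ k ih =>
    obtain ⟨h1, h2, h3, h4, h5, h6⟩ := h
    have e2 := ih h2
    have e3 := ih h3
    have e : r + 2 ^ (k + 1) = r + 2 ^ k + 2 ^ k := by ring
    have e' : c + 2 ^ (k + 1) = c + 2 ^ k + 2 ^ k := by ring
    rw [e, e']
    exact ⟨_, _, _, _, _, _, _, _, _, ih h1, e2, e3, h4, h5, h6⟩

lemma sol_pos {f : ℕ → ℕ → ℕ} {k r c : ℕ} (h : Sol f k r c)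
    (hP : PP k (f r c) ∨ PP k (f (r + 2 ^ k) c) ∨ PP k (f (r + 2 ^ k) (c + 2 ^ k))) :
    ∀ x y, Jn k r c x y → 1 ≤ f x y := by
  induction k generalizing r c with
  | zero => intro x y h; exact h.elim
  | succ k ih =>
    obtain ⟨h1, h2, h3, h4, h5, h6⟩ := h
    have e1 := sol_rel h1
    have e2 := sol_rel h2
    have e3 := sol_rel h3
    have e : r + 2 ^ (k + 1) = r + 2 ^ k + 2 ^ k := by ring
    have e' : c + 2 ^ (k + 1) = c + 2 ^ k + 2 ^ k := by ring
    rw [e, e'] at hP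
    have key : 1 ≤ f (r + 2 ^ k) c ∧ 1 ≤ f (r + 2 ^ k) (c + 2 ^ k) ∧
        1 ≤ f (r + 2 ^ k + 2 ^ k) (c + 2 ^ k) ∧
        (PP k (f r c) ∨ PP k (f (r + 2 ^ k) c) ∨ PP k (f (r + 2 ^ k) (c + 2 ^ k))) ∧
        (PP k (f (r + 2 ^ k) c) ∨ PP k (f (r + 2 ^ k + 2 ^ k) c) ∨
          PP k (f (r + 2 ^ k + 2 ^ k) (c + 2 ^ k))) ∧
        (PP k (f (r + 2 ^ k) (c + 2 ^ k)) ∨ PP k (f (r + 2 ^ k + 2 ^ k) (c + 2 ^ k)) ∨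
          PP k (f (r + 2 ^ k + 2 ^ k) (c + 2 ^ k + 2 ^ k))) := by
      rcases hP with hP | hP | hP
      · have := hP.step e1 e2 e3 h4 h5 h6
        tauto
      · have := hP.step e2.swapAB e1.swapAB e3.swapAB (by omega) h6 h5
        tauto
      · have := hP.step e3.swapBC.swapAB e1.swapBC.swapAB e2.swapBC.swapAB (by omega) (by omega) h4
        tauto
    obtain ⟨k1, k2, k3, k4, k5, k6⟩ := key
    intro x y hj
    rcases hj with ⟨rfl, rfl⟩ | ⟨rfl, rfl⟩ | ⟨rfl, rfl⟩ | hj | hj | hj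
    · exact k1
    · exact k2
    · exact k3
    · exact ih h1 k4 x y hj
    · exact ih h2 k5 x y hj
    · exact ih h3 k6 x y hj

lemma sol_congr {f g : ℕ → ℕ → ℕ} {k r c : ℕ} (h : Sol f k r c)
    (hfg : ∀ x y, r ≤ x → x ≤ r + 2 ^ k → c ≤ y → y + r ≤ c + x → f x y = g x y) :
    Sol g k r c := by
  induction k generalizing r c with
  | zero => trivial
  | succ k ih =>
    obtain ⟨h1, h2, h3, h4, h5, h6⟩ := h
    have e : r + 2 ^ (k + 1) = r + 2 ^ k + 2 ^ k := by ring
    have pos : 0 < 2 ^ k := by positivity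
    rw [e] at hfg
    refine ⟨ih h1 ?_, ih h2 ?_, ih h3 ?_, ?_, ?_, ?_⟩
    · intros; apply hfg <;> omega
    · intros; apply hfg <;> omega
    · intros; apply hfg <;> omega
    · unfold sE sD at *
      rw [← hfg, ← hfg, ← hfg, ← hfg, ← hfg]
      · exact h4
      all_goals omega
    · unfold sF sD at *
      rw [← hfg, ← hfg, ← hfg, ← hfg, ← hfg]
      · exact h5
      all_goals omega
    · unfold sF sE at *
      rw [← hfg, ← hfg, ← hfg, ← hfg, ← hfg]
      · exact h6
      all_goals omega

lemma rel_real {k a b c α β γ : ℕ} (h : GRel k a b c α β γ) (r s : ℕ) :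
    ∃ g : ℕ → ℕ → ℕ, g r s = a ∧ g (r + 2 ^ k) s = b ∧ g (r + 2 ^ k) (s + 2 ^ k) = c ∧
      sD g r s ≤ α ∧ sE g (r + 2 ^ k) s ≤ β ∧ sF g (r + 2 ^ k) (s + 2 ^ k) ≤ γ ∧
      Sol g k r s := by
  induction k generalizing a b c α β γ r s with
  | zero =>
    simp only [GRel] at h
    refine ⟨fun x y => if x = r then a else if y = s then b else c, ?_⟩
    simp [sD, sE, sF, Sol]
    omega
  | succ k ih =>
    obtain ⟨x, y, z, x1, x2, y1, y2, z1, z2, h1, h2, h3, h4, h5, h6⟩ := h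
    obtain ⟨gA, A1, A2, A3, A4, A5, A6, A7⟩ := ih h1 r s
    obtain ⟨gB, B1, B2, B3, B4, B5, B6, B7⟩ := ih h2 (r + 2 ^ k) s
    obtain ⟨gC, C1, C2, C3, C4, C5, C6, C7⟩ := ih h3 (r + 2 ^ k) (s + 2 ^ k)
    have e : r + 2 ^ (k + 1) = r + 2 ^ k + 2 ^ k := by ring
    have e' : s + 2 ^ (k + 1) = s + 2 ^ k + 2 ^ k := by ring
    have pos : 0 < 2 ^ k := by positivity
    rw [e, e']
    generalize hh : 2 ^ k = p at *
    obtain ⟨g, hg⟩ : ∃ g : ℕ → ℕ → ℕ, g = fun i j => if i ≤ r + p then gA i j else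
      if j < s + p then gB i j else gC i j := ⟨_, rfl⟩
    have gAe : ∀ i j, i ≤ r + p → gA i j = g i j := by
      intro i j h; rw [hg]; simp [h]
    have gBe : ∀ i j, r + p ≤ i → i ≤ r + p + p → s ≤ j → j + (r + p) ≤ s + i →
        gB i j = g i j := by
      intro i j q1 q2 q3 q4
      rw [hg]; dsimp only
      split_ifs with c1 c2
      · have : i = r + p := by omega
        have : j = s := by omega
        subst i j; rw [A2, B1]
      · rfl
      · have : i = r + p + p := by omega
        have : j = s + p := by omega
        subst i j; rw [B3, C2]
    have gCe : ∀ i j, r + p ≤ i → i ≤ r + p + p → s + p ≤ j → j + (r + p) ≤ s + p + i →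
        gC i j = g i j := by
      intro i j q1 q2 q3 q4
      rw [hg]; dsimp only
      split_ifs with c1 c2
      · have : i = r + p := by omega
        have : j = s + p := by omega
        subst i j; rw [A3, C1]
      · omega
      · rfl
    have hA1 := gAe r s (by omega)
    have hA2 := gAe (r + p) s (by omega)
    have hA3 := gAe (r + p) (s + p) (by omega)
    have hB2 := gBe (r + p + p) s (by omega) (by omega) (by omega) (by omega)
    have hB3 := gBe (r + p + p) (s + p) (by omega) (by omega) (by omega) (by omega)
    have hC3 := gCe (r + p + p) (s + p + p) (by omega) (by omega) (by omega) (by omega)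
    have dA : sD gA r s = sD g r s := by
      unfold sD; rw [gAe, gAe] <;> omega
    have eA : sE gA (r + p) s = sE g (r + p) s := by
      unfold sE; rw [gAe, gAe] <;> omega
    have fA : sF gA (r + p) (s + p) = sF g (r + p) (s + p) := by
      unfold sF; rw [gAe, gAe] <;> omega
    have dB : sD gB (r + p) s = sD g (r + p) s := by
      unfold sD; rw [gBe, gBe] <;> omega
    have eB : sE gB (r + p + p) s = sE g (r + p + p) s := by
      unfold sE; rw [gBe, gBe] <;> omega
    have fB : sF gB (r + p + p) (s + p) = sF g (r + p + p) (s + p) := by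
      unfold sF; rw [gBe, gBe] <;> omega
    have dC : sD gC (r + p) (s + p) = sD g (r + p) (s + p) := by
      unfold sD; rw [gCe, gCe] <;> omega
    have eC : sE gC (r + p + p) (s + p) = sE g (r + p + p) (s + p) := by
      unfold sE; rw [gCe, gCe] <;> omega
    have fC : sF gC (r + p + p) (s + p + p) = sF g (r + p + p) (s + p + p) := by
      unfold sF; rw [gCe, gCe] <;> omega
    refine ⟨g, by omega, by omega, by omega, by omega, by omega, by omega, ?_⟩
    subst hh
    refine ⟨sol_congr A7 ?_, sol_congr B7 ?_, sol_congr C7 ?_, by omega, by omega, by omega⟩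
    · intro i j _ _ _ _; exact gAe i j (by omega)
    · intro i j _ _ _ _; exact gBe i j (by omega) (by omega) (by omega) (by omega)
    · intro i j _ _ _ _; exact gCe i j (by omega) (by omega) (by omega) (by omega)

/-- The cells of a copy. -/
def cells : ℕ → ℕ → ℕ → Finset (ℕ × ℕ)
  | 0, r, c => {(r, c)}
  | k + 1, r, c => cells k r c ∪ (cells k (r + 2 ^ k) c ∪ cells k (r + 2 ^ k) (c + 2 ^ k))

lemma cells_region {k r c i j : ℕ} (h : (i, j) ∈ cells k r c) :
    r ≤ i ∧ i < r + 2 ^ k ∧ c ≤ j ∧ j + r ≤ c + i := by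
  induction k generalizing r c with
  | zero => simp [cells] at h; simp; omega
  | succ k ih =>
    have e : r + 2 ^ (k + 1) = r + 2 ^ k + 2 ^ k := by ring
    simp only [cells, Finset.mem_union] at h
    rw [e]
    rcases h with h | h | h <;> have := ih h <;> omega

lemma cells_card (k r c : ℕ) : (cells k r c).card = 3 ^ k := by
  induction k generalizing r c with
  | zero => simp [cells]
  | succ k ih =>
    simp only [cells]
    rw [Finset.card_union_of_disjoint, Finset.card_union_of_disjoint, ih, ih, ih]
    · ring
    · rw [Finset.disjoint_left]
      rintro ⟨i, j⟩ h1 h2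
      have := cells_region h1
      have := cells_region h2
      omega
    · rw [Finset.disjoint_left]
      rintro ⟨i, j⟩ h1 h2
      have := cells_region h1
      rcases Finset.mem_union.1 h2 with h2 | h2 <;> have := cells_region h2 <;> omega

lemma cell_top (k r c : ℕ) : (r, c) ∈ cells k r c := by
  induction k generalizing r c with
  | zero => simp [cells]
  | succ k ih => simp [cells, ih]

lemma cell_left (k r c : ℕ) : (r + 2 ^ k - 1, c) ∈ cells k r c := by
  induction k generalizing r c with
  | zero => simp [cells]
  | succ k ih =>
    have e : r + 2 ^ (k + 1) = r + 2 ^ k + 2 ^ k := by ring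
    simp only [cells, Finset.mem_union, e]
    exact Or.inr (Or.inl (ih _ _))

lemma cell_right (k r c : ℕ) : (r + 2 ^ k - 1, c + 2 ^ k - 1) ∈ cells k r c := by
  induction k generalizing r c with
  | zero => simp [cells]
  | succ k ih =>
    have e : r + 2 ^ (k + 1) = r + 2 ^ k + 2 ^ k := by ring
    have e' : c + 2 ^ (k + 1) = c + 2 ^ k + 2 ^ k := by ring
    simp only [cells, Finset.mem_union, e, e']
    exact Or.inr (Or.inr (ih _ _))

/-- Vertices of a copy. -/
def InC (k r c x y : ℕ) : Prop := ∃ i j, (i, j) ∈ cells k r c ∧ InCorners i j x y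

lemma inC_region {k r c x y : ℕ} (h : InC k r c x y) :
    r ≤ x ∧ x ≤ r + 2 ^ k ∧ c ≤ y ∧ y + r ≤ c + x := by
  obtain ⟨i, j, h1, h2⟩ := h
  have := cells_region h1
  unfold InCorners at h2
  omega

lemma inC_succ {k r c x y : ℕ} (h : InC (k + 1) r c x y) :
    InC k r c x y ∨ InC k (r + 2 ^ k) c x y ∨ InC k (r + 2 ^ k) (c + 2 ^ k) x y := by
  obtain ⟨i, j, h1, h2⟩ := h
  simp only [cells, Finset.mem_union] at h1
  rcases h1 with h1 | h1 | h1
  · exact Or.inl ⟨i, j, h1, h2⟩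
  · exact Or.inr (Or.inl ⟨i, j, h1, h2⟩)
  · exact Or.inr (Or.inr ⟨i, j, h1, h2⟩)

lemma inC_cases {k r c x y : ℕ} (h : InC k r c x y) : Cor k r c x y ∨ Jn k r c x y := by
  induction k generalizing r c with
  | zero =>
    obtain ⟨i, j, h1, h2⟩ := h
    simp [cells] at h1
    obtain ⟨rfl, rfl⟩ := h1
    left; simpa [Cor, InCorners] using h2
  | succ k ih =>
    have e : r + 2 ^ (k + 1) = r + 2 ^ k + 2 ^ k := by ring
    have e' : c + 2 ^ (k + 1) = c + 2 ^ k + 2 ^ k := by ring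
    have key : ∀ r' c', Cor k r' c' x y ∨ Jn k r' c' x y → Cor k r' c' x y ∨ Jn k r' c' x y :=
      fun _ _ h => h
    unfold Cor at *
    simp only [Jn, e, e']
    rcases inC_succ h with h | h | h <;> have := ih h <;> tauto

/-- Type 1 membership. -/
def ty2 (C : ℕ → ℕ → Prop) (x y : ℕ) : Prop := 1 ≤ x ∧ C (x - 1) y
/-- Type 2 membership. -/
def ty3 (C : ℕ → ℕ → Prop) (x y : ℕ) : Prop := 1 ≤ x ∧ 1 ≤ y ∧ C (x - 1) (y - 1)

lemma jn_types {f : ℕ → ℕ → ℕ} {k r c : ℕ} (h : Sol f k r c) {x y : ℕ} (hj : Jn k r c x y)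
    (C : ℕ → ℕ → Prop) (hC : ∀ i j, (i, j) ∈ cells k r c → C i j) :
    (C x y ∧ ty2 C x y ∧ sE f x y + sD f x y ≤ 4 * f x y + 3) ∨
    (C x y ∧ ty3 C x y ∧ sF f x y + sD f x y ≤ 4 * f x y + 3) ∨
    (ty2 C x y ∧ ty3 C x y ∧ sF f x y + sE f x y ≤ 4 * f x y + 3) := by
  induction k generalizing r c with
  | zero => exact hj.elim
  | succ k ih =>
    obtain ⟨h1, h2, h3, h4, h5, h6⟩ := h
    simp only [cells, Finset.mem_union] at hC
    have pos : 0 < 2 ^ k := by positivity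
    rcases hj with ⟨rfl, rfl⟩ | ⟨rfl, rfl⟩ | ⟨rfl, rfl⟩ | hj | hj | hj
    · exact Or.inl ⟨hC _ _ (Or.inr (Or.inl (cell_top _ _ _))),
        ⟨by omega, hC _ _ (Or.inl (cell_left _ _ _))⟩, h4⟩
    · exact Or.inr (Or.inl ⟨hC _ _ (Or.inr (Or.inr (cell_top _ _ _))),
        ⟨by omega, by omega, hC _ _ (Or.inl (cell_right _ _ _))⟩, h5⟩)
    · exact Or.inr (Or.inr ⟨⟨by omega, hC _ _ (Or.inr (Or.inr (cell_left _ _ _)))⟩,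
        ⟨by omega, by omega, hC _ _ (Or.inr (Or.inl (cell_right _ _ _)))⟩, h6⟩)
    · exact ih h1 hj (fun i j h => hC i j (Or.inl h))
    · exact ih h2 hj (fun i j h => hC i j (Or.inr (Or.inl h)))
    · exact ih h3 hj (fun i j h => hC i j (Or.inr (Or.inr h)))

lemma sol_of {f : ℕ → ℕ → ℕ} {k r c : ℕ}
    (C : ℕ → ℕ → Prop) (hC : ∀ i j, (i, j) ∈ cells k r c → C i j)
    (q1 : ∀ x y, C x y → ty2 C x y → sE f x y + sD f x y ≤ 4 * f x y + 3)
    (q2 : ∀ x y, C x y → ty3 C x y → sF f x y + sD f x y ≤ 4 * f x y + 3)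
    (q3 : ∀ x y, ty2 C x y → ty3 C x y → sF f x y + sE f x y ≤ 4 * f x y + 3) :
    Sol f k r c := by
  induction k generalizing r c with
  | zero => trivial
  | succ k ih =>
    simp only [cells, Finset.mem_union] at hC
    have pos : 0 < 2 ^ k := by positivity
    refine ⟨ih (fun i j h => hC i j (Or.inl h)), ih (fun i j h => hC i j (Or.inr (Or.inl h))),
      ih (fun i j h => hC i j (Or.inr (Or.inr h))), q1 _ _ ?_ ?_, q2 _ _ ?_ ?_, q3 _ _ ?_ ?_⟩
    · exact hC _ _ (Or.inr (Or.inl (cell_top _ _ _)))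
    · exact ⟨by omega, hC _ _ (Or.inl (cell_left _ _ _))⟩
    · exact hC _ _ (Or.inr (Or.inr (cell_top _ _ _)))
    · exact ⟨by omega, by omega, hC _ _ (Or.inl (cell_right _ _ _))⟩
    · exact ⟨by omega, hC _ _ (Or.inr (Or.inr (cell_left _ _ _)))⟩
    · exact ⟨by omega, by omega, hC _ _ (Or.inr (Or.inl (cell_right _ _ _)))⟩

lemma odd_double {R C : ℕ} (h : ¬ 2 ∣ Nat.choose R C) :
    ¬ 2 ∣ Nat.choose (2 * R) (2 * C) ∧ ¬ 2 ∣ Nat.choose (2 * R + 1) (2 * C) ∧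
    ¬ 2 ∣ Nat.choose (2 * R + 1) (2 * C + 1) := by
  haveI : Fact (Nat.Prime 2) := ⟨Nat.prime_two⟩
  have key : ∀ i j, i < 2 → j ≤ i →
      ¬ 2 ∣ Nat.choose (2 * R + i) (2 * C + j) := by
    intro i j hi hj
    have := Choose.choose_modEq_choose_mod_mul_choose_div_nat (n := 2 * R + i) (k := 2 * C + j) (p := 2)
    have e1 : (2 * R + i) % 2 = i := by omega
    have e2 : (2 * C + j) % 2 = j := by omega
    have e3 : (2 * R + i) / 2 = R := by omega
    have e4 : (2 * C + j) / 2 = C := by omega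
    rw [e1, e2, e3, e4] at this
    have e5 : Nat.choose i j = 1 := by
      interval_cases i
      · have : j = 0 := by omega
        subst this; rfl
      · interval_cases j <;> rfl
    rw [e5, one_mul] at this
    rw [Nat.dvd_iff_mod_eq_zero] at h ⊢
    unfold Nat.ModEq at this
    omega
  exact ⟨key 0 0 (by omega) (by omega), key 1 0 (by omega) (by omega), key 1 1 (by omega) (by omega)⟩

lemma cells_odd {k R C : ℕ} (h : ¬ 2 ∣ Nat.choose R C) {i j : ℕ}
    (hij : (i, j) ∈ cells k (2 ^ k * R) (2 ^ k * C)) : ¬ 2 ∣ Nat.choose i j := by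
  induction k generalizing R C with
  | zero =>
    simp [cells] at hij
    rw [hij.1, hij.2]; exact h
  | succ k ih =>
    obtain ⟨h1, h2, h3⟩ := odd_double h
    simp only [cells, Finset.mem_union] at hij
    have a1 : 2 ^ (k + 1) * R = 2 ^ k * (2 * R) := by ring
    have a2 : 2 ^ (k + 1) * C = 2 ^ k * (2 * C) := by ring
    have a3 : 2 ^ k * (2 * R) + 2 ^ k = 2 ^ k * (2 * R + 1) := by ring
    have a4 : 2 ^ k * (2 * C) + 2 ^ k = 2 ^ k * (2 * C + 1) := by ring
    rw [a1, a2, a3, a4] at hij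
    rcases hij with hij | hij | hij
    · exact ih h1 hij
    · exact ih h2 hij
    · exact ih h3 hij

lemma odd_mersenne (m j : ℕ) (hj : j < 2 ^ m) : ¬ 2 ∣ Nat.choose (2 ^ m - 1) j := by
  induction m generalizing j with
  | zero =>
    have : j = 0 := by simpa using hj
    subst this; simp
  | succ m ih =>
    have e : 2 ^ (m + 1) - 1 = 2 * (2 ^ m - 1) + 1 := by
      have : 0 < 2 ^ m := by positivity
      rw [pow_succ]; omega
    rw [pow_succ] at hj
    rw [e]
    obtain ⟨h1, h2, h3⟩ := odd_double (ih (j / 2) (by omega))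
    rcases Nat.even_or_odd' j with ⟨q, rfl | rfl⟩
    · rwa [Nat.mul_div_cancel_left q (by omega)] at h2
    · have : (2 * q + 1) / 2 = q := by omega
      rwa [this] at h3

lemma bottom_cell {n j : ℕ} (hj : j < 2 ^ n) : IsCell n (2 ^ n - 1) j := by
  have : 0 < 2 ^ n := by positivity
  exact ⟨by omega, by omega, odd_mersenne n j hj⟩

lemma cells_isCell {k m C : ℕ} (hC : C < 2 ^ m) {i j : ℕ}
    (hij : (i, j) ∈ cells k (2 ^ k * (2 ^ m - 1)) (2 ^ k * C)) : IsCell (k + m) i j := by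
  have h1 := cells_odd (odd_mersenne m C hC) hij
  have h2 := cells_region hij
  refine ⟨?_, ?_, h1⟩
  · have e : 2 ^ (k + m) = 2 ^ k * (2 ^ m - 1) + 2 ^ k := by
      have : 0 < 2 ^ m := by positivity
      obtain ⟨q, hq⟩ : ∃ q, 2 ^ m = q + 1 := ⟨2 ^ m - 1, by omega⟩
      rw [pow_add, hq]; simp; ring
    omega
  · by_contra hcon
    rw [Nat.choose_eq_zero_of_lt (by omega)] at h1
    exact h1 (dvd_zero _)

lemma not_three {n x y : ℕ} : ¬ (IsCell n x y ∧ ty2 (IsCell n) x y ∧ ty3 (IsCell n) x y) := by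
  rintro ⟨h1, ⟨h2, h3⟩, ⟨_, h4, h5⟩⟩
  obtain ⟨x, rfl⟩ : ∃ z, x = z + 1 := ⟨x - 1, by omega⟩
  obtain ⟨y, rfl⟩ : ∃ z, y = z + 1 := ⟨y - 1, by omega⟩
  have := Nat.choose_succ_succ x y
  have a := h1.2.2
  have b := h3.2.2
  have c := h5.2.2
  simp only [Nat.add_sub_cancel, Nat.succ_eq_add_one] at *
  omega

lemma two_of_top {n x y : ℕ} (hx : 1 ≤ x) (h : IsCell n x y) :
    ty2 (IsCell n) x y ∨ ty3 (IsCell n) x y := by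
  obtain ⟨x, rfl⟩ : ∃ z, x = z + 1 := ⟨x - 1, by omega⟩
  obtain ⟨h1, h2, h3⟩ := h
  unfold ty2 ty3 IsCell
  simp only [Nat.add_sub_cancel]
  rcases Nat.eq_zero_or_pos y with rfl | hy
  · left; simp; omega
  · obtain ⟨y, rfl⟩ : ∃ z, y = z + 1 := ⟨y - 1, by omega⟩
    have e := Nat.choose_succ_succ x y
    simp only [Nat.add_sub_cancel, Nat.succ_eq_add_one] at *
    by_cases hh : 2 ∣ Nat.choose x (y + 1)
    · right; exact ⟨by omega, by omega, by omega, by omega, by omega⟩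
    · left
      refine ⟨by omega, by omega, ?_, hh⟩
      by_contra hcon
      rw [Nat.choose_eq_zero_of_lt (by omega)] at hh
      exact hh (dvd_zero _)

noncomputable instance instFinSGV (n : ℕ) : Fintype (SGV n) := by
  have : Finite (SGV n) := by
    refine Set.Finite.to_subtype (s := {p | IsVtx n p}) ?_
    refine Set.Finite.subset (Finset.finite_toSet (Finset.range (2 ^ n + 1) ×ˢ Finset.range (2 ^ n + 1))) ?_
    rintro ⟨x, y⟩ ⟨i, j, h1, h2⟩
    obtain ⟨h3, h4, _⟩ := h1
    unfold InCorners at h2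
    simp at h2 ⊢
    omega
  exact Fintype.ofFinite _

lemma sg_ext {n : ℕ} {v w : SGV n} (h1 : v.val.1 = w.val.1) (h2 : v.val.2 = w.val.2) : v = w :=
  Subtype.ext (Prod.ext h1 h2)

lemma sg_adj {n : ℕ} (v w : SGV n) : (SGgraph n).Adj v w ↔
    (IsCell n v.val.1 v.val.2 ∧ w.val ∈ ({(v.val.1 + 1, v.val.2), (v.val.1 + 1, v.val.2 + 1)} : Finset (ℕ × ℕ))) ∨
    (ty2 (IsCell n) v.val.1 v.val.2 ∧ w.val ∈ ({(v.val.1 - 1, v.val.2), (v.val.1, v.val.2 + 1)} : Finset (ℕ × ℕ))) ∨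
    (ty3 (IsCell n) v.val.1 v.val.2 ∧ w.val ∈ ({(v.val.1 - 1, v.val.2 - 1), (v.val.1, v.val.2 - 1)} : Finset (ℕ × ℕ))) := by
  have hne : v ≠ w ↔ ¬ (v.val.1 = w.val.1 ∧ v.val.2 = w.val.2) := by
    constructor
    · intro h hh; exact h (sg_ext hh.1 hh.2)
    · rintro h rfl; exact h ⟨rfl, rfl⟩
  change (v ≠ w ∧ _) ↔ _
  rw [hne]
  obtain ⟨⟨x, y⟩, hv⟩ := v
  obtain ⟨⟨x', y'⟩, hw⟩ := w
  simp only [Finset.mem_insert, Finset.mem_singleton, Prod.mk.injEq]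
  unfold ty2 ty3
  constructor
  · rintro ⟨h0, i, j, hc, h1, h2⟩
    unfold InCorners at h1 h2
    dsimp only at *
    rcases h1 with ⟨rfl, rfl⟩ | ⟨rfl, rfl⟩ | ⟨rfl, rfl⟩
    · left; exact ⟨hc, by omega⟩
    · right; left; exact ⟨⟨by omega, hc⟩, by omega⟩
    · right; right; exact ⟨⟨by omega, by omega, hc⟩, by omega⟩
  · rintro (⟨hc, h⟩ | ⟨⟨h1, hc⟩, h⟩ | ⟨⟨h1, h2, hc⟩, h⟩)
    · exact ⟨by omega, x, y, hc, by unfold InCorners; omega, by unfold InCorners; omega⟩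
    · exact ⟨by omega, x - 1, y, hc, by unfold InCorners; omega, by unfold InCorners; omega⟩
    · exact ⟨by omega, x - 1, y - 1, hc, by unfold InCorners; omega, by unfold InCorners; omega⟩

/-- Coordinates. -/
def sgEmb (n : ℕ) : SGV n ↪ ℕ × ℕ :=
  ⟨fun v => v.val, fun v w h => sg_ext (congrArg Prod.fst h) (congrArg Prod.snd h)⟩

lemma mkV {n : ℕ} {p : ℕ × ℕ} (h : IsVtx n p) : ∃ v : SGV n, v.val = p := ⟨⟨p, h⟩, rfl⟩

lemma nbrsum {n : ℕ} (v : SGV n) (f : ℕ → ℕ → ℕ) :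
    ∑ w ∈ Finset.univ.filter (fun w => (SGgraph n).Adj v w), f w.val.1 w.val.2 =
    (if IsCell n v.val.1 v.val.2 then sD f v.val.1 v.val.2 else 0) +
    (if ty2 (IsCell n) v.val.1 v.val.2 then sE f v.val.1 v.val.2 else 0) +
    (if ty3 (IsCell n) v.val.1 v.val.2 then sF f v.val.1 v.val.2 else 0) := by
  obtain ⟨x, hx⟩ : ∃ x, x = v.val.1 := ⟨_, rfl⟩
  obtain ⟨y, hy⟩ : ∃ y, y = v.val.2 := ⟨_, rfl⟩
  obtain ⟨S1, hS1⟩ : ∃ S : Finset (ℕ × ℕ), S = if IsCell n x y then {(x + 1, y), (x + 1, y + 1)} else ∅ := ⟨_, rfl⟩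
  obtain ⟨S2, hS2⟩ : ∃ S : Finset (ℕ × ℕ), S = if ty2 (IsCell n) x y then {(x - 1, y), (x, y + 1)} else ∅ := ⟨_, rfl⟩
  obtain ⟨S3, hS3⟩ : ∃ S : Finset (ℕ × ℕ), S = if ty3 (IsCell n) x y then {(x - 1, y - 1), (x, y - 1)} else ∅ := ⟨_, rfl⟩
  have m1 : ∀ p, p ∈ S1 ↔ IsCell n x y ∧ p ∈ ({(x + 1, y), (x + 1, y + 1)} : Finset (ℕ × ℕ)) := by
    intro p; rw [hS1]; split_ifs with h <;> simp [h]
  have m2 : ∀ p, p ∈ S2 ↔ ty2 (IsCell n) x y ∧ p ∈ ({(x - 1, y), (x, y + 1)} : Finset (ℕ × ℕ)) := by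
    intro p; rw [hS2]; split_ifs with h <;> simp [h]
  have m3 : ∀ p, p ∈ S3 ↔ ty3 (IsCell n) x y ∧ p ∈ ({(x - 1, y - 1), (x, y - 1)} : Finset (ℕ × ℕ)) := by
    intro p; rw [hS3]; split_ifs with h <;> simp [h]
  have hset : (Finset.univ.filter (fun w => (SGgraph n).Adj v w)).map (sgEmb n)
      = S1 ∪ (S2 ∪ S3) := by
    ext p
    simp only [Finset.mem_map, Finset.mem_filter, Finset.mem_univ, true_and, Finset.mem_union,
      m1, m2, m3]
    constructor
    · rintro ⟨w, hw, rfl⟩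
      rw [sg_adj] at hw
      change _ ∧ w.val ∈ _ ∨ _ ∧ w.val ∈ _ ∨ _ ∧ w.val ∈ _
      rw [hx, hy]; exact hw
    · intro hp
      have hvp : IsVtx n p := by
        obtain ⟨p1, p2⟩ := p
        simp only [Finset.mem_insert, Finset.mem_singleton, Prod.mk.injEq, ty2, ty3] at hp
        rcases hp with ⟨hc, h⟩ | ⟨⟨h1, hc⟩, h⟩ | ⟨⟨h1, h2, hc⟩, h⟩
        · exact ⟨_, _, hc, by unfold InCorners; dsimp only; omega⟩
        · exact ⟨_, _, hc, by unfold InCorners; dsimp only; omega⟩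
        · exact ⟨_, _, hc, by unfold InCorners; dsimp only; omega⟩
      obtain ⟨w, rfl⟩ := mkV hvp
      refine ⟨w, ?_, rfl⟩
      rw [sg_adj]
      rw [hx, hy] at hp; exact hp
  have hs : ∑ w ∈ Finset.univ.filter (fun w => (SGgraph n).Adj v w), f w.val.1 w.val.2 =
      ∑ p ∈ S1 ∪ (S2 ∪ S3), f p.1 p.2 := by
    rw [← hset, Finset.sum_map]; rfl
  rw [hs, Finset.sum_union, Finset.sum_union, ← hx, ← hy, ← add_assoc]
  · congr 1
    · congr 1
      · rw [hS1]; split_ifs <;> simp [sD]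
      · rw [hS2]; split_ifs with h
        · have := h.1
          rw [Finset.sum_pair]
          · rfl
          · simp
        · simp
    · rw [hS3]; split_ifs with h
      · have := h.1
        rw [Finset.sum_pair]
        · rfl
        · simp; omega
      · simp
  · rw [Finset.disjoint_left]
    rintro ⟨a, b⟩
    rw [m2, m3]
    unfold ty2 ty3
    simp
    intros
    omega
  · rw [Finset.disjoint_left]
    rintro ⟨a, b⟩
    rw [Finset.mem_union, m1, m2, m3]
    unfold ty2 ty3
    simp
    intros
    omega

/-- Walk of bounded length between lattice points. -/
def Wk (n d : ℕ) (p q : ℕ × ℕ) : Prop :=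
  ∃ (v v' : SGV n) (w : (SGgraph n).Walk v v'), v.val = p ∧ v'.val = q ∧ w.length ≤ d

lemma Wk.trans {n d e : ℕ} {p q r : ℕ × ℕ} (h1 : Wk n d p q) (h2 : Wk n e q r) : Wk n (d + e) p r := by
  obtain ⟨a, b, w, hp, hq, hw⟩ := h1
  obtain ⟨a', b', w', hp', hq', hw'⟩ := h2
  have : b = a' := (sgEmb n).injective (hq.trans hp'.symm)
  subst this
  refine ⟨a, b', w.append w', hp, hq', ?_⟩
  rw [SimpleGraph.Walk.length_append]; omega

lemma Wk.up {n d e : ℕ} {p q : ℕ × ℕ} (h1 : Wk n d p q) (h : d ≤ e) : Wk n e p q := by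
  obtain ⟨a, b, w, hp, hq, hw⟩ := h1
  exact ⟨a, b, w, hp, hq, by omega⟩

lemma wk_cell {n i j : ℕ} (hc : IsCell n i j) {p q : ℕ × ℕ} (hp : InCorners i j p.1 p.2)
    (hq : InCorners i j q.1 q.2) : Wk n 1 p q := by
  obtain ⟨v, rfl⟩ := mkV (n := n) (p := p) ⟨_, _, hc, hp⟩
  obtain ⟨v', rfl⟩ := mkV (n := n) (p := q) ⟨_, _, hc, hq⟩
  by_cases h : v = v'
  · subst h
    exact ⟨v, v, SimpleGraph.Walk.nil, rfl, rfl, by simp⟩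
  · have hadj : (SGgraph n).Adj v v' := ⟨h, i, j, hc, hp, hq⟩
    exact ⟨_, _, SimpleGraph.Walk.cons hadj SimpleGraph.Walk.nil, rfl, rfl, by simp⟩

lemma wk_copy {n k r c : ℕ} (hC : ∀ i j, (i, j) ∈ cells k r c → IsCell n i j) {x y x' y' : ℕ}
    (h : InC k r c x y) (h' : Cor k r c x' y') : Wk n (2 ^ k) (x', y') (x, y) := by
  induction k generalizing r c x y x' y' with
  | zero =>
    obtain ⟨i, j, h1, h2⟩ := h
    simp [cells] at h1
    obtain ⟨rfl, rfl⟩ := h1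
    exact wk_cell (hC i j (by simp [cells])) (by simpa [InCorners, Cor] using h') h2
  | succ k ih =>
    have e : r + 2 ^ (k + 1) = r + 2 ^ k + 2 ^ k := by ring
    have e' : c + 2 ^ (k + 1) = c + 2 ^ k + 2 ^ k := by ring
    have e2 : 2 ^ (k + 1) = 2 ^ k + 2 ^ k := by ring
    have pos : 0 < 2 ^ k := by positivity
    simp only [cells, Finset.mem_union] at hC
    have hA : ∀ i j, (i, j) ∈ cells k r c → IsCell n i j := fun i j h => hC i j (Or.inl h)
    have hB : ∀ i j, (i, j) ∈ cells k (r + 2 ^ k) c → IsCell n i j :=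
      fun i j h => hC i j (Or.inr (Or.inl h))
    have hD : ∀ i j, (i, j) ∈ cells k (r + 2 ^ k) (c + 2 ^ k) → IsCell n i j :=
      fun i j h => hC i j (Or.inr (Or.inr h))
    have inTop : ∀ r c, InC k r c r c := fun r c => ⟨_, _, cell_top k r c, by simp [InCorners]⟩
    have inLeft : ∀ r c, InC k r c (r + 2 ^ k) c :=
      fun r c => ⟨_, _, cell_left k r c, by unfold InCorners; omega⟩
    have inRight : ∀ r c, InC k r c (r + 2 ^ k) (c + 2 ^ k) :=
      fun r c => ⟨_, _, cell_right k r c, by unfold InCorners; omega⟩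
    have corTop : ∀ r c, Cor k r c r c := fun r c => Or.inl ⟨rfl, rfl⟩
    have corLeft : ∀ r c, Cor k r c (r + 2 ^ k) c := fun r c => Or.inr (Or.inl ⟨rfl, rfl⟩)
    have corRight : ∀ r c, Cor k r c (r + 2 ^ k) (c + 2 ^ k) :=
      fun r c => Or.inr (Or.inr ⟨rfl, rfl⟩)
    unfold Cor at h'
    rw [e, e'] at h'
    rw [e2]
    rcases h' with ⟨rfl, rfl⟩ | ⟨rfl, rfl⟩ | ⟨rfl, rfl⟩ <;> rcases inC_succ h with h | h | h
    · exact (ih hA h (corTop _ _)).up (by omega)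
    · exact (ih hA (inLeft _ _) (corTop _ _)).trans (ih hB h (corTop _ _))
    · exact (ih hA (inRight _ _) (corTop _ _)).trans (ih hD h (corTop _ _))
    · exact (ih hB (inTop _ _) (corLeft _ _)).trans (ih hA h (corLeft _ _))
    · exact (ih hB h (corLeft _ _)).up (by omega)
    · exact (ih hB (inRight _ _) (corLeft _ _)).trans (ih hD h (corLeft _ _))
    · exact (ih hD (inTop _ _) (corRight _ _)).trans (ih hA h (corRight _ _))
    · exact (ih hD (inLeft _ _) (corRight _ _)).trans (ih hB h (corRight _ _))
    · exact (ih hD h (corRight _ _)).up (by omega)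

lemma deg_types {n : ℕ} (v : SGV n) : deg (SGgraph n) v =
    (if IsCell n v.val.1 v.val.2 then 2 else 0) +
    (if ty2 (IsCell n) v.val.1 v.val.2 then 2 else 0) +
    (if ty3 (IsCell n) v.val.1 v.val.2 then 2 else 0) := by
  rw [deg_eq]
  exact nbrsum v (fun _ _ => 1)

lemma deg_pos {n : ℕ} (v : SGV n) : 2 ≤ deg (SGgraph n) v := by
  rw [deg_types]
  have : IsCell n v.val.1 v.val.2 ∨ ty2 (IsCell n) v.val.1 v.val.2 ∨
      ty3 (IsCell n) v.val.1 v.val.2 := by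
    obtain ⟨⟨x, y⟩, i, j, hc, h⟩ := v
    unfold InCorners at h
    unfold ty2 ty3
    dsimp only at *
    rcases h with ⟨rfl, rfl⟩ | ⟨rfl, rfl⟩ | ⟨rfl, rfl⟩
    · left; exact hc
    · right; left; exact ⟨by omega, hc⟩
    · right; right; exact ⟨by omega, by omega, hc⟩
  rcases this with h | h | h <;> simp only [h, if_true] <;> omega

lemma not_cell_bottom {n y : ℕ} : ¬ IsCell n (2 ^ n) y := fun h => absurd h.1 (lt_irrefl _)

lemma ty2_bottom {n y : ℕ} (h : y < 2 ^ n) : ty2 (IsCell n) (2 ^ n) y :=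
  ⟨Nat.one_le_two_pow, bottom_cell h⟩

lemma ty3_bottom {n y : ℕ} (h1 : 1 ≤ y) (h : y ≤ 2 ^ n) : ty3 (IsCell n) (2 ^ n) y :=
  ⟨Nat.one_le_two_pow, h1, bottom_cell (by omega)⟩

section transfer
variable {G g : ℕ → ℕ → ℕ} {k r c : ℕ} (hG : ∀ x y, InC k r c x y → G x y = g x y)
include hG

lemma tr1 {x y : ℕ} (h : (x, y) ∈ cells k r c) : sD G x y = sD g x y := by
  unfold sD
  rw [hG, hG] <;> exact ⟨_, _, h, by unfold InCorners; omega⟩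

lemma tr2 {x y : ℕ} (h : ty2 (fun i j => (i, j) ∈ cells k r c) x y) : sE G x y = sE g x y := by
  obtain ⟨h1, h⟩ := h
  unfold sE
  rw [hG, hG] <;> exact ⟨_, _, h, by unfold InCorners; omega⟩

lemma tr3 {x y : ℕ} (h : ty3 (fun i j => (i, j) ∈ cells k r c) x y) : sF G x y = sF g x y := by
  obtain ⟨h1, h2, h⟩ := h
  unfold sF
  rw [hG, hG] <;> exact ⟨_, _, h, by unfold InCorners; omega⟩

lemma jn_ok {n : ℕ} (hC : ∀ i j, (i, j) ∈ cells k r c → IsCell n i j) (hs : Sol g k r c)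
    (v : SGV n) (hj : Jn k r c v.val.1 v.val.2) (hv : InC k r c v.val.1 v.val.2) :
    ∑ w ∈ Finset.univ.filter (fun w => (SGgraph n).Adj v w), G w.val.1 w.val.2
      < deg (SGgraph n) v * (G v.val.1 v.val.2 + 1) := by
  have h2 : ∀ x y, ty2 (fun i j => (i, j) ∈ cells k r c) x y → ty2 (IsCell n) x y :=
    fun x y h => ⟨h.1, hC _ _ h.2⟩
  have h3 : ∀ x y, ty3 (fun i j => (i, j) ∈ cells k r c) x y → ty3 (IsCell n) x y :=
    fun x y h => ⟨h.1, h.2.1, hC _ _ h.2.2⟩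
  have nt := not_three (n := n) (x := v.val.1) (y := v.val.2)
  rw [nbrsum, deg_types, hG _ _ hv]
  rcases jn_types hs hj (fun i j => (i, j) ∈ cells k r c) (fun _ _ h => h) with
    ⟨a, b, q⟩ | ⟨a, b, q⟩ | ⟨a, b, q⟩
  · have a' := hC _ _ a
    have b' := h2 _ _ b
    have c' : ¬ ty3 (IsCell n) v.val.1 v.val.2 := fun h => nt ⟨a', b', h⟩
    simp only [a', b', c', if_true, if_false, tr1 hG a, tr2 hG b]
    omega
  · have a' := hC _ _ a
    have b' := h3 _ _ b
    have c' : ¬ ty2 (IsCell n) v.val.1 v.val.2 := fun h => nt ⟨a', h, b'⟩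
    simp only [a', b', c', if_true, if_false, tr1 hG a, tr3 hG b]
    omega
  · have a' := h2 _ _ a
    have b' := h3 _ _ b
    have c' : ¬ IsCell n v.val.1 v.val.2 := fun h => nt ⟨h, a', b'⟩
    simp only [a', b', c', if_true, if_false, tr2 hG a, tr3 hG b]
    omega

end transfer

lemma adj_inB {n : ℕ} (B : ℕ → ℕ → Prop) (v w : SGV n) (hadj : (SGgraph n).Adj v w)
    (h1 : IsCell n v.val.1 v.val.2 → B v.val.1 v.val.2)
    (h2 : ty2 (IsCell n) v.val.1 v.val.2 → ty2 B v.val.1 v.val.2)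
    (h3 : ty3 (IsCell n) v.val.1 v.val.2 → ty3 B v.val.1 v.val.2) :
    ∃ i j, B i j ∧ InCorners i j w.val.1 w.val.2 := by
  rw [sg_adj] at hadj
  simp only [Finset.mem_insert, Finset.mem_singleton, Prod.ext_iff] at hadj
  rcases hadj with ⟨q, h⟩ | ⟨q, h⟩ | ⟨q, h⟩
  · exact ⟨_, _, h1 q, by unfold InCorners; omega⟩
  · have := h2 q
    exact ⟨_, _, this.2, by have := this.1; unfold InCorners; omega⟩
  · have := h3 q
    exact ⟨_, _, this.2.2, by
      have h1 := this.1
      have h2 := this.2.1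
      unfold InCorners; omega⟩

lemma jn_closed {n k r c : ℕ} (hC : ∀ i j, (i, j) ∈ cells k r c → IsCell n i j)
    {x y : ℕ} (hj : Jn k r c x y) :
    (IsCell n x y → (x, y) ∈ cells k r c) ∧
    (ty2 (IsCell n) x y → ty2 (fun i j => (i, j) ∈ cells k r c) x y) ∧
    (ty3 (IsCell n) x y → ty3 (fun i j => (i, j) ∈ cells k r c) x y) := by
  have h2 : ty2 (fun i j => (i, j) ∈ cells k r c) x y → ty2 (IsCell n) x y :=
    fun h => ⟨h.1, hC _ _ h.2⟩
  have h3 : ty3 (fun i j => (i, j) ∈ cells k r c) x y → ty3 (IsCell n) x y :=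
    fun h => ⟨h.1, h.2.1, hC _ _ h.2.2⟩
  have h1 := hC x y
  have nt := not_three (n := n) (x := x) (y := y)
  have hs : Sol (fun _ _ => 0) k r c := by
    apply sol_of (fun _ _ => True) <;> intros <;> simp [sD, sE, sF]
  have := jn_types hs hj (fun i j => (i, j) ∈ cells k r c) (fun _ _ h => h)
  tauto

set_option maxHeartbeats 1000000 in
lemma confine {n k r cL h : ℕ} (hr : r + 2 ^ k = 2 ^ n) (hcL : cL + 2 ^ k = h)
    (hh : h + h = 2 ^ n)
    (hr1 : 1 ≤ r)
    (hm : k + 1 = n ∨ (1 ≤ cL ∧ h + 2 ^ k < 2 ^ n))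
    (vL : ∀ i j, (i, j) ∈ cells k r cL → IsCell n i j)
    (vR : ∀ i j, (i, j) ∈ cells k r h → IsCell n i j)
    (v0 : SGV n) (hv0 : v0.val = (2 ^ n, h)) {M α s : ℕ} (hrel : GRel k M 0 0 α s s)
    (hs3 : s ≤ 3) (hs0 : k + 1 = n → s = 0) :
    ∃ G : ℕ → ℕ → ℕ, G (2 ^ n) h = M ∧
      (∀ v : SGV n, v ≠ v0 →
        ∑ w ∈ Finset.univ.filter (fun w => (SGgraph n).Adj v w), G w.val.1 w.val.2
          < deg (SGgraph n) v * (G v.val.1 v.val.2 + 1)) ∧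
      (∀ v w : SGV n, 0 < G v.val.1 v.val.2 → (SGgraph n).Adj v w →
        InC k r cL w.val.1 w.val.2 ∨ InC k r h w.val.1 w.val.2) := by
  have pos : 0 < 2 ^ k := by positivity
  obtain ⟨gL, l1, l2, l3, l4, l5, l6, l7⟩ := rel_real hrel.swapAB.swapBC r cL
  obtain ⟨gR, r1, r2, r3, r4, r5, r6, r7⟩ := rel_real hrel.swapAB r h
  rw [hr] at l2 l3 l5 l6 r2 r3 r5 r6
  rw [hcL] at l3 l6
  obtain ⟨G, hG⟩ : ∃ G : ℕ → ℕ → ℕ, G = fun x y => if InC k r cL x y then gL x y else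
    if InC k r h x y then gR x y else 0 := ⟨_, rfl⟩
  have hGL : ∀ x y, InC k r cL x y → G x y = gL x y := by
    intro x y hx; rw [hG]; simp only [hx, if_true]
  have hGR : ∀ x y, InC k r h x y → G x y = gR x y := by
    intro x y hx; rw [hG]; simp only [hx, if_true]
    split_ifs with hl
    · have := inC_region hx
      have := inC_region hl
      have e1 : x = 2 ^ n := by omega
      have e2 : y = h := by omega
      rw [e1, e2, l3, r2]
    · rfl
  have hGZ : ∀ x y, ¬ InC k r cL x y → ¬ InC k r h x y → G x y = 0 := by
    intro x y hx hy; rw [hG]; simp only [hx, hy, if_false]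
  have Gr : ∀ x y, x ≤ r → G x y = 0 := by
    intro x y hx
    by_cases c1 : InC k r cL x y
    · have := inC_region c1
      have e1 : x = r := by omega
      have e2 : y = cL := by omega
      rw [hGL _ _ c1, e1, e2, l1]
    · by_cases c2 : InC k r h x y
      · have := inC_region c2
        have e1 : x = r := by omega
        have e2 : y = h := by omega
        rw [hGR _ _ c2, e1, e2, r1]
      · exact hGZ _ _ c1 c2
  have GlowL : ∀ x y, y < cL → G x y = 0 := by
    intro x y hy
    apply hGZ
    · intro hc; have := inC_region hc; omega
    · intro hc; have := inC_region hc; omega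
  have GhiR : ∀ x y, h + x < y + r → G x y = 0 := by
    intro x y hy
    apply hGZ
    · intro hc; have := inC_region hc; omega
    · intro hc; have := inC_region hc; omega
  have cases4 : ∀ x y, InC k r cL x y ∨ InC k r h x y →
      (x = r ∧ y = cL) ∨ (x = 2 ^ n ∧ y = cL) ∨ (x = 2 ^ n ∧ y = h) ∨ (x = r ∧ y = h) ∨
      (x = 2 ^ n ∧ y = h + 2 ^ k) ∨ (Jn k r cL x y ∧ InC k r cL x y) ∨
      (Jn k r h x y ∧ InC k r h x y) := by
    rintro x y (hx | hx)
    · have := inC_cases hx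
      unfold Cor at this
      rw [hr, hcL] at this
      rcases this with (q | q | q) | q
      · exact Or.inl q
      · exact Or.inr (Or.inl q)
      · exact Or.inr (Or.inr (Or.inl q))
      · exact Or.inr (Or.inr (Or.inr (Or.inr (Or.inr (Or.inl ⟨q, hx⟩)))))
    · have := inC_cases hx
      unfold Cor at this
      rw [hr] at this
      rcases this with (q | q | q) | q
      · exact Or.inr (Or.inr (Or.inr (Or.inl q)))
      · exact Or.inr (Or.inr (Or.inl q))
      · exact Or.inr (Or.inr (Or.inr (Or.inr (Or.inl q))))
      · exact Or.inr (Or.inr (Or.inr (Or.inr (Or.inr (Or.inr ⟨q, hx⟩)))))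
  have inLl : InC k r cL (2 ^ n) cL := ⟨_, _, cell_left k r cL, by unfold InCorners; omega⟩
  have inRr : InC k r h (2 ^ n) (h + 2 ^ k) := ⟨_, _, cell_right k r h, by unfold InCorners; omega⟩
  have G1 : G (2 ^ n) cL = 0 := by rw [hGL _ _ inLl, l2]
  have G2 : G (2 ^ n) (h + 2 ^ k) = 0 := by rw [hGR _ _ inRr, r3]
  have G0 : G (2 ^ n) h = M := by
    rw [hGL _ _ ⟨_, _, cell_right k r cL, by unfold InCorners; omega⟩, l3]
  have closed : ∀ v w : SGV n, 0 < G v.val.1 v.val.2 → (SGgraph n).Adj v w →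
        InC k r cL w.val.1 w.val.2 ∨ InC k r h w.val.1 w.val.2 := by
    intro v w hv hadj
    have hin : InC k r cL v.val.1 v.val.2 ∨ InC k r h v.val.1 v.val.2 := by
      by_contra hcon
      push Not at hcon
      rw [hGZ _ _ hcon.1 hcon.2] at hv
      omega
    have : ∃ i j, ((i, j) ∈ cells k r cL ∨ (i, j) ∈ cells k r h) ∧
        InCorners i j w.val.1 w.val.2 := by
      rcases cases4 _ _ hin with ⟨a, b⟩ | ⟨a, b⟩ | ⟨a, b⟩ | ⟨a, b⟩ | ⟨a, b⟩ | ⟨a, b⟩ | ⟨a, b⟩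
      · rw [Gr _ _ (by omega)] at hv; omega
      · rw [a, b, G1] at hv; omega
      · refine adj_inB _ v w hadj ?_ ?_ ?_
        · rw [a]; intro q; exact (not_cell_bottom q).elim
        · rw [a, b]; intro _
          refine ⟨by omega, Or.inr ?_⟩
          have := cell_left k r h
          rwa [hr] at this
        · rw [a, b]; intro _
          refine ⟨by omega, by omega, Or.inl ?_⟩
          have := cell_right k r cL
          rwa [hr, hcL] at this
      · rw [Gr _ _ (by omega)] at hv; omega
      · rw [a, b, G2] at hv; omega
      · obtain ⟨q1, q2, q3⟩ := jn_closed vL a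
        exact adj_inB _ v w hadj (fun q => Or.inl (q1 q))
          (fun q => ⟨(q2 q).1, Or.inl (q2 q).2⟩)
          (fun q => ⟨(q3 q).1, (q3 q).2.1, Or.inl (q3 q).2.2⟩)
      · obtain ⟨q1, q2, q3⟩ := jn_closed vR a
        exact adj_inB _ v w hadj (fun q => Or.inr (q1 q))
          (fun q => ⟨(q2 q).1, Or.inr (q2 q).2⟩)
          (fun q => ⟨(q3 q).1, (q3 q).2.1, Or.inr (q3 q).2.2⟩)
    obtain ⟨i, j, a | a, b⟩ := this
    · exact Or.inl ⟨i, j, a, b⟩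
    · exact Or.inr ⟨i, j, a, b⟩
  have topcase : ∀ (v : SGV n) (c : ℕ), v.val.1 = r → v.val.2 = c → (r, c) ∈ cells k r c →
      IsCell n r c → sD G r c ≤ s →
      ∑ w ∈ Finset.univ.filter (fun w => (SGgraph n).Adj v w), G w.val.1 w.val.2
          < deg (SGgraph n) v * (G v.val.1 v.val.2 + 1) := by
    intro v c e1 e2 hc hcell hsum
    rw [nbrsum, deg_types, e1, e2]
    have t := two_of_top hr1 hcell
    have nt := not_three (n := n) (x := r) (y := c)
    have z1 : sE G r c = 0 := by
      unfold sE; rw [Gr _ _ (by omega), Gr _ _ (by omega)]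
    have z2 : sF G r c = 0 := by
      unfold sF; rw [Gr _ _ (by omega), Gr _ _ (by omega)]
    rw [Gr _ _ le_rfl]
    simp only [hcell, if_true, z1, z2]
    rcases t with t | t <;> simp only [t, if_true] <;> split_ifs <;> omega
  refine ⟨G, G0, ?_, closed⟩
  intro v hv
  by_cases hin : InC k r cL v.val.1 v.val.2 ∨ InC k r h v.val.1 v.val.2
  · rcases cases4 _ _ hin with ⟨a, b⟩ | ⟨a, b⟩ | ⟨a, b⟩ | ⟨a, b⟩ | ⟨a, b⟩ | ⟨a, b⟩ | ⟨a, b⟩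
    · refine topcase v cL a b (cell_top _ _ _) (vL _ _ (cell_top _ _ _)) ?_
      rw [tr1 hGL (cell_top _ _ _)]; exact l4
    · rw [nbrsum, deg_types, a, b, G1]
      have t2 := ty2_bottom (n := n) (y := cL) (by omega)
      have e2 : sE G (2 ^ n) cL ≤ s := by
        rw [tr2 hGL ⟨by omega, by have := cell_left k r cL; rwa [hr] at this⟩]; exact l5
      have e3 : ty3 (IsCell n) (2 ^ n) cL → sF G (2 ^ n) cL = 0 := by
        intro q
        have := q.2.1
        unfold sF; rw [GlowL _ _ (by omega), GlowL _ _ (by omega)]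
      have n1 := not_cell_bottom (n := n) (y := cL)
      simp only [t2, n1, if_true, if_false]
      rcases hm with hm | ⟨hm, hm'⟩
      · have := hs0 hm
        by_cases q : ty3 (IsCell n) (2 ^ n) cL
        · rw [e3 q]; simp only [q, if_true]; omega
        · simp only [q, if_false]; omega
      · have q := ty3_bottom hm (show cL ≤ 2 ^ n by omega)
        rw [e3 q]; simp only [q, if_true]; omega
    · exact (hv ((sgEmb n).injective (by
        change v.val = v0.val
        rw [hv0]; exact Prod.ext a b))).elim
    · refine topcase v h a b (cell_top _ _ _) (vR _ _ (cell_top _ _ _)) ?_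
      rw [tr1 hGR (cell_top _ _ _)]; exact r4
    · rw [nbrsum, deg_types, a, b, G2]
      have t2 := ty3_bottom (n := n) (y := h + 2 ^ k) (by omega) (by omega)
      have e2 : sF G (2 ^ n) (h + 2 ^ k) ≤ s := by
        rw [tr3 hGR ⟨by omega, by omega, by have := cell_right k r h; rwa [hr] at this⟩]; exact r6
      have e3 : sE G (2 ^ n) (h + 2 ^ k) = 0 := by
        unfold sE; rw [GhiR _ _ (by omega), GhiR _ _ (by omega)]
      have n1 := not_cell_bottom (n := n) (y := h + 2 ^ k)
      simp only [t2, n1, if_true, if_false, e3]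
      rcases hm with hm | ⟨hm, hm'⟩
      · have := hs0 hm
        split_ifs <;> omega
      · have q := ty2_bottom hm'
        simp only [q, if_true]; omega
    · exact jn_ok hGL vL l7 v a b
    · exact jn_ok hGR vR r7 v a b
  · have z : ∑ w ∈ Finset.univ.filter (fun w => (SGgraph n).Adj v w), G w.val.1 w.val.2 = 0 := by
      apply Finset.sum_eq_zero
      intro w hw
      by_contra hcon
      exact hin (closed w v (by omega) (by simpa using hw : (SGgraph n).Adj v w).symm)
    rw [z]
    have := deg_pos v
    positivity

lemma full_ball {n k r cL h : ℕ} (hr : r + 2 ^ k = 2 ^ n) (hcL : cL + 2 ^ k = h)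
    (hh : h + h = 2 ^ n)
    (hr1 : 1 ≤ r)
    (vL : ∀ i j, (i, j) ∈ cells k r cL → IsCell n i j)
    (vR : ∀ i j, (i, j) ∈ cells k r h → IsCell n i j)
    (f : ℕ → ℕ → ℕ)
    (hf : ∀ v : SGV n,
        ∑ w ∈ Finset.univ.filter (fun w => (SGgraph n).Adj v w), f w.val.1 w.val.2
          < deg (SGgraph n) v * (f v.val.1 v.val.2 + 1)) :
    (∀ s, s = sE f (2 ^ n) cL → f (2 ^ n) cL = 0 → ∃ α s', s' ≤ s ∧ GRel k (f (2 ^ n) h) 0 0 α s' s') ∧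
    ((1 ≤ cL ∧ h + 2 ^ k < 2 ^ n) →
      (¬ ∃ α s, s ≤ 3 ∧ GRel k (f (2 ^ n) h) 0 0 α s s) →
      ∀ x y, InC k r cL x y ∨ InC k r h x y → 1 ≤ f x y) := by
  have pos : 0 < 2 ^ k := by positivity
  have vtx1 : ∀ x y, IsCell n x y → ∃ v : SGV n, v.val = (x, y) := fun x y q =>
    mkV ⟨x, y, q, Or.inl ⟨rfl, rfl⟩⟩
  have vtx2 : ∀ x y, ty2 (IsCell n) x y → ∃ v : SGV n, v.val = (x, y) := fun x y q =>
    mkV ⟨x - 1, y, q.2, by have := q.1; unfold InCorners; dsimp only; omega⟩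
  have q1 : ∀ x y, IsCell n x y → ty2 (IsCell n) x y → sE f x y + sD f x y ≤ 4 * f x y + 3 := by
    intro x y a b
    obtain ⟨v, hv⟩ := vtx1 x y a
    have := hf v
    have nt : ¬ ty3 (IsCell n) x y := fun q => not_three ⟨a, b, q⟩
    rw [nbrsum, deg_types, hv] at this
    simp only [a, b, nt, if_true, if_false] at this
    omega
  have q2 : ∀ x y, IsCell n x y → ty3 (IsCell n) x y → sF f x y + sD f x y ≤ 4 * f x y + 3 := by
    intro x y a b
    obtain ⟨v, hv⟩ := vtx1 x y a
    have := hf v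
    have nt : ¬ ty2 (IsCell n) x y := fun q => not_three ⟨a, q, b⟩
    rw [nbrsum, deg_types, hv] at this
    simp only [a, b, nt, if_true, if_false] at this
    omega
  have q3 : ∀ x y, ty2 (IsCell n) x y → ty3 (IsCell n) x y → sF f x y + sE f x y ≤ 4 * f x y + 3 := by
    intro x y a b
    obtain ⟨v, hv⟩ := vtx2 x y a
    have := hf v
    have nt : ¬ IsCell n x y := fun q => not_three ⟨q, a, b⟩
    rw [nbrsum, deg_types, hv] at this
    simp only [a, b, nt, if_true, if_false] at this
    omega
  have sL : Sol f k r cL := sol_of _ vL q1 q2 q3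
  have sR : Sol f k r h := sol_of _ vR q1 q2 q3
  have eL := sol_rel sL
  have eR := sol_rel sR
  rw [hr] at eL eR
  rw [hcL] at eL
  have eL' := eL.swapBC.swapAB.sy
  have eR' := eR.swapAB.sy
  refine ⟨?_, ?_⟩
  · intro s hs h0
    refine ⟨_, _, ?_, eL'.down le_rfl (Nat.zero_le _) (Nat.zero_le _)⟩
    omega
  · rintro ⟨hc1, hc2⟩ hno x y hin
    have nL := fun hh => hno ⟨_, _, hh, eL'.down le_rfl (Nat.zero_le _) (Nat.zero_le _)⟩
    have nR := fun hh => hno ⟨_, _, hh, eR'.down le_rfl (Nat.zero_le _) (Nat.zero_le _)⟩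
    have hPP : PP k (f (2 ^ n) h) := by
      intro α β γ q
      by_contra hcon
      have q2 := q.sy
      rw [min_self] at q2
      exact hno ⟨_, _, by omega, q2⟩
    have p0 : 1 ≤ f (2 ^ n) h := by
      by_contra hcon
      have e : f (2 ^ n) h = 0 := by omega
      exact hno ⟨0, 0, by omega, by rw [e]; exact GRel.const k 0 le_rfl le_rfl le_rfl⟩
    have ptop : ∀ c, IsCell n r c → f r c = 0 → sD f r c ≤ 3 := by
      intro c hc h0
      rcases two_of_top hr1 hc with t | t
      · have := q1 _ _ hc t; omega
      · have := q2 _ _ hc t; omega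
    have p1 : 1 ≤ f r cL := by
      by_contra hcon
      have := ptop cL (vL _ _ (cell_top _ _ _)) (by omega)
      exact nL (by omega)
    have p2 : 1 ≤ f r h := by
      by_contra hcon
      have := ptop h (vR _ _ (cell_top _ _ _)) (by omega)
      exact nR (by omega)
    have p3 : 1 ≤ f (2 ^ n) cL := by
      by_contra hcon
      have := q3 (2 ^ n) cL (ty2_bottom (by omega)) (ty3_bottom hc1 (by omega))
      exact nL (by omega)
    have p4 : 1 ≤ f (2 ^ n) (h + 2 ^ k) := by
      by_contra hcon
      have := q3 (2 ^ n) (h + 2 ^ k) (ty2_bottom (by omega)) (ty3_bottom (by omega) (by omega))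
      exact nR (by omega)
    rcases hin with hin | hin
    · rcases inC_cases hin with hc | hj
      · unfold Cor at hc
        rw [hr, hcL] at hc
        rcases hc with ⟨rfl, rfl⟩ | ⟨rfl, rfl⟩ | ⟨rfl, rfl⟩ <;> assumption
      · refine sol_pos sL ?_ x y hj
        rw [hr, hcL]; tauto
    · rcases inC_cases hin with hc | hj
      · unfold Cor at hc
        rw [hr] at hc
        rcases hc with ⟨rfl, rfl⟩ | ⟨rfl, rfl⟩ | ⟨rfl, rfl⟩ <;> assumption
      · refine sol_pos sR ?_ x y hj
        rw [hr]; tauto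

/-- First end of an edge. -/
def endA (i j t : ℕ) : ℕ × ℕ := if t = 2 then (i + 1, j) else (i, j)
/-- Second end of an edge. -/
def endB (i j t : ℕ) : ℕ × ℕ := if t = 0 then (i + 1, j) else (i + 1, j + 1)

lemma count_edges {n N k r cL h : ℕ} {v0 : SGV n} {l : List (SGV n)} {η' : SGV n → ℕ}
    (hl : Topples (SGgraph n) ∅ (fun v => if v = v0 then N else 0) l η')
    (hr : r + 2 ^ k = 2 ^ n) (hcL : cL + 2 ^ k = h) (hh : h + h = 2 ^ n) (hc1 : 1 ≤ cL)
    (vL : ∀ i j, (i, j) ∈ cells k r cL → IsCell n i j)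
    (vR : ∀ i j, (i, j) ∈ cells k r h → IsCell n i j)
    (hall : ∀ v : SGV n, InC k r cL v.val.1 v.val.2 ∨ InC k r h v.val.1 v.val.2 → v ∈ l) :
    2 * 3 ^ (k + 1) + 1 ≤ N := by
  have pos : 0 < 2 ^ k := by positivity
  obtain ⟨L, a1, a2, a3⟩ := last_topple hl 0 (fun _ => 0) (by simp) (by simp) (by simp)
  have hN : ∑ v, η' v = N := by
    rw [topples_sum hl]; simp
  obtain ⟨Q, hQ⟩ : ∃ Q : Finset (SGV n × SGV n), Q = Finset.univ.filter
    (fun p => (SGgraph n).Adj p.1 p.2 ∧ L p.1 < L p.2) := ⟨_, rfl⟩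
  have hQc : Q.card ≤ N := by
    rw [← hN, hQ, Finset.card_filter, Fintype.sum_prod_type]
    apply Finset.sum_le_sum
    intro v _
    rw [← Finset.card_filter]
    exact a2 v
  obtain ⟨S, hS⟩ : ∃ S : Finset ((ℕ × ℕ) × ℕ), S =
    insert ((2 ^ n - 1, cL - 1), 2) ((cells k r cL ∪ cells k r h) ×ˢ Finset.range 3) := ⟨_, rfl⟩
  have hSc : S.card = 2 * 3 ^ (k + 1) + 1 := by
    rw [hS, Finset.card_insert_of_notMem, Finset.card_product, Finset.card_union_of_disjoint,
      cells_card, cells_card, Finset.card_range]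
    · ring
    · rw [Finset.disjoint_left]
      rintro ⟨i, j⟩ h1 h2
      have := cells_region h1
      have := cells_region h2
      omega
    · intro hmem
      rw [Finset.mem_product, Finset.mem_union] at hmem
      rcases hmem.1 with q | q <;> have := cells_region q <;> omega
  rw [← hSc]
  refine le_trans ?_ hQc
  refine Finset.card_le_card_of_forall_subsingleton (fun e p =>
    (p.1.val = endA e.1.1 e.1.2 e.2 ∧ p.2.val = endB e.1.1 e.1.2 e.2) ∨
    (p.2.val = endA e.1.1 e.1.2 e.2 ∧ p.1.val = endB e.1.1 e.1.2 e.2)) ?_ ?_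
  · rintro ⟨⟨i, j⟩, t⟩ he
    have hkey : t < 3 ∧ IsCell n i j ∧ (∀ v : SGV n, v.val = endB i j t → v ∈ l) := by
      rw [hS, Finset.mem_insert, Finset.mem_product, Finset.mem_union, Finset.mem_range] at he
      rcases he with he | ⟨he, ht⟩
      · simp only [Prod.mk.injEq] at he
        obtain ⟨⟨rfl, rfl⟩, rfl⟩ := he
        refine ⟨by omega, bottom_cell (by omega), ?_⟩
        intro v hv
        apply hall
        left
        refine ⟨_, _, cell_left k r cL, ?_⟩
        rw [hv]
        unfold endB InCorners
        simp
        omega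
      · refine ⟨ht, ?_, ?_⟩
        · rcases he with he | he
          · exact vL _ _ he
          · exact vR _ _ he
        · intro v hv
          apply hall
          have hcor : InCorners i j v.val.1 v.val.2 := by
            rw [hv]; unfold endB InCorners; split_ifs <;> simp
          rcases he with he | he
          · left; exact ⟨_, _, he, hcor⟩
          · right; exact ⟨_, _, he, hcor⟩
    obtain ⟨ht, hc, hb⟩ := hkey
    have cA : InCorners i j (endA i j t).1 (endA i j t).2 := by
      unfold endA InCorners; split_ifs <;> simp
    have cB : InCorners i j (endB i j t).1 (endB i j t).2 := by
      unfold endB InCorners; split_ifs <;> simp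
    obtain ⟨v, hv⟩ := mkV (n := n) (p := endA i j t) ⟨_, _, hc, cA⟩
    obtain ⟨w, hw⟩ := mkV (n := n) (p := endB i j t) ⟨_, _, hc, cB⟩
    have hne : v ≠ w := by
      rintro rfl
      rw [hv] at hw
      unfold endA endB at hw
      split_ifs at hw <;> simp at hw
      omega
    have hadj : (SGgraph n).Adj v w := ⟨hne, i, j, hc, by rw [hv]; exact cA, by rw [hw]; exact cB⟩
    have hLw : 0 < L w := a3 w (Or.inr (hb w hw))
    have hLne : L w ≠ L v := fun q => hne (a1 w v q hLw).symm
    rcases lt_or_gt_of_ne hLne with q | q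
    · exact ⟨(w, v), by rw [hQ]; simp [hadj.symm, q], Or.inr ⟨hv, hw⟩⟩
    · exact ⟨(v, w), by rw [hQ]; simp [hadj, q], Or.inl ⟨hv, hw⟩⟩
  · rintro ⟨v, w⟩ _ ⟨⟨i, j⟩, t⟩ ⟨he, h1⟩ ⟨⟨i', j'⟩, t'⟩ ⟨he', h2⟩
    have ht : ∀ i j t, ((i, j), t) ∈ S → t < 3 := by
      intro i j t he
      rw [hS, Finset.mem_insert, Finset.mem_product, Finset.mem_range] at he
      rcases he with he | he
      · simp only [Prod.mk.injEq] at he; omega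
      · exact he.2
    have t1 := ht _ _ _ he
    have t2 := ht _ _ _ he'
    simp only [Prod.mk.injEq]
    dsimp only at h1 h2
    have h3 : (endA i j t = endA i' j' t' ∧ endB i j t = endB i' j' t') ∨
        (endA i j t = endB i' j' t' ∧ endB i j t = endA i' j' t') := by
      rcases h1 with ⟨p1, p2⟩ | ⟨p1, p2⟩ <;> rcases h2 with ⟨p3, p4⟩ | ⟨p3, p4⟩ <;>
        rw [p1] at * <;> rw [p2] at * <;> tauto
    clear h1 h2 ht he he'
    unfold endA endB at h3
    interval_cases t <;> interval_cases t' <;> simp at h3 <;> omega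

lemma ball_exists {n k : ℕ} (hk : k < n) : ∃ r cL h, h = 2 ^ (n - 1) ∧ r + 2 ^ k = 2 ^ n ∧
    cL + 2 ^ k = h ∧ h + h = 2 ^ n ∧ 1 ≤ r ∧
    (k + 1 < n → (1 ≤ cL ∧ h + 2 ^ k < 2 ^ n)) ∧ (k + 1 = n → cL = 0) ∧
    (∀ i j, (i, j) ∈ cells k r cL → IsCell n i j) ∧
    (∀ i j, (i, j) ∈ cells k r h → IsCell n i j) := by
  obtain ⟨m, rfl⟩ : ∃ m, n = k + (m + 1) := ⟨n - k - 1, by omega⟩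
  have pos : 0 < 2 ^ k := by positivity
  have pos' : 0 < 2 ^ m := by positivity
  have e1 : 2 ^ (k + (m + 1)) = 2 ^ k * 2 ^ m + 2 ^ k * 2 ^ m := by ring
  have e2 : 2 ^ (k + (m + 1) - 1) = 2 ^ k * 2 ^ m := by
    rw [← pow_add]; congr 1
  have e3 : 2 ^ k * (2 ^ m - 1) + 2 ^ k = 2 ^ k * 2 ^ m := by
    rw [← Nat.mul_succ]; congr 1; omega
  have e4 : 2 ^ k * (2 ^ (m + 1) - 1) + 2 ^ k = 2 ^ (k + (m + 1)) := by
    have h1 : 0 < 2 ^ (m + 1) := by positivity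
    have h2 : 2 ^ (m + 1) - 1 + 1 = 2 ^ (m + 1) := by omega
    calc 2 ^ k * (2 ^ (m + 1) - 1) + 2 ^ k = 2 ^ k * (2 ^ (m + 1) - 1 + 1) := by ring
      _ = 2 ^ (k + (m + 1)) := by rw [h2, ← pow_add]
  have e5 : 2 ^ k ≤ 2 ^ k * 2 ^ m := Nat.le_mul_of_pos_right _ pos'
  refine ⟨2 ^ k * (2 ^ (m + 1) - 1), 2 ^ k * (2 ^ m - 1), 2 ^ k * 2 ^ m, e2.symm, e4, e3, e1.symm,
    Nat.mul_pos pos (by have : 2 ≤ 2 ^ (m + 1) := by rw [pow_succ]; omega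
                        omega), ?_, ?_, ?_, ?_⟩
  · intro hm
    obtain ⟨q, rfl⟩ : ∃ q, m = q + 1 := ⟨m - 1, by omega⟩
    have : 2 ^ k * 2 ^ (q + 1) = 2 ^ k * 2 ^ q + 2 ^ k * 2 ^ q := by ring
    have : 2 ^ k ≤ 2 ^ k * 2 ^ q := Nat.le_mul_of_pos_right _ (by positivity)
    clear e2 e4
    rw [e1]
    generalize 2 ^ k * (2 ^ (q + 1) - 1) = X at *
    generalize 2 ^ k * 2 ^ (q + 1) = Y at *
    generalize 2 ^ k * 2 ^ q = Z at *
    omega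
  · intro hm
    have : m = 0 := by omega
    subst this; simp
  · intro i j q
    exact cells_isCell (by rw [pow_succ]; omega) q
  · intro i j q
    exact cells_isCell (by rw [pow_succ]; omega) q

lemma dichotomy {n N k : ℕ} (hk : k < n)
    (v0 : SGV n) (hv0 : v0.val = (2 ^ n, 2 ^ (n - 1)))
    (l : List (SGV n)) (η' : SGV n → ℕ)
    (hl : Topples (SGgraph n) ∅ (fun v => if v = v0 then N else 0) l η')
    (hstable : Stable (SGgraph n) ∅ η')
    (hboundary : ∀ b ∈ SGBoundary n, b ∉ l ∧ η' b = 0) :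
    (∀ v, 1 ≤ η' v → (SGgraph n).dist v0 v ≤ 2 ^ k) ∨
    (k + 1 < n ∧ 2 * 3 ^ (k + 1) + 1 ≤ N) := by
  obtain ⟨r, cL, h, hhe, hr, hcL, hh, hr1, hm1, hm2, vL, vR⟩ := ball_exists hk
  rw [← hhe] at hv0
  have pos : 0 < 2 ^ k := by positivity
  obtain ⟨f, hfdef⟩ : ∃ f : ℕ → ℕ → ℕ, ∀ v : SGV n, f v.val.1 v.val.2 = l.count v := by
    refine ⟨fun x y => if q : ∃ v : SGV n, v.val = (x, y) then l.count q.choose else 0, ?_⟩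
    intro v
    have q : ∃ w : SGV n, w.val = (v.val.1, v.val.2) := ⟨v, rfl⟩
    have e : q.choose = v := Subtype.ext q.choose_spec
    simp only [q, dif_pos]
    rw [e]
  have hcount := topples_count hl
  have hf : ∀ v : SGV n,
        ∑ w ∈ Finset.univ.filter (fun w => (SGgraph n).Adj v w), f w.val.1 w.val.2
          < deg (SGgraph n) v * (f v.val.1 v.val.2 + 1) := by
    intro v
    have h1 := hcount v
    have h2 := hstable v (by simp)
    simp only [hfdef]
    rw [mul_add]
    omega
  obtain ⟨F1, F2⟩ := full_ball hr hcL hh hr1 vL vR f hf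
  have hfv0 : f (2 ^ n) h = l.count v0 := by
    have := hfdef v0
    rwa [hv0] at this
  have conf : (∃ α s, s ≤ 3 ∧ (k + 1 = n → s = 0) ∧ GRel k (f (2 ^ n) h) 0 0 α s s) →
      (∀ v, 1 ≤ η' v → (SGgraph n).dist v0 v ≤ 2 ^ k) := by
    rintro ⟨α, s, hs3, hs0, hrel⟩ v hv
    obtain ⟨G, g1, g2, g3⟩ := confine hr hcL hh hr1
      (by by_cases q : k + 1 = n
          · exact Or.inl q
          · exact Or.inr (hm1 (by omega))) vL vR v0 hv0 hrel hs3 hs0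
    have hle := least_action hl v0 (fun v => if v = v0 then N else 0)
      (fun v => G v.val.1 v.val.2) (by
        intro v hv
        have := g2 v hv
        simpa [hv] using this) (fun _ => 0) (by simp) (by simp) (by
        rw [hv0]; simp only [g1, hfv0]; omega)
    have hin : InC k r cL v.val.1 v.val.2 ∨ InC k r h v.val.1 v.val.2 := by
      by_cases hvv : v = v0
      · rw [hvv, hv0]
        left
        exact ⟨_, _, cell_right k r cL, by unfold InCorners; dsimp only; omega⟩
      · have h1 := hcount v
        simp only [hvv, if_false] at h1
        have : ∃ w ∈ Finset.univ.filter (fun w => (SGgraph n).Adj v w), l.count w ≠ 0 := by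
          by_contra hcon
          push Not at hcon
          rw [Finset.sum_eq_zero hcon] at h1
          omega
        obtain ⟨w, hw, hw0⟩ := this
        have hadj : (SGgraph n).Adj v w := by simpa using hw
        have := hle w
        exact g3 w v (by omega) hadj.symm
    have hwk : Wk n (2 ^ k) (2 ^ n, h) (v.val.1, v.val.2) := by
      rcases hin with hin | hin
      · exact wk_copy vL hin (by unfold Cor; omega)
      · exact wk_copy vR hin (by unfold Cor; omega)
    obtain ⟨a, b, w, ha, hb, hw⟩ := hwk
    have ea : a = v0 := (sgEmb n).injective (ha.trans hv0.symm)
    have eb : b = v := (sgEmb n).injective hb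
    subst ea eb
    exact le_trans (SimpleGraph.dist_le w) hw
  by_cases hkn : k + 1 = n
  · left
    apply conf
    have hc0 := hm2 hkn
    obtain ⟨b, hb⟩ := mkV (n := n) (p := (2 ^ n, cL))
      ⟨_, _, vL _ _ (cell_left k r cL), by unfold InCorners; dsimp only; omega⟩
    obtain ⟨b1, b2⟩ := hboundary b (Or.inr (Or.inl (by rw [hb, hc0])))
    have hb0 : l.count b = 0 := List.count_eq_zero_of_not_mem b1
    have hfb : f (2 ^ n) cL = 0 := by
      have := hfdef b
      rw [hb, hb0] at this
      exact this
    have hbv : b ≠ v0 := by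
      rintro rfl
      rw [hv0] at hb
      simp at hb
      omega
    have hsum := hcount b
    rw [b2, hb0] at hsum
    simp only [hbv, if_false] at hsum
    have e := nbrsum b f
    simp only [hfdef] at e
    rw [hb] at e
    have t := ty2_bottom (n := n) (y := cL) (by omega)
    simp only [t, if_true] at e
    obtain ⟨α, s', hs', hrel⟩ := F1 _ rfl hfb
    exact ⟨α, s', by omega, by omega, hrel⟩
  · by_cases hex : ∃ α s, s ≤ 3 ∧ GRel k (f (2 ^ n) h) 0 0 α s s
    · left
      apply conf
      obtain ⟨α, s, q1, q2⟩ := hex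
      exact ⟨α, s, q1, fun q => (hkn q).elim, q2⟩
    · right
      have hkn' : k + 1 < n := by omega
      refine ⟨hkn', ?_⟩
      have hall := F2 (hm1 hkn') hex
      refine count_edges hl hr hcL hh (hm1 hkn').1 vL vR ?_
      intro v hv
      have := hall _ _ hv
      rw [hfdef] at this
      exact List.count_pos_iff.1 this

lemma real_final {R k N : ℕ} (hR : R ≤ 2 ^ k) (hN : 2 * 3 ^ k + 1 ≤ N) :
    (R : ℝ) < ((N : ℝ) / 2) ^ (1 / (Real.log 3 / Real.log 2)) := by
  have l3 : 0 < Real.log 3 := Real.log_pos (by norm_num)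
  have l2 : 0 < Real.log 2 := Real.log_pos (by norm_num)
  have e : 1 / (Real.log 3 / Real.log 2) = Real.log 2 / Real.log 3 := by field_simp
  rw [e]
  have h3 : (3 : ℝ) ^ (Real.log 2 / Real.log 3) = 2 := by
    rw [Real.rpow_def_of_pos (by norm_num), mul_div_cancel₀ _ l3.ne', Real.exp_log (by norm_num)]
  have h4 : ((3 : ℝ) ^ k) ^ (Real.log 2 / Real.log 3) = 2 ^ k := by
    rw [← Real.rpow_natCast, ← Real.rpow_mul (by norm_num), mul_comm, Real.rpow_mul (by norm_num), h3,
      Real.rpow_natCast]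
  have h5 : (3 : ℝ) ^ k < (N : ℝ) / 2 := by
    have : (2 * 3 ^ k + 1 : ℝ) ≤ N := by exact_mod_cast hN
    linarith
  calc (R : ℝ) ≤ 2 ^ k := by exact_mod_cast hR
    _ = ((3 : ℝ) ^ k) ^ (Real.log 2 / Real.log 3) := h4.symm
    _ < _ := Real.rpow_lt_rpow (by positivity) h5 (by positivity)

lemma small_case {n N : ℕ} (hn : 1 ≤ n) (v0 : SGV n) (hv0 : v0.val = (2 ^ n, 2 ^ (n - 1)))
    (l : List (SGV n)) (η' : SGV n → ℕ)
    (hl : Topples (SGgraph n) ∅ (fun v => if v = v0 then N else 0) l η') (hN : N < 4) :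
    ∀ v, 1 ≤ η' v → (SGgraph n).dist v0 v ≤ 0 := by
  cases hl with
  | nil =>
    intro v hv
    by_cases h : v = v0
    · subst h; simp
    · simp [h] at hv
  | cons a ha hge ht =>
    exfalso
    by_cases h : a = v0
    · subst h
      simp at hge
      rw [deg_types, hv0] at hge
      have e : 2 ^ n = 2 ^ (n - 1) + 2 ^ (n - 1) := by
        obtain ⟨q, rfl⟩ : ∃ q, n = q + 1 := ⟨n - 1, by omega⟩
        simp; ring
      have : 0 < 2 ^ (n - 1) := by positivity
      have t2 := ty2_bottom (n := n) (y := 2 ^ (n - 1)) (by omega)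
      have t3 := ty3_bottom (n := n) (y := 2 ^ (n - 1)) (by omega) (by omega)
      simp only [t2, t3, if_true] at hge
      omega
    · have := deg_pos a
      simp [h] at hge
      omega

/-- Let `N` be the number of grains of sand placed on the vertex `v0`
(the midpoint of the bottom boundary) of a sufficiently large graph approximation `SG_n`
of the Sierpinski gasket — "sufficiently large" meaning that no grain ever reaches the
boundary — and let `R` be the diameter after stabilization (the maximum graph distance
from `v0` of a vertex carrying at least one grain).  Then `R < (N/2)^(1/D_f)`, where
`D_f = log 3 / log 2`. -/
theorem sg_growth_upper_bound
    (n : ℕ) (hn : 1 ≤ n) (N : ℕ) (hN : 1 ≤ N)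
    (v0 : SGV n) (hv0 : v0.val = (2 ^ n, 2 ^ (n - 1)))
    (l : List (SGV n)) (η' : SGV n → ℕ)
    (hl : Topples (SGgraph n) ∅ (fun v => if v = v0 then N else 0) l η')
    (hstable : Stable (SGgraph n) ∅ η')
    (hboundary : ∀ b ∈ SGBoundary n, b ∉ l ∧ η' b = 0) :
    (reachRadius n v0 η' : ℝ) < ((N : ℝ) / 2) ^ (1 / (Real.log 3 / Real.log 2)) := by
  have hbound : ∀ B, (∀ v, 1 ≤ η' v → (SGgraph n).dist v0 v ≤ B) → reachRadius n v0 η' ≤ B := by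
    intro B hB
    apply csSup_le'
    rintro d ⟨v, hv, rfl⟩
    exact hB v hv
  by_cases hN4 : N < 4
  · have := hbound 0 (small_case hn v0 hv0 l η' hl hN4)
    have h0 : reachRadius n v0 η' = 0 := by omega
    rw [h0]
    have : (0 : ℝ) < N := by exact_mod_cast hN
    simp only [Nat.cast_zero]
    positivity
  · have hex : ∃ k, k < n ∧ ∀ v, 1 ≤ η' v → (SGgraph n).dist v0 v ≤ 2 ^ k := by
      refine ⟨n - 1, by omega, ?_⟩
      rcases dichotomy (k := n - 1) (by omega) v0 hv0 l η' hl hstable hboundary with h | h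
      · exact h
      · omega
    obtain ⟨hk, hc⟩ := Nat.find_spec hex
    have hmin := fun m => Nat.find_min hex (m := m)
    generalize Nat.find hex = k at *
    refine real_final (hbound _ hc) ?_
    rcases Nat.eq_zero_or_pos k with rfl | hkpos
    · simp; omega
    · obtain ⟨j, rfl⟩ : ∃ j, k = j + 1 := ⟨k - 1, by omega⟩
      rcases dichotomy (k := j) (by omega) v0 hv0 l η' hl hstable hboundary with h | h
      · exact (hmin j (by omega) ⟨by omega, h⟩).elim
      · exact h.2
end

section
/- Let G = (V, E) be a finite graph with a nonempty set B ⊆ V of sink vertices, and define the configuration Id_f by letting Id_f(v) be the number of edges joining v to sink vertices. If η_G is a recurrent configuration on G, then (Id_f + η_G)° = η_G; that is, Id_f acts as an identity on recurrent configurations under addition-and-stabilization. -/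
open Classical

open ASM

namespace ASM

theorem count_insert {V : Type*} [Finite V] (G : SimpleGraph V) (u v : V) (A : Set V)
    (hv : v ∉ A) : (G.neighborSet u ∩ insert v A).ncard =
      (G.neighborSet u ∩ A).ncard + (if G.Adj v u then 1 else 0) := by
  by_cases h : G.Adj v u
  · have h1 : v ∈ G.neighborSet u := h.symm
    rw [Set.inter_insert_of_mem h1, Set.ncard_insert_of_notMem (fun h2 => hv h2.2), if_pos h]
  · have h1 : v ∉ G.neighborSet u := fun h2 => h (G.adj_symm h2)
    rw [Set.inter_insert_of_notMem h1, if_neg h, add_zero]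

theorem count_compl {V : Type*} [Finite V] (G : SimpleGraph V) (u : V) (A : Set V) :
    (G.neighborSet u ∩ A).ncard + (G.neighborSet u ∩ Aᶜ).ncard = deg G u := by
  rw [← Set.sdiff_eq]
  exact Set.ncard_inter_add_ncard_sdiff_eq_ncard _ _

theorem not_mem_bound {V : Type*} [Finite V] (G : SimpleGraph V) (S : Set V)
    {η η' : V → ℕ} {l : List V} (h : Topples G S η l η') (v : V) (hv : v ∉ l) :
    η v + (G.neighborSet v ∩ {x | x ∈ l}).ncard ≤ η' v := by
  induction h with
  | nil η => simp
  | @cons η η' l w hw hge ht ih =>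
    have hvw : v ≠ w := fun e => hv (by simp [e])
    have hvl : v ∉ l := fun e => hv (by simp [e])
    have h1 := ih hvl
    have h2 : toppleAt G η w v = η v + (if G.Adj w v then 1 else 0) := by
      simp [toppleAt, hvw]
    rw [h2] at h1
    have h3 : {x | x ∈ w :: l} = insert w {x | x ∈ l} := by
      ext x; simp
    rw [h3]
    by_cases hwl : w ∈ l
    · rw [Set.insert_eq_of_mem (show w ∈ {x | x ∈ l} from hwl)]
      omega
    · rw [count_insert G v w _ hwl]
      omega

theorem no_forbidden {V : Type*} [Finite V] (G : SimpleGraph V) (S U : Set V)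
    (hU : U.Nonempty) {η η' : V → ℕ} {l : List V} (h : Topples G S η l η')
    (hl : ∀ v ∈ U, v ∈ l) : ∃ v ∈ U, (G.neighborSet v ∩ U).ncard ≤ η' v := by
  induction h with
  | nil η => obtain ⟨v, hv⟩ := hU; simpa using hl v hv
  | @cons η η' l w hw hge ht ih =>
    by_cases h : ∀ v ∈ U, v ∈ l
    · exact ih h
    · push Not at h
      obtain ⟨u, hu, hul⟩ := h
      have huw : u = w := by simpa [hul] using hl u hu
      refine ⟨u, hu, ?_⟩
      have h1 := not_mem_bound G S ht u hul
      have h2 : (G.neighborSet u ∩ U).ncard ≤ (G.neighborSet u ∩ {x | x ∈ l}).ncard := by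
        apply Set.ncard_le_ncard _ (Set.toFinite _)
        rintro x ⟨hx, hxU⟩
        refine ⟨hx, ?_⟩
        have hne : x ≠ w := by
          rintro rfl
          subst huw
          exact G.loopless.irrefl _ hx
        simpa [hne] using hl x hxU
      omega

theorem recurrent_allowed {V : Type*} [Finite V] (G : SimpleGraph V) (S U : Set V)
    (hU : U.Nonempty) (hUS : ∀ v ∈ U, v ∉ S) (η : V → ℕ) (hrec : Recurrent G S η) :
    ∃ v ∈ U, (G.neighborSet v ∩ U).ncard ≤ η v := by
  obtain ⟨τ, η', ⟨l, hl, hst⟩, he⟩ := hrec.2 (deg G)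
  obtain ⟨v, hv, h⟩ := no_forbidden G S U hU hl (by
    intro v hv
    by_contra hvl
    have h1 := not_mem_bound G S hl v hvl
    have h2 := hst v (hUS v hv)
    simp only [Pi.add_apply] at h1
    omega)
  exact ⟨v, hv, by rw [← he v (hUS v hv)]; exact h⟩

theorem burn {V : Type*} [Finite V] (G : SimpleGraph V) (S : Set V)
    (η : V → ℕ) (hrec : Recurrent G S η) (n : ℕ) : ∀ (U : Set V) (ζ : V → ℕ),
    U.ncard = n → (∀ v ∈ U, v ∉ S) →
    (∀ v ∈ U, ζ v = η v + (G.neighborSet v ∩ Uᶜ).ncard) →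
    (∀ v, v ∉ S → v ∉ U → ζ v + deg G v = η v + (G.neighborSet v ∩ Uᶜ).ncard) →
    ∃ l η', Topples G S ζ l η' ∧ ∀ v, v ∉ S → η' v = η v := by
  induction n with
  | zero =>
    intro U ζ hn hUS h1 h2
    have hU : U = ∅ := (Set.ncard_eq_zero (Set.toFinite _)).1 hn
    subst hU
    refine ⟨[], ζ, Topples.nil ζ, fun v hv => ?_⟩
    have := h2 v hv (by simp)
    simp only [Set.compl_empty, Set.inter_univ] at this
    unfold deg at this
    omega
  | succ n ih =>
    intro U ζ hn hUS h1 h2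
    have hU : U.Nonempty := Set.nonempty_of_ncard_ne_zero (by omega)
    obtain ⟨v, hv, hle⟩ := recurrent_allowed G S U hU hUS η hrec
    have hc := count_compl G v U
    have hζ := h1 v hv
    have hge : deg G v ≤ ζ v := by omega
    have hcomp : (U \ {v})ᶜ = insert v Uᶜ := by
      ext x; by_cases hx : x = v <;> simp [hx]
    have hins : ∀ u, (G.neighborSet u ∩ (U \ {v})ᶜ).ncard =
        (G.neighborSet u ∩ Uᶜ).ncard + (if G.Adj v u then 1 else 0) := by
      intro u
      rw [hcomp]
      exact count_insert G u v _ (by simpa using hv)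
    have hne : ∀ u, u ≠ v → toppleAt G ζ v u = ζ u + (if G.Adj v u then 1 else 0) := by
      intro u hu; simp [toppleAt, hu]
    obtain ⟨l, η', hl, he⟩ := ih (U \ {v}) (toppleAt G ζ v)
      (by rw [Set.ncard_sdiff_singleton_of_mem hv]; omega)
      (fun u hu => hUS u hu.1)
      (by
        rintro u ⟨hu, huv⟩
        rw [hins, hne u huv, h1 u hu]
        omega)
      (by
        intro u hu huU
        rw [hins]
        by_cases huv : u = v
        · subst huv
          simp only [toppleAt, if_true, SimpleGraph.irrefl, if_false]
          omega
        · have := h2 u hu (fun h => huU ⟨h, huv⟩)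
          rw [hne u huv]
          omega)
    exact ⟨v :: l, η', Topples.cons v (hUS v hv) hge hl, he⟩

end ASM

/-- Let `G = (V, E)` be a finite graph with a nonempty set `S` of sink
vertices, and let `idf` be the configuration assigning to each vertex the number of edges
joining it to sink vertices.  If `η` is a recurrent configuration on `G`, then
`(idf + η)° = η`, i.e. `idf` acts as an identity on recurrent configurations under
addition-and-stabilization. -/
theorem idf_acts_as_identity_on_recurrent
    {V : Type*} [Fintype V] (G : SimpleGraph V) (S : Set V) (hS : S.Nonempty)
    (η : V → ℕ) (hrec : Recurrent G S η) :
    ∃ η' : V → ℕ, StabilizesTo G S (idf G S + η) η' ∧ ∀ v, v ∉ S → η' v = η v := by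
  obtain ⟨l, η', hl, he⟩ := ASM.burn G S η hrec _ Sᶜ (idf G S + η) rfl (fun v hv => hv)
    (fun v _ => by simp [idf, add_comm]) (fun v h1 h2 => absurd h1 h2)
  refine ⟨η', ⟨l, hl, fun v hv => ?_⟩, he⟩
  rw [he v hv]
  exact hrec.1 v hv
end

section
/- Let G = (V, E) be a connected graph and B ⊆ V a finite set of vertices whose removal (together with incident edges) disconnects G into a finite graph F and a second graph; let S be the graph consisting of F together with the vertices of B declared as sinks, including all edges of E joining F and B. Fix a configuration η_F on F and a configuration η_G on G. If stabilizing the configuration kη_F + η_G on G is possible for k ≥ N(F, η_F) and causes all vertices of B to topple the same number of times, then the restriction to F of the stabilization on G equals the restriction to F of the stabilization on S; that is, the stabilized configurations G|_F and S|_F agree vertexwise. -/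
open Classical

namespace ASM

variable {V : Type*}

lemma toppleAt_comm (G : SimpleGraph V) (η : V → ℕ) {v w : V} (hvw : w ≠ v)
    (hv : deg G v ≤ η v) (hw : deg G w ≤ η w) :
    toppleAt G (toppleAt G η w) v = toppleAt G (toppleAt G η v) w := by
  funext u
  unfold toppleAt
  by_cases h1 : u = v
  · subst h1
    simp only [if_true, if_neg hvw.symm]
    omega
  · by_cases h2 : u = w
    · subst h2
      simp only [if_true, if_neg h1]
      omega
    · simp only [if_neg h1, if_neg h2]
      omega

lemma le_toppleAt (G : SimpleGraph V) (η : V → ℕ) {v w : V} (hvw : v ≠ w) :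
    η v ≤ toppleAt G η w v := by
  unfold toppleAt
  rw [if_neg hvw]; omega

lemma one_step {G : SimpleGraph V} {S : Set V} {η η2 : V → ℕ} {l : List V}
    (h : Topples G S η l η2) (hs : Stable G S η2) (v : V) (hv : v ∉ S) (hge : deg G v ≤ η v) :
    ∃ l', l'.length + 1 = l.length ∧ Topples G S (toppleAt G η v) l' η2 := by
  induction h with
  | nil η => exact absurd (hs v hv) (by omega)
  | @cons η η' l w hw hwge ht ih =>
    by_cases hvw : w = v
    · subst hvw
      exact ⟨l, rfl, ht⟩
    · have h1 := le_toppleAt G η (v := v) (w := w) (Ne.symm hvw)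
      obtain ⟨l', hl', ht'⟩ := ih hs (hge.trans h1)
      refine ⟨w :: l', by simp [hl'], Topples.cons w hw ?_ ?_⟩
      · exact hwge.trans (le_toppleAt G η hvw)
      · rw [← toppleAt_comm G η hvw hge hwge]; exact ht'

lemma confl {G : SimpleGraph V} {S : Set V} {η η1 η2 : V → ℕ} {l : List V}
    (h : Topples G S η l η1) (hs : StabilizesTo G S η η2) : StabilizesTo G S η1 η2 := by
  induction h with
  | nil η => exact hs
  | cons w hw hwge ht ih =>
    obtain ⟨l2, h2, hst⟩ := hs
    obtain ⟨l', -, h'⟩ := one_step h2 hst w hw hwge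
    exact ih ⟨l', h', hst⟩

lemma trans' {G : SimpleGraph V} {S : Set V} {η η1 η2 : V → ℕ} {l m : List V}
    (h : Topples G S η l η1) (h2 : Topples G S η1 m η2) : Topples G S η (l ++ m) η2 := by
  induction h with
  | nil η => exact h2
  | cons w hw hwge ht ih => exact Topples.cons w hw hwge (ih h2)

lemma stable_unique {G : SimpleGraph V} {S : Set V} {η η2 : V → ℕ}
    (h : Stable G S η) (hs : StabilizesTo G S η η2) : η = η2 := by
  obtain ⟨l, ht, -⟩ := hs
  cases ht with
  | nil => rfl
  | cons v hv hge ht => exact absurd (h v hv) (by omega)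

lemma stab_unique {G : SimpleGraph V} {S : Set V} {η η1 η2 : V → ℕ}
    (h1 : StabilizesTo G S η η1) (h2 : StabilizesTo G S η η2) : η1 = η2 := by
  obtain ⟨l, ht, hs⟩ := h1
  exact stable_unique hs (confl ht h2)

lemma toppleAt_add (G : SimpleGraph V) (η ξ : V → ℕ) {v : V} (hge : deg G v ≤ η v) :
    toppleAt G (η + ξ) v = toppleAt G η v + ξ := by
  funext u
  simp only [toppleAt, Pi.add_apply]
  split_ifs with h
  · subst h; omega
  · omega
  · omega

lemma topples_add {G : SimpleGraph V} {S : Set V} {η η1 : V → ℕ} {l : List V}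
    (h : Topples G S η l η1) (ξ : V → ℕ) : Topples G S (η + ξ) l (η1 + ξ) := by
  induction h with
  | nil η => exact Topples.nil _
  | @cons η η' l w hw hwge ht ih =>
    refine Topples.cons w hw (hwge.trans (by simp)) ?_
    rw [toppleAt_add G η ξ hwge]; exact ih

lemma exists_stab {G : SimpleGraph V} {S : Set V} (ξ : V → ℕ) (n : ℕ) :
    ∀ (η η2 : V → ℕ) (l : List V), l.length = n → Topples G S (η + ξ) l η2 → Stable G S η2 →
    ∃ η', StabilizesTo G S η η' := by
  induction n with
  | zero =>
    intro η η2 l hl ht hs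
    have : l = [] := List.length_eq_zero_iff.mp hl
    subst this
    cases ht
    refine ⟨η, [], Topples.nil _, fun v hv => ?_⟩
    have := hs v hv
    simp only [Pi.add_apply] at this
    omega
  | succ n ih =>
    intro η η2 l hl ht hs
    by_cases hst : Stable G S η
    · exact ⟨η, [], Topples.nil _, hst⟩
    · unfold Stable at hst
      push Not at hst
      obtain ⟨v, hv, hge⟩ := hst
      obtain ⟨l', hl', ht'⟩ := one_step ht hs v hv (hge.trans (by simp))
      rw [toppleAt_add G η ξ hge] at ht'
      obtain ⟨η', m, hm, hs'⟩ := ih _ _ l' (by omega) ht' hs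
      exact ⟨η', v :: m, Topples.cons v hv hge hm, hs'⟩

lemma topples_congr {G : SimpleGraph V} {S : Set V} {η η1 : V → ℕ} {l : List V}
    (h : Topples G S η l η1) : ∀ (ζ : V → ℕ), (∀ v, v ∉ S → ζ v = η v) →
    ∃ ζ1, Topples G S ζ l ζ1 ∧ ∀ v, v ∉ S → ζ1 v = η1 v := by
  induction h with
  | nil η => exact fun ζ h => ⟨ζ, Topples.nil _, h⟩
  | @cons η η' l w hw hwge ht ih =>
    intro ζ hζ
    obtain ⟨ζ1, h1, h2⟩ := ih (toppleAt G ζ w) (by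
      intro v hv
      simp only [toppleAt, hζ v hv, hζ w hw])
    exact ⟨ζ1, Topples.cons w hw (by rw [hζ w hw]; exact hwge) h1, h2⟩

lemma stab_congr {G : SimpleGraph V} {S : Set V} {η η1 : V → ℕ}
    (h : StabilizesTo G S η η1) (ζ : V → ℕ) (hζ : ∀ v, v ∉ S → ζ v = η v) :
    ∃ ζ1, StabilizesTo G S ζ ζ1 ∧ ∀ v, v ∉ S → ζ1 v = η1 v := by
  obtain ⟨l, ht, hs⟩ := h
  obtain ⟨ζ1, h1, h2⟩ := topples_congr ht ζ hζ
  exact ⟨ζ1, ⟨l, h1, fun v hv => by rw [h2 v hv]; exact hs v hv⟩, h2⟩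

/-- Topple, then stabilize up to sinks. -/
lemma stab_after {G : SimpleGraph V} {S : Set V} {η η1 ζ ζ1 : V → ℕ} {l : List V}
    (ht : Topples G S η l η1) (he : ∀ v, v ∉ S → η1 v = ζ v) (h : StabilizesTo G S ζ ζ1) :
    ∃ X, StabilizesTo G S η X ∧ ∀ v, v ∉ S → X v = ζ1 v := by
  obtain ⟨X, ⟨m, hm, hs⟩, hX⟩ := stab_congr h η1 he
  exact ⟨X, ⟨l ++ m, trans' ht hm, hs⟩, hX⟩

lemma exists_topples {G : SimpleGraph V} {S : Set V} (l : List V) : ∀ (η : V → ℕ), l.Nodup →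
    (∀ v ∈ l, v ∉ S ∧ deg G v ≤ η v) → ∃ η', Topples G S η l η' := by
  induction l with
  | nil => exact fun η _ _ => ⟨η, Topples.nil _⟩
  | cons w l ih =>
    intro η hn h
    rw [List.nodup_cons] at hn
    obtain ⟨η', h'⟩ := ih (toppleAt G η w) hn.2 (by
      intro v hv
      have hvw : v ≠ w := fun e => hn.1 (e ▸ hv)
      exact ⟨(h v (by simp [hv])).1, (h v (by simp [hv])).2.trans (le_toppleAt G η hvw)⟩)
    exact ⟨η', Topples.cons w (h w (by simp)).1 (h w (by simp)).2 h'⟩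

lemma conservation {G : SimpleGraph V} {S : Set V} {η η1 : V → ℕ} {l : List V}
    (h : Topples G S η l η1) (u : V) :
    η1 u + l.count u * deg G u = η u + l.countP (fun v => decide (G.Adj v u)) := by
  induction h with
  | nil η => simp
  | @cons η η' l w hw hwge ht ih =>
    rw [List.count_cons, List.countP_cons]
    by_cases h : u = w
    · subst h
      simp only [toppleAt, if_true] at ih
      simp only [beq_self_eq_true, if_true, SimpleGraph.irrefl, decide_false]
      simp only [add_mul, one_mul, Bool.false_eq_true, if_false]
      omega
    · have h' : ¬ w = u := fun e => h e.symm
      simp only [toppleAt, if_neg h] at ih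
      simp only [beq_iff_eq, h', if_false, decide_eq_true_eq]
      simp only [add_zero]
      omega

lemma project {G : SimpleGraph V} (S : Set V) {η η1 : V → ℕ} {l : List V}
    (h : Topples G ∅ η l η1) : ∀ ζ : V → ℕ,
    (∀ v, v ∉ S → ζ v = η v + l.countP (fun b => decide (b ∈ S ∧ G.Adj b v))) →
    ∃ l' ζ', Topples G S ζ l' ζ' ∧ ∀ v, v ∉ S → ζ' v = η1 v := by
  induction h with
  | nil η => exact fun ζ h => ⟨[], ζ, Topples.nil _, by simpa using h⟩
  | @cons η η' l w hw hwge ht ih =>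
    intro ζ hζ
    by_cases hwS : w ∈ S
    · apply ih ζ
      intro v hv
      have hvw : v ≠ w := fun e => hv (e ▸ hwS)
      rw [hζ v hv, List.countP_cons]
      simp only [toppleAt, if_neg hvw, hwS, true_and, decide_eq_true_eq]
      omega
    · have hz : ∀ v, v ∉ S → ζ v = η v + l.countP (fun b => decide (b ∈ S ∧ G.Adj b v)) := by
        intro v hv
        rw [hζ v hv, List.countP_cons]
        simp [hwS]
      obtain ⟨l', ζ', h1, h2⟩ := ih (toppleAt G ζ w) (by
        intro v hv
        simp only [toppleAt]
        split_ifs with h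
        · subst h
          rw [hz v hv]; omega
        · rw [hz v hv]; omega
        · rw [hz v hv]; omega)
      exact ⟨w :: l', ζ', Topples.cons w hwS (by rw [hz w hwS]; omega) h1, h2⟩

lemma countP_mem (T : Finset V) (l : List V) :
    l.countP (fun b => decide (b ∈ T)) = ∑ b ∈ T, l.count b := by
  induction l with
  | nil => simp
  | cons w l ih =>
    rw [List.countP_cons, ih]
    simp only [List.count_cons, Finset.sum_add_distrib, beq_iff_eq, Finset.sum_ite_eq,
      decide_eq_true_eq]

lemma burn_s13 {G : SimpleGraph V} {S F : Set V} (hF : F.Finite) (hFS : ∀ v, v ∈ F ↔ v ∉ S)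
    (hfin : ∀ v ∈ F, (G.neighborSet v).Finite) (x : V → ℕ) (hx : ∀ v, v ∉ S → deg G v ≤ x v) :
    ∃ l η', Topples G S (x + idf G S) l η' ∧ ∀ v, v ∉ S → η' v = x v := by
  obtain ⟨η', h⟩ := exists_topples (G := G) (S := S) hF.toFinset.toList (x + idf G S)
    (Finset.nodup_toList _) (by
      intro v hv
      have hv' : v ∉ S := (hFS v).1 (by simpa using hv)
      exact ⟨hv', (hx v hv').trans (by simp)⟩)
  refine ⟨_, η', h, fun v hv => ?_⟩
  have hvF := (hFS v).2 hv
  have hc := conservation h v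
  have h1 : hF.toFinset.toList.count v = 1 :=
    List.count_eq_one_of_mem (Finset.nodup_toList _) (by simpa using hvF)
  have h2 : hF.toFinset.toList.countP (fun w => decide (G.Adj w v)) =
      (G.neighborSet v \ S).ncard := by
    have e : (G.neighborSet v \ S) = ((hF.toFinset.filter (fun w => G.Adj w v) : Finset V) : Set V) := by
      ext w
      simp [hFS, G.adj_comm, and_comm]
    rw [e, Set.ncard_coe_finset, List.countP_eq_length_filter, ← Finset.length_toList]
    apply List.Perm.length_eq
    rw [List.perm_ext_iff_of_nodup ((Finset.nodup_toList _).filter _) (Finset.nodup_toList _)]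
    intro a
    simp
  have h3 := Set.ncard_inter_add_ncard_sdiff_eq_ncard (G.neighborSet v) S (hfin v hvF)
  rw [h1, h2] at hc
  simp only [Pi.add_apply, idf, deg] at hc
  omega

lemma burn_iter {G : SimpleGraph V} {S F : Set V} (hF : F.Finite) (hFS : ∀ v, v ∈ F ↔ v ∉ S)
    (hfin : ∀ v ∈ F, (G.neighborSet v).Finite) (x Z : V → ℕ) (hx : ∀ v, v ∉ S → deg G v ≤ x v)
    (hZ : StabilizesTo G S x Z) (c : ℕ) :
    ∃ X, StabilizesTo G S (x + c • idf G S) X ∧ ∀ v, v ∉ S → X v = Z v := by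
  induction c with
  | zero => exact ⟨Z, by simpa using hZ, fun _ _ => rfl⟩
  | succ c ih =>
    obtain ⟨X, hX, hXZ⟩ := ih
    obtain ⟨l, η', ht, he⟩ := burn_s13 hF hFS hfin (x + c • idf G S)
      (fun v hv => (hx v hv).trans (by simp))
    obtain ⟨Y, hY, hYX⟩ := stab_after ht he hX
    refine ⟨Y, ?_, fun v hv => (hYX v hv).trans (hXZ v hv)⟩
    rw [succ_nsmul, ← add_assoc]; exact hY

end ASM

open ASM

/-- Let `G = (V, E)` be a connected graph and `B ⊆ V` a finite set of
vertices whose removal disconnects `G` into a finite graph `F` and a second (nonempty)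
graph `W` (so `V = F ∪ B ∪ W` with no edges between `F` and `W`).  Let `S` be the sandpile
system consisting of `F` together with the vertices of `B` declared as sinks (realized
here on the same vertex set by declaring all of `B ∪ W` to be sinks; since there are no
edges between `F` and `W` this is the graph `F` with `B` as sinks, as far as the vertices
of `F` are concerned).  Fix a configuration `ηF` supported on `F` and a configuration
`ηG` on `G`.  If `k ≥ N(F, ηF)` (i.e. the stabilization on `S` of `j • ηF` is recurrent
for every `j ≥ k`), stabilizing `k • ηF + ηG` on `G` is possible, and this stabilization
topples all the vertices of `B` equally often, then the stabilization on `G` and the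
stabilization on `S` agree at every vertex of `F`. -/
theorem sandpile_invariance_of_configuration
    {V : Type*} (G : SimpleGraph V) (hG : G.Connected)
    (B F W : Set V) (hBfin : B.Finite) (hFfin : F.Finite)
    (hFne : F.Nonempty) (hWne : W.Nonempty)
    (hcover : F ∪ B ∪ W = Set.univ)
    (hFB : Disjoint F B) (hFW : Disjoint F W) (hBW : Disjoint B W)
    (hsep : ∀ u ∈ F, ∀ w ∈ W, ¬ G.Adj u w)
    (ηF ηG : V → ℕ) (hsupp : ∀ v, v ∉ F → ηF v = 0)
    (k : ℕ)
    (hk : ∀ j : ℕ, k ≤ j → ∀ η' : V → ℕ,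
      StabilizesTo G (B ∪ W) (j • ηF) η' → Recurrent G (B ∪ W) η')
    (l : List V) (ηG' : V → ℕ)
    (hl : Topples G ∅ (k • ηF + ηG) l ηG') (hstab : Stable G ∅ ηG')
    (heq : ∃ c : ℕ, ∀ b ∈ B, l.count b = c) :
    ∀ ηS' : V → ℕ, StabilizesTo G (B ∪ W) (k • ηF + ηG) ηS' →
      ∀ v ∈ F, ηG' v = ηS' v := by
  intro ηS' hS v hv
  obtain ⟨c, hc⟩ := heq
  have hFS : ∀ v, v ∈ F ↔ v ∉ B ∪ W := by
    intro v
    have h := hcover ▸ Set.mem_univ v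
    constructor
    · rintro hF (h | h)
      · exact Set.disjoint_left.1 hFB hF h
      · exact Set.disjoint_left.1 hFW hF h
    · intro hn
      rcases h with (h | h) | h
      · exact h
      · exact absurd (Or.inl h) hn
      · exact absurd (Or.inr h) hn
  have hfin : ∀ v ∈ F, (G.neighborSet v).Finite := by
    intro v hv
    refine (hFfin.union hBfin).subset fun w hw => ?_
    rcases hcover ▸ Set.mem_univ w with h | h
    · exact h
    · exact absurd hw (hsep v hv w h)
  -- the stabilization of `k • ηF`
  obtain ⟨η, u0, hu0, hηs⟩ : ∃ η, StabilizesTo G (B ∪ W) (k • ηF) η := by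
    obtain ⟨m, hm, hs⟩ := hS
    exact exists_stab ηG _ _ _ m rfl hm hs
  obtain ⟨-, hrec⟩ := hk k le_rfl η ⟨u0, hu0, hηs⟩
  obtain ⟨τ, η', ⟨q, hq, -⟩, hη'⟩ := hrec (deg G)
  have hS1 : StabilizesTo G (B ∪ W) (η + ηG) ηS' := confl (topples_add hu0 ηG) hS
  obtain ⟨X, hX, hXS⟩ := stab_after (topples_add hq ηG)
    (fun v hv => by simp only [Pi.add_apply, hη' v hv]) hS1
  obtain ⟨X', hX', hXX⟩ := burn_iter hFfin hFS hfin (deg G + τ + ηG) X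
    (fun v _ => by simp only [Pi.add_apply]; omega) hX c
  -- the projection of the stabilization on `G`
  obtain ⟨l', Y, hY, hYG⟩ := project (B ∪ W) hl (k • ηF + ηG + c • idf G (B ∪ W)) (by
    intro v hv
    have hvF := (hFS v).2 hv
    have hf : (G.neighborSet v ∩ (B ∪ W)).Finite := (hfin v hvF).inter_of_left _
    rw [List.countP_congr (q := fun b => decide (b ∈ hf.toFinset)) (by
      intro b _
      simp [G.adj_comm, and_comm])]
    have e2 : ∑ b ∈ hf.toFinset, l.count b = ∑ b ∈ hf.toFinset, c := by
      refine Finset.sum_congr rfl fun b hb => hc b ?_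
      rw [Set.Finite.mem_toFinset] at hb
      rcases hb.2 with h | h
      · exact h
      · exact absurd hb.1 (hsep v hvF b h)
    rw [countP_mem, e2, Finset.sum_const, ← Set.ncard_eq_toFinset_card _ hf]
    simp [idf, mul_comm])
  have hYs : StabilizesTo G (B ∪ W) (k • ηF + ηG + c • idf G (B ∪ W)) Y :=
    ⟨l', hY, fun v hv => by rw [hYG v hv]; exact hstab v (by simp)⟩
  have hY1 : StabilizesTo G (B ∪ W) (η + ηG + c • idf G (B ∪ W)) Y :=
    confl (topples_add (topples_add hu0 ηG) _) hYs
  obtain ⟨Z, hZ, hZY⟩ := stab_after (topples_add (topples_add hq ηG) (c • idf G (B ∪ W)))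
    (fun v hv => by simp only [Pi.add_apply, hη' v hv]) hY1
  have hv' := (hFS v).1 hv
  rw [← hYG v hv', ← hZY v hv', stab_unique hZ hX', hXX v hv', hXS v hv']
end
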